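/- arXiv:2505.09797 — 2 statements merged into one kernel-verified Lean document; each statement's English description precedes it below -/
import Mathlib

section
/- Let F be a finite field of odd characteristic and τ : F → F a field automorphism with τ∘τ = id, applied entrywise to matrices. Let ρ be an irreducible cuspidal complex representation of GL_r(F) whose character satisfies χ_ρ(τ(g)) = χ_ρ(g⁻¹) for all g ∈ GL_r(F). Then for every k ≥ 1, every irreducible constituent π of the parabolic induction of ρ^{⊗k} to GL_{rk}(F) satisfies χ_π(τ(g)) = χ_π(g⁻¹) for all g ∈ GL_{rk}(F). -/
open Matrix

/-- A representation is irreducible if the space is nonzero and the only invariant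
subspaces are `⊥` and `⊤`. -/
def IsIrred {G V : Type*} [Group G] [AddCommGroup V] [Module ℂ V]
    (ρ : Representation ℂ G V) : Prop :=
  (∃ v : V, v ≠ 0) ∧
    ∀ W : Submodule ℂ V, (∀ (g : G), ∀ v ∈ W, ρ g v ∈ W) → W = ⊥ ∨ W = ⊤

/-- `M` lies in the block upper unitriangular group `U(n_1, …, n_m)` associated to the
composition encoded by the monotone surjection `b : Fin n → Fin m`. -/
def IsBlockUnitri {n m : ℕ} {F : Type*} [Field F] (b : Fin n → Fin m)
    (M : Matrix (Fin n) (Fin n) F) : Prop :=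
  ∀ i j : Fin n, b j ≤ b i → M i j = if i = j then 1 else 0

/-- A representation `ρ` of `GL_n(F)` is cuspidal if for every composition of `n` with
at least two parts, the subspace of vectors fixed by the corresponding block
unitriangular group is zero. -/
def IsCuspidal {n : ℕ} {F : Type*} [Field F] [Fintype F] {V : Type*}
    [AddCommGroup V] [Module ℂ V] (ρ : Representation ℂ (GL (Fin n) F) V) : Prop :=
  ∀ m : ℕ, 2 ≤ m → ∀ b : Fin n → Fin m, Monotone b → Function.Surjective b →
    ∀ v : V,
      (∀ u : GL (Fin n) F, IsBlockUnitri b (u : Matrix (Fin n) (Fin n) F) → ρ u v = v) →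
      v = 0

/-- The position of the `a`-th entry of the `i`-th block, for `k` blocks of size `r`. -/
def emb {k r : ℕ} (i : Fin k) (a : Fin r) : Fin (k * r) :=
  ⟨(i : ℕ) * r + (a : ℕ), by
    have hi : (i : ℕ) + 1 ≤ k := i.2
    have ha : (a : ℕ) < r := a.2
    calc (i : ℕ) * r + (a : ℕ) < ((i : ℕ) + 1) * r := by nlinarith
      _ ≤ k * r := Nat.mul_le_mul_right r hi⟩

/-- `M` is block upper triangular for `k` diagonal blocks of size `r`. -/
def IsParab {k r : ℕ} {F : Type*} [Field F] (M : Matrix (Fin (k * r)) (Fin (k * r)) F) :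
    Prop :=
  ∀ (i j : Fin k) (a b : Fin r), j < i → M (emb i a) (emb j b) = 0

/-- `T` intertwines the restriction of `π` to the block upper triangular parabolic `P`
(with `k` blocks of size `r`) with the inflation to `P` of `ρ^{⊗k}`; the existence of
a nonzero such `T` says exactly (by Frobenius reciprocity) that the irreducible `π` is
a constituent of the parabolic induction of `ρ^{⊗k}` to `GL_{rk}(F)`. -/
def IntertwinesParab {k r : ℕ} {F : Type*} [Field F] [Fintype F]
    {V Vπ : Type*} [AddCommGroup V] [Module ℂ V] [AddCommGroup Vπ] [Module ℂ Vπ]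
    (ρ : Representation ℂ (GL (Fin r) F) V)
    (π : Representation ℂ (GL (Fin (k * r)) F) Vπ)
    (T : Vπ →ₗ[ℂ] PiTensorProduct ℂ (fun _ : Fin k => V)) : Prop :=
  ∀ p : GL (Fin (k * r)) F, IsParab (p : Matrix (Fin (k * r)) (Fin (k * r)) F) →
    ∀ d : Fin k → GL (Fin r) F,
      (∀ (i : Fin k) (a b : Fin r), (d i : Matrix (Fin r) (Fin r) F) a b =
        (p : Matrix (Fin (k * r)) (Fin (k * r)) F) (emb i a) (emb i b)) →
      ∀ v : Vπ, T (π p v) = PiTensorProduct.map (fun i => ρ (d i)) (T v)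

section Irreducible

variable {G V : Type*} [Group G] [AddCommGroup V] [Module ℂ V]

theorem IsIrred.isIrreducible {ρ : Representation ℂ G V} (h : IsIrred ρ) :
    ρ.IsIrreducible := by
  obtain ⟨⟨v, hv⟩, h⟩ := h
  refine { exists_pair_ne := ⟨⊥, ⊤, fun e => hv ?_⟩, eq_bot_or_eq_top := fun a => ?_ }
  · have : v ∈ (⊤ : Subrepresentation ρ).toSubmodule := Submodule.mem_top
    rw [← e] at this
    exact (Submodule.mem_bot ℂ).1 this
  · refine (h a.toSubmodule fun g v hv => a.apply_mem_toSubmodule g hv).imp ?_ ?_ <;>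
      exact fun e => Subrepresentation.toSubmodule_injective e

/-- Burnside's theorem: the operators of an irreducible representation span all operators. -/
theorem IsIrred.exists_eq_sum [Fintype G] [FiniteDimensional ℂ V] {ρ : Representation ℂ G V}
    (h : IsIrred ρ) (A : V →ₗ[ℂ] V) : ∃ c : G → ℂ, A = ∑ g, c g • ρ g := by
  classical
  have := h.isIrreducible
  have hs : IsSimpleModule (MonoidAlgebra ℂ G) ρ.asModule := inferInstance
  have hb := IsSimpleModule.algebraMap_end_bijective_of_isAlgClosed ℂ (A := MonoidAlgebra ℂ G)
    (V := ρ.asModule)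
  let f : Module.End (Module.End (MonoidAlgebra ℂ G) ρ.asModule) ρ.asModule :=
    { toFun := fun x => ρ.asModuleEquiv.symm (A (ρ.asModuleEquiv x))
      map_add' := by simp
      map_smul' := fun m x => by
        obtain ⟨z, rfl⟩ := hb.2 m
        have e : ∀ y : ρ.asModule,
            (algebraMap ℂ (Module.End (MonoidAlgebra ℂ G) ρ.asModule)) z • y = z • y :=
          fun y => rfl
        rw [e]
        simp [e] }
  let b := Module.finBasis ℂ V
  obtain ⟨r, hr⟩ := jacobson_density f (Finset.univ.image fun i => ρ.asModuleEquiv.symm (b i))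
  refine ⟨fun g => r.coeff g, b.ext fun i => ?_⟩
  have h1 := hr (ρ.asModuleEquiv.symm (b i)) (by simp)
  have h2 := congrArg ρ.asModuleEquiv h1
  rw [ρ.asModuleEquiv_map_smul] at h2
  have h3 : A (b i) = ρ.asAlgebraHom r (b i) := h2
  rw [h3, Representation.asAlgebraHom_def, MonoidAlgebra.lift_apply,
    Finsupp.sum_fintype _ _ (by simp)]

theorem IsIrred.exists_intertwiner [Fintype G] [FiniteDimensional ℂ V]
    {ρ σ : Representation ℂ G V} (hρ : IsIrred ρ) (hσ : IsIrred σ)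
    (h : ∀ g, LinearMap.trace ℂ V (ρ g) = LinearMap.trace ℂ V (σ g)) :
    ∃ A : V ≃ₗ[ℂ] V, ∀ g v, A (ρ g v) = σ g (A v) := by
  have := hρ.isIrreducible
  have := hσ.isIrreducible
  have : Invertible (Nat.card G : ℂ) := invertibleOfNonzero (by simp)
  have e : σ.character = ρ.character := funext fun g => (h g).symm
  have h1 := Representation.char_orthonormal ρ ρ
  have h2 := Representation.char_orthonormal σ ρ
  rw [e, h1, if_pos ⟨Representation.Equiv.refl ρ⟩] at h2
  by_cases hn : Nonempty (Representation.Equiv ρ σ)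
  · obtain ⟨φ⟩ := hn
    exact ⟨φ.toLinearEquiv, fun g v => LinearMap.congr_fun (φ.isIntertwining' g) v⟩
  · rw [if_neg hn] at h2
    exact absurd h2 one_ne_zero

end Irreducible

section Average

variable {G V : Type*} [Group G] [AddCommGroup V] [Module ℂ V]

/-- The average of the operators of a representation over a subgroup. -/
noncomputable def subgroupAverage (π : Representation ℂ G V) (U : Subgroup G) : V →ₗ[ℂ] V :=
  (Nat.card U : ℂ)⁻¹ • ∑ᶠ u : U, π u

variable (π : Representation ℂ G V) {U U₁ U₂ : Subgroup G}

theorem subgroupAverage_apply [Fintype U] (v : V) :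
    subgroupAverage π U v = (Nat.card U : ℂ)⁻¹ • ∑ u : U, π u v := by
  simp [subgroupAverage, finsum_eq_sum_of_fintype]

theorem card_smul_subgroupAverage [Fintype U] (v : V) :
    (Nat.card U : ℂ) • subgroupAverage π U v = ∑ u : U, π u v := by
  rw [subgroupAverage_apply, smul_smul, mul_inv_cancel₀, one_smul]
  simp

variable [Finite G]

theorem subgroupAverage_of_fixed {v : V} (h : ∀ u ∈ U, π u v = v) :
    subgroupAverage π U v = v := by
  have := Fintype.ofFinite U
  have e : ∑ u : U, π u v = (Nat.card U : ℂ) • v := by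
    rw [Finset.sum_congr rfl fun (u : U) _ => h u u.2]
    simp [Nat.cast_smul_eq_nsmul]
  rw [subgroupAverage_apply, e, smul_smul, inv_mul_cancel₀, one_smul]
  simp

theorem apply_subgroupAverage {u : G} (hu : u ∈ U) (v : V) :
    π u (subgroupAverage π U v) = subgroupAverage π U v := by
  have := Fintype.ofFinite U
  rw [subgroupAverage_apply, map_smul, map_sum]
  congr 1
  refine Fintype.sum_equiv (Equiv.mulLeft (⟨u, hu⟩ : U)) _ _ fun x => ?_
  simp

theorem subgroupAverage_apply_of_mem {u : G} (hu : u ∈ U) (v : V) :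
    subgroupAverage π U (π u v) = subgroupAverage π U v := by
  have := Fintype.ofFinite U
  rw [subgroupAverage_apply, subgroupAverage_apply]
  congr 1
  refine Fintype.sum_equiv (Equiv.mulRight (⟨u, hu⟩ : U)) _ _ fun x => ?_
  simp

theorem apply_subgroupAverage_conj {g : G} (h : ∀ u, g * u * g⁻¹ ∈ U₂ ↔ u ∈ U₁) (v : V) :
    π g (subgroupAverage π U₁ v) = subgroupAverage π U₂ (π g v) := by
  have := Fintype.ofFinite U₁
  have := Fintype.ofFinite U₂
  let e : U₁ ≃ U₂ :=
    { toFun := fun u => ⟨g * u * g⁻¹, (h u).2 u.2⟩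
      invFun := fun u => ⟨g⁻¹ * u * g, (h _).1 (by convert u.2 using 1; group)⟩
      left_inv := fun u => Subtype.ext (by simp; group)
      right_inv := fun u => Subtype.ext (by simp; group) }
  rw [subgroupAverage_apply, subgroupAverage_apply, map_smul, map_sum, Nat.card_congr e]
  congr 1
  refine Fintype.sum_equiv e _ _ fun x => ?_
  simp only [e, Equiv.coe_fn_mk, ← Module.End.mul_apply, ← map_mul]
  congr 2
  group

theorem subgroupAverage_eq_comp (h₁ : U₁ ≤ U) (h₂ : U₂ ≤ U) (hd : U₁ ⊓ U₂ = ⊥)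
    (hc : Nat.card U = Nat.card U₁ * Nat.card U₂) (v : V) :
    subgroupAverage π U v = subgroupAverage π U₁ (subgroupAverage π U₂ v) := by
  have := Fintype.ofFinite U
  have := Fintype.ofFinite U₁
  have := Fintype.ofFinite U₂
  let f : U₁ × U₂ → U := fun x => ⟨x.1 * x.2, U.mul_mem (h₁ x.1.2) (h₂ x.2.2)⟩
  have hf : Function.Injective f := by
    intro x y hxy
    have hxy : (x.1 * x.2 : G) = y.1 * y.2 := congrArg Subtype.val hxy
    have hq : (y.1 : G)⁻¹ * x.1 = y.2 * (x.2 : G)⁻¹ := by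
      rw [inv_mul_eq_iff_eq_mul, ← mul_assoc, ← hxy, mul_inv_cancel_right]
    have hm : (y.1 : G)⁻¹ * x.1 ∈ U₁ ⊓ U₂ :=
      ⟨U₁.mul_mem (U₁.inv_mem y.1.2) x.1.2, hq ▸ U₂.mul_mem y.2.2 (U₂.inv_mem x.2.2)⟩
    rw [hd, Subgroup.mem_bot] at hm
    have h1 : (x.1 : G) = y.1 := (inv_mul_eq_one.1 hm).symm
    rw [hm] at hq
    have h2 : (x.2 : G) = y.2 := (mul_inv_eq_one.1 hq.symm).symm
    exact Prod.ext (Subtype.ext h1) (Subtype.ext h2)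
  have hb : Function.Bijective f :=
    (Fintype.bijective_iff_injective_and_card f).2
      ⟨hf, by rw [Fintype.card_prod]; simpa using hc.symm⟩
  rw [subgroupAverage_apply, subgroupAverage_apply, hc,
    ← Fintype.sum_equiv (Equiv.ofBijective f hb) (fun x => π (x.1 * x.2) v) _ fun x => rfl,
    Fintype.sum_prod_type]
  simp only [subgroupAverage_apply, map_smul, map_sum, map_mul, Module.End.mul_apply,
    Nat.cast_mul, mul_inv, smul_smul, ← Finset.smul_sum]

theorem subgroupAverage_absorb (h : U₁ ≤ U) (v : V) :
    subgroupAverage π U (subgroupAverage π U₁ v) = subgroupAverage π U v := by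
  have := Fintype.ofFinite U₁
  rw [subgroupAverage_apply (U := U₁), map_smul, map_sum,
    Finset.sum_congr rfl fun (u : U₁) _ => subgroupAverage_apply_of_mem π (h u.2) v]
  rw [Finset.sum_const, Finset.card_univ, ← Nat.cast_smul_eq_nsmul ℂ, smul_smul,
    Fintype.card_eq_nat_card, inv_mul_cancel₀, one_smul]
  simp

end Average

section TransposeConjugate

open Polynomial

variable {K : Type*} [Field K]

theorem exists_functional_of_prime_pow {p : K[X]} (hp : Irreducible p) (e : ℕ) :
    ∃ l : (K[X] ⧸ Ideal.span {p ^ e}) →ₗ[K] K, ∀ x, x ≠ 0 → ∃ y, l (x * y) ≠ 0 := by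
  classical
  rcases Nat.eq_zero_or_pos e with rfl | he
  · refine ⟨0, fun x hx => absurd ?_ hx⟩
    obtain ⟨g, rfl⟩ := Ideal.Quotient.mk_surjective x
    exact Ideal.Quotient.eq_zero_iff_mem.2 (by simp)
  have hp0 : p ≠ 0 := hp.ne_zero
  have hne : (Ideal.Quotient.mk (Ideal.span {p ^ e}) (p ^ (e - 1))) ≠ 0 := by
    rw [Ne, Ideal.Quotient.eq_zero_iff_mem, Ideal.mem_span_singleton,
      pow_dvd_pow_iff hp0 hp.not_isUnit]
    omega
  obtain ⟨l, hl⟩ := Module.Projective.exists_dual_ne_zero K hne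
  refine ⟨l, fun x hx => ?_⟩
  obtain ⟨g, rfl⟩ := Ideal.Quotient.mk_surjective x
  rw [Ne, Ideal.Quotient.eq_zero_iff_mem, Ideal.mem_span_singleton] at hx
  obtain ⟨j, hj, hja⟩ := (dvd_prime_pow hp.prime e).1 (EuclideanDomain.gcd_dvd_right g (p ^ e))
  have hje : j < e := by
    rcases hj.lt_or_eq with h | rfl
    · exact h
    · exact absurd (hja.symm.dvd.trans (EuclideanDomain.gcd_dvd_left _ _)) hx
  obtain ⟨u, hu⟩ := hja
  have hb := EuclideanDomain.gcd_eq_gcd_ab g (p ^ e)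
  refine ⟨Ideal.Quotient.mk _ (EuclideanDomain.gcdA g (p ^ e) * u * p ^ (e - 1 - j)), ?_⟩
  convert hl using 2
  rw [← map_mul, Ideal.Quotient.mk_eq_mk_iff_sub_mem, Ideal.mem_span_singleton]
  refine ⟨- (EuclideanDomain.gcdB g (p ^ e) * u * p ^ (e - 1 - j)), ?_⟩
  have he1 : p ^ (e - 1) = p ^ j * p ^ (e - 1 - j) := by
    rw [← pow_add]; congr 1; omega
  rw [he1, ← hu, hb]
  ring

theorem exists_nondegenerate_selfAdjoint_form {V : Type*} [AddCommGroup V] [Module K V]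
    [FiniteDimensional K V] (f : V →ₗ[K] V) :
    ∃ B : V →ₗ[K] V →ₗ[K] K, (∀ x y, B (f x) y = B x (f y)) ∧
      ∀ x, (∀ y, B x y = 0) → x = 0 := by
  classical
  obtain ⟨ι, _, p, hp, e, ⟨φ⟩⟩ := Module.equiv_directSum_of_isTorsion
    (R := K[X]) (M := Module.AEval' f) (Module.AEval.isTorsion_of_finiteDimensional K V f)
  choose l hl using fun i => exists_functional_of_prime_pow (hp i) (e i)
  let c : ∀ i, Module.AEval' f →ₗ[K[X]] K[X] ⧸ Ideal.span {p i ^ e i} := fun i =>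
    (DirectSum.component K[X] ι (fun i => K[X] ⧸ Ideal.span {p i ^ e i}) i).comp φ.toLinearMap
  have hc : ∀ x, (∀ i, c i x = 0) → x = 0 := fun x hx =>
    φ.map_eq_zero_iff.1 (DFinsupp.ext hx)
  have hs : ∀ i (z : K[X] ⧸ Ideal.span {p i ^ e i}), ∃ x, c i x = z ∧ ∀ j, j ≠ i → c j x = 0 := by
    intro i z
    refine ⟨φ.symm (DirectSum.lof K[X] ι (fun i => K[X] ⧸ Ideal.span {p i ^ e i}) i z), ?_, ?_⟩
    · simp [c]
    · intro j hj
      simp [c, DirectSum.component.of, hj.symm]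
  let o := Module.AEval'.of f
  refine ⟨LinearMap.mk₂ K (fun x y => ∑ i, l i (c i (o x) * c i (o y))) ?_ ?_ ?_ ?_, ?_, ?_⟩
  · intro x x' y
    simp [add_mul, Finset.sum_add_distrib]
  · intro a x y
    simp only [map_smul, LinearMap.map_smul_of_tower, smul_mul_assoc,
      Finset.smul_sum]
  · intro x x' y
    simp [mul_add, Finset.sum_add_distrib]
  · intro a x y
    simp only [map_smul, LinearMap.map_smul_of_tower, mul_smul_comm,
      Finset.smul_sum]
  · intro x y
    simp only [LinearMap.mk₂_apply, o, ← Module.AEval'.X_smul_of, map_smul, smul_mul_assoc,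
      mul_smul_comm]
  · intro x hx
    refine (Module.AEval'.of f).map_eq_zero_iff.1 (hc _ fun i => ?_)
    by_contra hne
    obtain ⟨z, hz⟩ := hl i _ hne
    obtain ⟨y, hy, hy'⟩ := hs i z
    have h := hx (o.symm y)
    simp only [LinearMap.mk₂_apply, LinearEquiv.apply_symm_apply] at h
    rw [Finset.sum_eq_single i (fun j _ hj => by simp [hy' j hj]) (by simp), hy] at h
    exact hz h

theorem exists_conj_eq_transpose {n : Type*} [Fintype n] [DecidableEq n] (g : GL n K) :
    ∃ p : GL n K, (p : Matrix n n K) * (g : Matrix n n K) * (p⁻¹ : GL n K) =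
      (g : Matrix n n K)ᵀ := by
  obtain ⟨B, hB, hn⟩ := exists_nondegenerate_selfAdjoint_form (toLin' (g : Matrix n n K))
  let P : Matrix n n K := LinearMap.toMatrix₂' K B
  have hP : ∀ x y, B x y = x ⬝ᵥ P *ᵥ y := fun x y => by
    rw [← Matrix.toLinearMap₂'_apply', Matrix.toLinearMap₂'_toMatrix']
  have hdet : IsUnit P := by
    rw [← Matrix.isUnit_transpose, ← Matrix.mulVec_injective_iff_isUnit]
    refine (injective_iff_map_eq_zero (Pᵀ.mulVecLin)).2 fun x hx => hn x fun y => ?_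
    rw [hP, dotProduct_mulVec, ← mulVec_transpose]
    rw [mulVecLin_apply] at hx
    rw [hx, zero_dotProduct]
  have hc : (g : Matrix n n K)ᵀ * P = P * g := by
    refine Matrix.ext_of_mulVec_single fun j => funext fun i => ?_
    have h := hB (Pi.single i 1) (Pi.single j 1)
    rw [hP, hP, toLin'_apply, toLin'_apply, dotProduct_mulVec,  mulVec_mulVec] at h
    rw [← mulVec_transpose, mulVec_mulVec, dotProduct_mulVec] at h
    have e : Pᵀ * (g : Matrix n n K) = ((g : Matrix n n K)ᵀ * P)ᵀ := by
      rw [transpose_mul, transpose_transpose]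
    rw [e, mulVec_transpose, single_one_vecMul, single_one_vecMul, dotProduct_single_one,
      dotProduct_single_one] at h
    rw [mulVec_single_one, mulVec_single_one]
    exact h
  refine ⟨hdet.unit, ?_⟩
  rw [IsUnit.unit_spec, ← hc, mul_assoc]
  have h := hdet.unit.mul_inv
  rw [IsUnit.unit_spec] at h
  rw [h, mul_one]

end TransposeConjugate

section OrderUnipotent

variable {K R : Type*} [Fintype K] [DecidableEq K] [Ring R]

/-- A relation is a strict partial order. -/
structure IsStrictRel (D : K → K → Prop) : Prop where
  irrefl : ∀ i, ¬ D i i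
  trans : ∀ i j l, D i j → D j l → D i l

/-- The group of invertible matrices over `R` with `1` on the diagonal whose off-diagonal entries
are supported on the strict partial order `D`. -/
def orderUnipotent (R : Type*) [Ring R] (D : K → K → Prop) : Subgroup (Matrix K K R)ˣ :=
  Subgroup.closure {g | ∀ i j, ¬ D i j → (g : Matrix K K R) i j = (1 : Matrix K K R) i j}

variable [Finite R] {D D₁ D₂ : K → K → Prop}

theorem mem_orderUnipotent (hD : IsStrictRel D) {g : (Matrix K K R)ˣ} :
    g ∈ orderUnipotent R D ↔
      ∀ i j, ¬ D i j → (g : Matrix K K R) i j = (1 : Matrix K K R) i j := by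
  have : Finite (Matrix K K R) := inferInstanceAs (Finite (K → K → R))
  refine ⟨fun h => ?_, fun h => Subgroup.subset_closure h⟩
  have hm : g ∈ (orderUnipotent R D).toSubmonoid := h
  clear h
  rw [orderUnipotent, Subgroup.closure_toSubmonoid_of_finite] at hm
  induction hm using Submonoid.closure_induction with
  | mem x hx => exact hx
  | one => intros; rfl
  | mul x y _ _ hx hy =>
    intro i j hij
    rw [Units.val_mul, Matrix.mul_apply, Finset.sum_eq_single i, hx i i (hD.irrefl i), hy i j hij,
      one_apply_eq, one_mul]
    · intro l _ hl
      by_cases hil : D i l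
      · have hlj : ¬ D l j := fun h => hij (hD.trans _ _ _ hil h)
        have hne : l ≠ j := by rintro rfl; exact hij hil
        rw [hy l j hlj, one_apply_ne hne, mul_zero]
      · rw [hx i l hil, one_apply_ne hl.symm, zero_mul]
    · simp

theorem orderUnipotent_mono (hD : IsStrictRel D) (h₁ : IsStrictRel D₁)
    (h : ∀ i j, D₁ i j → D i j) : orderUnipotent R D₁ ≤ orderUnipotent R D := fun _ hg =>
  (mem_orderUnipotent hD).2 fun i j hij => (mem_orderUnipotent h₁).1 hg i j fun h' => hij (h i j h')

theorem orderUnipotent_inf (h₁ : IsStrictRel D₁) (h₂ : IsStrictRel D₂)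
    (h : ∀ i j, D₁ i j → ¬ D₂ i j) : orderUnipotent R D₁ ⊓ orderUnipotent R D₂ = ⊥ := by
  refine le_antisymm (fun g hg => ?_) bot_le
  rw [Subgroup.mem_bot]
  refine Units.ext (Matrix.ext fun i j => ?_)
  by_cases hij : D₁ i j
  · exact (mem_orderUnipotent h₂).1 hg.2 i j (h i j hij)
  · exact (mem_orderUnipotent h₁).1 hg.1 i j hij

theorem isUnit_of_strict (hD : IsStrictRel D) (X : Matrix K K R)
    (hX : ∀ i j, ¬ D i j → X i j = (1 : Matrix K K R) i j) : IsUnit X := by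
  have : Finite (Matrix K K R) := inferInstanceAs (Finite (K → K → R))
  refine IsLeftRegular.isUnit_of_finite ?_
  rw [isLeftRegular_iff_right_eq_zero_of_mul]
  intro A hA
  have hwf : WellFounded (fun i j => D j i) := by
    have : IsTrans K (fun i j => D j i) := ⟨fun a b c h h' => hD.trans _ _ _ h' h⟩
    have : Std.Irrefl (fun i j => D j i) := ⟨fun a => hD.irrefl a⟩
    exact Finite.wellFounded_of_trans_of_irrefl _
  refine Matrix.ext fun i => ?_
  induction i using hwf.induction with
  | _ i ih =>
    intro j
    have h := congrFun (congrFun hA i) j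
    rw [Matrix.mul_apply, Finset.sum_eq_single i, hX i i (hD.irrefl i), one_apply_eq,
      one_mul] at h
    · exact h
    · intro l _ hl
      by_cases hil : D i l
      · rw [ih l hil j, Matrix.zero_apply, mul_zero]
      · rw [hX i l hil, one_apply_ne hl.symm, zero_mul]
    · simp

theorem card_orderUnipotent (hD : IsStrictRel D) :
    Nat.card (orderUnipotent R D) = Nat.card R ^ Nat.card {x : K × K // D x.1 x.2} := by
  classical
  rw [← Nat.card_fun]
  have hX : ∀ (f : {x : K × K // D x.1 x.2} → R) i j, ¬ D i j →
      (Matrix.of fun i j => if h : D i j then f ⟨(i, j), h⟩ else (1 : Matrix K K R) i j) i j =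
        (1 : Matrix K K R) i j := fun f i j hij => by simp [hij]
  refine Nat.card_congr
    { toFun := fun g x => ((g : (Matrix K K R)ˣ) : Matrix K K R) x.1.1 x.1.2
      invFun := fun f => ⟨(isUnit_of_strict hD _ (hX f)).unit, (mem_orderUnipotent hD).2 (hX f)⟩
      left_inv := fun g => ?_
      right_inv := fun f => ?_ }
  · refine Subtype.ext (Units.ext (Matrix.ext fun i j => ?_))
    rw [IsUnit.unit_spec, of_apply]
    split_ifs with h
    · rfl
    · exact ((mem_orderUnipotent hD).1 g.2 i j h).symm
  · funext x
    simp [x.2]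

variable {V : Type*} [AddCommGroup V] [Module ℂ V] (π : Representation ℂ (Matrix K K R)ˣ V)

theorem average_orderUnipotent_eq_comp (hD : IsStrictRel D) (h₁ : IsStrictRel D₁)
    (h₂ : IsStrictRel D₂) (h : ∀ i j, D i j ↔ D₁ i j ∨ D₂ i j) (hd : ∀ i j, D₁ i j → ¬ D₂ i j)
    (v : V) :
    subgroupAverage π (orderUnipotent R D) v =
      subgroupAverage π (orderUnipotent R D₁) (subgroupAverage π (orderUnipotent R D₂) v) := by
  classical
  have : Finite (Matrix K K R) := inferInstanceAs (Finite (K → K → R))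
  refine subgroupAverage_eq_comp π
    (orderUnipotent_mono hD h₁ fun i j hij => (h i j).2 (Or.inl hij))
    (orderUnipotent_mono hD h₂ fun i j hij => (h i j).2 (Or.inr hij))
    (orderUnipotent_inf h₁ h₂ hd) ?_ v
  rw [card_orderUnipotent hD, card_orderUnipotent h₁, card_orderUnipotent h₂, ← pow_add]
  congr 1
  rw [← Nat.card_sum, Nat.card_congr (Equiv.subtypeEquivRight fun x : K × K => h x.1 x.2)]
  exact Nat.card_congr (subtypeOrEquiv (fun x : K × K => D₁ x.1 x.2) (fun x => D₂ x.1 x.2)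
    (Pi.disjoint_iff.2 fun x => Prop.disjoint_iff.2 (by
      by_contra hh
      have := hd x.1 x.2
      tauto)))

end OrderUnipotent

section Elementary

section Pair

variable {K : Type*}

/-- The relation whose only related pair is `(i, j)`. -/
def pairRel (i j : K) : K → K → Prop := fun a b => a = i ∧ b = j

theorem isStrictRel_pairRel {i j : K} (h : i ≠ j) : IsStrictRel (pairRel i j) where
  irrefl a := by rintro ⟨rfl, rfl⟩; exact h rfl
  trans a b c := by rintro ⟨rfl, rfl⟩ ⟨rfl, rfl⟩; exact ⟨rfl, rfl⟩

end Pair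

variable {K R : Type*} [Fintype K] [DecidableEq K] [Ring R]

/-- The invertible block diagonal matrix with given invertible diagonal blocks. -/
def blockDiagUnit : (K → Rˣ) →* (Matrix K K R)ˣ :=
  (Units.map (Matrix.diagonalRingHom K R : (K → R) →* Matrix K K R)).comp
    MulEquiv.piUnits.symm.toMonoidHom

theorem blockDiagUnit_val (d : K → Rˣ) :
    (blockDiagUnit d : Matrix K K R) = diagonal fun i => (d i : R) := rfl

theorem blockDiagUnit_inv_val (d : K → Rˣ) :
    (((blockDiagUnit d)⁻¹ : (Matrix K K R)ˣ) : Matrix K K R) =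
      diagonal fun i => (((d i)⁻¹ : Rˣ) : R) := by
  rw [← map_inv]; rfl

/-- The elementary unipotent `1 + X e_{ij}` for `i ≠ j`. -/
def elemUnit {i j : K} (h : i ≠ j) (X : R) : (Matrix K K R)ˣ where
  val := 1 + single i j X
  inv := 1 + single i j (-X)
  val_inv := by
    simp [mul_add, add_mul, single_mul_single_of_ne _ _ _ _ h.symm]
    rw [add_assoc, ← single_add]; simp
  inv_val := by
    simp [mul_add, add_mul, single_mul_single_of_ne _ _ _ _ h.symm]
    rw [add_assoc, ← single_add]; simp

theorem elemUnit_val {i j : K} (h : i ≠ j) (X : R) :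
    (elemUnit h X : Matrix K K R) = 1 + single i j X := rfl

theorem elemUnit_neg {i j : K} (h : i ≠ j) (X : R) : elemUnit h (-X) = (elemUnit h X)⁻¹ :=
  Units.ext rfl

theorem elemUnit_swap_mul {i j : K} (h : i ≠ j) (X : Rˣ) (Z : R) :
    elemUnit h (-(X⁻¹ : Rˣ) : R) * elemUnit h.symm (X : R) * elemUnit h (-(X⁻¹ : Rˣ) : R) *
        elemUnit h.symm Z =
      elemUnit h (-((X⁻¹ : Rˣ) * Z * (X⁻¹ : Rˣ))) * (elemUnit h (-(X⁻¹ : Rˣ) : R) *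
        elemUnit h.symm (X : R) * elemUnit h (-(X⁻¹ : Rˣ) : R)) := by
  refine Units.ext ?_
  simp only [Units.val_mul, elemUnit_val, mul_add, add_mul, mul_one, one_mul,
    single_mul_single_same, single_mul_single_of_ne _ _ _ _ h,
    single_mul_single_of_ne _ _ _ _ h.symm, mul_neg, neg_mul, mul_zero, Units.mul_inv,
    Units.inv_mul, mul_assoc, Units.mul_inv_cancel_left]
  simp only [← single_neg]
  abel

theorem elemUnit_mul_elemUnit_of_mul_eq_zero {i j : K} (h : i ≠ j) {X Y : R} (u : Rˣ)
    (hXY : X * Y = 0) (hu : (u : R) = 1 + Y * X) :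
    elemUnit h Y * elemUnit h.symm X =
      elemUnit h.symm X * blockDiagUnit (Function.update 1 i u) * elemUnit h Y := by
  have e : (blockDiagUnit (Function.update 1 i u) : Matrix K K R) = 1 + single i i (Y * X) := by
    rw [blockDiagUnit_val, ← diagonal_one, ← diagonal_single, diagonal_add]
    congr 1
    funext l
    rcases eq_or_ne l i with rfl | hl
    · simp [hu]
    · simp [hl]
  refine Units.ext ?_
  simp only [Units.val_mul, e, elemUnit_val, mul_add, add_mul, mul_one, one_mul,
    single_mul_single_same, hXY, mul_zero, mul_assoc]
  simp only [← mul_assoc X Y, hXY, zero_mul, single_zero]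
  abel

variable [Finite R]

theorem elemUnit_mem_iff {i j : K} (h : i ≠ j) {g : (Matrix K K R)ˣ} :
    g ∈ orderUnipotent R (pairRel i j) ↔ ∃ X, g = elemUnit h X := by
  rw [mem_orderUnipotent (isStrictRel_pairRel h)]
  refine ⟨fun hg => ⟨(g : Matrix K K R) i j, Units.ext (Matrix.ext fun a b => ?_)⟩, ?_⟩
  · by_cases hab : pairRel i j a b
    · obtain ⟨rfl, rfl⟩ := hab
      simp [elemUnit_val, one_apply_ne h]
    · rw [hg a b hab, elemUnit_val, Matrix.add_apply, single_apply_of_ne, add_zero]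
      exact fun hh => hab ⟨hh.1.symm, hh.2.symm⟩
  · rintro ⟨X, rfl⟩ a b hab
    rw [elemUnit_val, Matrix.add_apply, single_apply_of_ne, add_zero]
    exact fun hh => hab ⟨hh.1.symm, hh.2.symm⟩

theorem blockDiagUnit_conj_mem {D : K → K → Prop} (hD : IsStrictRel D) (d : K → Rˣ)
    (u : (Matrix K K R)ˣ) :
    blockDiagUnit d * u * (blockDiagUnit d)⁻¹ ∈ orderUnipotent R D ↔ u ∈ orderUnipotent R D := by
  rw [mem_orderUnipotent hD, mem_orderUnipotent hD]
  refine forall_congr' fun i => forall_congr' fun j => imp_congr_right fun _ => ?_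
  rw [Units.val_mul, Units.val_mul, blockDiagUnit_inv_val, blockDiagUnit_val, mul_diagonal, diagonal_mul,
    Units.mul_inv_eq_iff_eq_mul, ← Units.eq_inv_mul_iff_mul_eq]
  rcases eq_or_ne i j with rfl | h
  · simp
  · simp [one_apply_ne h]

variable {V : Type*} [AddCommGroup V] [Module ℂ V] (π : Representation ℂ (Matrix K K R)ˣ V)

theorem blockDiagUnit_average {D : K → K → Prop} (hD : IsStrictRel D) (d : K → Rˣ) (v : V) :
    π (blockDiagUnit d) (subgroupAverage π (orderUnipotent R D) v) =
      subgroupAverage π (orderUnipotent R D) (π (blockDiagUnit d) v) := by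
  have : Finite (Matrix K K R) := inferInstanceAs (Finite (K → K → R))
  exact apply_subgroupAverage_conj π (blockDiagUnit_conj_mem hD d) v

theorem card_smul_average_pairRel [Fintype R] {i j : K} (h : i ≠ j) (v : V) :
    (Nat.card R : ℂ) • subgroupAverage π (orderUnipotent R (pairRel i j)) v =
      ∑ X : R, π (elemUnit h X) v := by
  have : Finite (Matrix K K R) := inferInstanceAs (Finite (K → K → R))
  have := Fintype.ofFinite (orderUnipotent R (pairRel i j))
  let e : R ≃ orderUnipotent R (pairRel i j) := Equiv.ofBijective
    (fun X => ⟨elemUnit h X, (elemUnit_mem_iff h).2 ⟨X, rfl⟩⟩)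
    ⟨fun X Y hXY => by
      have := congrArg (fun u : orderUnipotent R (pairRel i j) =>
        ((u : (Matrix K K R)ˣ) : Matrix K K R) i j) hXY
      simpa [elemUnit_val, one_apply_ne h] using this,
    fun u => by
      obtain ⟨X, hX⟩ := (elemUnit_mem_iff h).1 u.2
      exact ⟨X, Subtype.ext hX.symm⟩⟩
  rw [Nat.card_congr e, card_smul_subgroupAverage]
  exact (Fintype.sum_equiv e _ _ fun x => rfl).symm

theorem elemUnit_swap_average {i j : K} (h : i ≠ j) (X : Rˣ) (v : V) :
    π (elemUnit h (-(X⁻¹ : Rˣ) : R) * elemUnit h.symm (X : R) * elemUnit h (-(X⁻¹ : Rˣ) : R))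
        (subgroupAverage π (orderUnipotent R (pairRel j i)) v) =
      subgroupAverage π (orderUnipotent R (pairRel i j))
        (π (elemUnit h (-(X⁻¹ : Rˣ) : R) * elemUnit h.symm (X : R) *
          elemUnit h (-(X⁻¹ : Rˣ) : R)) v) := by
  have : Finite (Matrix K K R) := inferInstanceAs (Finite (K → K → R))
  refine apply_subgroupAverage_conj π (fun u => ?_) v
  rw [elemUnit_mem_iff h, elemUnit_mem_iff h.symm]
  constructor
  · rintro ⟨Y, hY⟩
    refine ⟨-(X * Y * X), ?_⟩
    have h1 := elemUnit_swap_mul h X (-(X * Y * X))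
    have h2 : -((X⁻¹ : Rˣ) * -(X * Y * X) * (X⁻¹ : Rˣ)) = Y := by
      simp [mul_assoc]
    rw [h2, ← hY, inv_mul_cancel_right] at h1
    exact (mul_left_cancel h1).symm
  · rintro ⟨Z, rfl⟩
    exact ⟨_, by rw [elemUnit_swap_mul, mul_inv_cancel_right]⟩

end Elementary

section PermUnit

variable {K R : Type*} [Fintype K] [DecidableEq K] [Ring R]

/-- The invertible permutation matrix of `σ`. -/
def permUnit (R : Type*) [Ring R] (σ : Equiv.Perm K) : (Matrix K K R)ˣ where
  val := σ.permMatrix R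
  inv := σ⁻¹.permMatrix R
  val_inv := by rw [← permMatrix_mul, inv_mul_cancel, permMatrix_one]
  inv_val := by rw [← permMatrix_mul, mul_inv_cancel, permMatrix_one]

theorem permUnit_val (σ : Equiv.Perm K) : (permUnit R σ : Matrix K K R) = σ.permMatrix R := rfl

theorem permUnit_inv (σ : Equiv.Perm K) : (permUnit R σ)⁻¹ = permUnit R σ⁻¹ := Units.ext rfl

theorem permUnit_mul_val (σ : Equiv.Perm K) (M : Matrix K K R) :
    (permUnit R σ : Matrix K K R) * M = M.submatrix σ id :=
  PEquiv.toMatrix_toPEquiv_mul σ M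

theorem mul_permUnit_val (σ : Equiv.Perm K) (M : Matrix K K R) :
    M * (permUnit R σ : Matrix K K R) = M.submatrix id σ.symm :=
  PEquiv.mul_toMatrix_toPEquiv M σ

theorem permUnit_conj_val (σ : Equiv.Perm K) (u : (Matrix K K R)ˣ) :
    ((permUnit R σ * u * (permUnit R σ)⁻¹ : (Matrix K K R)ˣ) : Matrix K K R) =
      (u : Matrix K K R).submatrix σ σ := by
  rw [permUnit_inv, Units.val_mul, Units.val_mul, permUnit_mul_val, mul_permUnit_val]
  rfl

theorem permUnit_conj_mem [Finite R] {D D' : K → K → Prop} (hD : IsStrictRel D)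
    (hD' : IsStrictRel D') (σ : Equiv.Perm K) (h : ∀ i j, D' (σ i) (σ j) ↔ D i j)
    (u : (Matrix K K R)ˣ) :
    permUnit R σ * u * (permUnit R σ)⁻¹ ∈ orderUnipotent R D ↔ u ∈ orderUnipotent R D' := by
  rw [mem_orderUnipotent hD, mem_orderUnipotent hD', permUnit_conj_val]
  constructor
  · intro hu i j hij
    have := hu (σ.symm i) (σ.symm j) (by rw [← h]; simpa using hij)
    simpa [one_apply] using this
  · intro hu i j hij
    rw [← h] at hij
    simpa [one_apply] using hu _ _ hij

/-- The strict partial order defined by comparing the values of a function. -/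
def valRel {K α : Type*} [LT α] (β : K → α) : K → K → Prop := fun a b => β a < β b

theorem isStrictRel_valRel {K α : Type*} [Preorder α] (β : K → α) : IsStrictRel (valRel β) where
  irrefl _ := lt_irrefl _
  trans _ _ _ := lt_trans

end PermUnit

section Cuspidal

variable {r : ℕ} {F : Type*} [Field F] [Fintype F] {V : Type*} [AddCommGroup V] [Module ℂ V]
  {ρ : Representation ℂ (GL (Fin r) F) V}

theorem IsCuspidal.average_eq_zero (hρ : IsCuspidal ρ) (β : Fin r → ℕ) {a b : Fin r}
    (hab : β a ≠ β b) (v : V) : subgroupAverage ρ (orderUnipotent F (valRel β)) v = 0 := by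
  classical
  have : Finite (GL (Fin r) F) :=
    haveI : Finite (Matrix (Fin r) (Fin r) F) := inferInstanceAs (Finite (Fin r → Fin r → F))
    inferInstance
  set v' := subgroupAverage ρ (orderUnipotent F (valRel β)) v with hv'
  let σ := Tuple.sort β
  let s := Finset.univ.image β
  let e := s.orderIsoOfFin rfl
  have hs : ∀ x, β x ∈ s := fun x => Finset.mem_image_of_mem _ (Finset.mem_univ x)
  let c : Fin r → Fin s.card := fun x => e.symm ⟨β (σ x), hs _⟩
  have hcard : 2 ≤ s.card := Finset.one_lt_card.2 ⟨β a, hs a, β b, hs b, hab⟩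
  have hmono : Monotone c := fun x y hxy => e.symm.monotone (Tuple.monotone_sort β hxy)
  have hsurj : Function.Surjective c := fun y => by
    obtain ⟨x, -, hx⟩ := Finset.mem_image.1 (e y).2
    refine ⟨σ.symm x, ?_⟩
    simp [c, hx]
  have hlt : ∀ x y, c x < c y ↔ β (σ x) < β (σ y) := fun x y => e.symm.lt_iff_lt
  let w : GL (Fin r) F := permUnit F σ
  have key : ρ w v' = 0 := by
    refine hρ _ hcard c hmono hsurj _ fun u hu => ?_
    have hu' : u ∈ orderUnipotent F (valRel c) :=
      (mem_orderUnipotent (isStrictRel_valRel c)).2 fun i j hij => by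
        rw [hu i j (not_lt.1 hij), one_apply]
    have hc : w⁻¹ * u * w ∈ orderUnipotent F (valRel β) := by
      rw [← permUnit_conj_mem (isStrictRel_valRel c) (isStrictRel_valRel β) σ
        fun i j => (hlt i j).symm]
      convert hu' using 1
      simp [w, mul_assoc]
    have h := apply_subgroupAverage ρ hc v
    rw [← hv'] at h
    calc ρ u (ρ w v') = ρ w (ρ (w⁻¹ * u * w) v') := by
          simp only [← Module.End.mul_apply, ← map_mul]; congr 2; group
      _ = ρ w v' := by rw [h]
  have h := congrArg (ρ w⁻¹) key
  rwa [← Module.End.mul_apply, ← map_mul, inv_mul_cancel, map_one, map_zero] at h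

end Cuspidal

section TensorRep

variable {G V : Type*} [Group G] [AddCommGroup V] [Module ℂ V]

open TensorProduct

/-- The external tensor power of a representation, as a representation of the product group. -/
noncomputable def tensorRep (K : Type*) (ρ : Representation ℂ G V) :
    Representation ℂ (K → G) (⨂[ℂ] _ : K, V) where
  toFun d := PiTensorProduct.map fun i => ρ (d i)
  map_one' := by
    simp only [Pi.one_apply, map_one]
    exact PiTensorProduct.map_id
  map_mul' d d' := by
    simp only [Pi.mul_apply, map_mul]
    exact PiTensorProduct.map_comp _ _

theorem tensorRep_apply {K : Type*} (ρ : Representation ℂ G V) (d : K → G) :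
    tensorRep K ρ d = PiTensorProduct.map fun i => ρ (d i) := rfl

variable {K : Type*} [DecidableEq K] {ρ : Representation ℂ G V}

theorem eq_zero_of_average_eq_zero [Finite G] {X : Type*} [AddCommGroup X] [Module ℂ X]
    (U : Subgroup G) (hU : ∀ v, subgroupAverage ρ U v = 0) (i : K)
    (L : (⨂[ℂ] _ : K, V) →ₗ[ℂ] X)
    (hL : ∀ u ∈ U, ∀ x, L (tensorRep K ρ (Function.update 1 i u) x) = L x) : L = 0 := by
  have := Fintype.ofFinite U
  refine PiTensorProduct.ext (MultilinearMap.ext fun f => ?_)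
  let g : V →ₗ[ℂ] X := L ∘ₗ (PiTensorProduct.tprod ℂ).toLinearMap f i
  have hg : ∀ u : U, g (ρ u (f i)) = L (PiTensorProduct.tprod ℂ f) := fun u => by
    rw [← hL u u.2, tensorRep_apply, PiTensorProduct.map_tprod]
    simp only [g, LinearMap.comp_apply, MultilinearMap.toLinearMap_apply]
    congr 2
    funext l
    rcases eq_or_ne l i with rfl | hl
    · simp
    · simp [hl]
  have h : (Nat.card U : ℂ) • L (PiTensorProduct.tprod ℂ f) = 0 := by
    have h1 : ∑ u : U, g (ρ u (f i)) = 0 := by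
      rw [← map_sum, ← card_smul_subgroupAverage, hU, smul_zero, map_zero]
    rw [Finset.sum_congr rfl fun u _ => hg u] at h1
    simpa [Nat.cast_smul_eq_nsmul] using h1
  simpa using h

end TensorRep

theorem IsCuspidal.eq_zero_of_invariant {r : ℕ} {F : Type*} [Field F] [Fintype F] {V : Type*}
    [AddCommGroup V] [Module ℂ V] {ρ : Representation ℂ (GL (Fin r) F) V} (hρ : IsCuspidal ρ)
    {K X : Type*} [DecidableEq K] [AddCommGroup X] [Module ℂ X] (i : K)
    (L : PiTensorProduct ℂ (fun _ : K => V) →ₗ[ℂ] X) (β : Fin r → ℕ) {a b : Fin r}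
    (hab : β a ≠ β b)
    (hL : ∀ u : GL (Fin r) F, u ∈ orderUnipotent F (valRel β) →
      ∀ x, L (tensorRep K ρ (Function.update 1 i u) x) = L x) : L = 0 :=
  haveI : Finite (GL (Fin r) F) :=
    haveI : Finite (Matrix (Fin r) (Fin r) F) := inferInstanceAs (Finite (Fin r → Fin r → F))
    inferInstance
  eq_zero_of_average_eq_zero _ (hρ.average_eq_zero β hab) i L hL

theorem exists_unit_mul_diagonal_mul_unit {n F : Type*} [Fintype n] [DecidableEq n] [Field F]
    (X : Matrix n n F) :
    ∃ (A B : GL n F) (δ : n → F), X = (A : Matrix n n F) * diagonal δ * (B : Matrix n n F) := by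
  obtain ⟨L, L', δ, h⟩ := Matrix.Pivot.exists_list_transvec_mul_mul_list_transvec_eq_diagonal X
  have hu : ∀ L : List (TransvectionStruct n F),
      IsUnit (L.map TransvectionStruct.toMatrix).prod := fun L => by
    rw [Matrix.isUnit_iff_isUnit_det, TransvectionStruct.det_toMatrix_prod]
    exact isUnit_one
  obtain ⟨A, hA⟩ := hu L
  obtain ⟨B, hB⟩ := hu L'
  refine ⟨A⁻¹, B⁻¹, δ, ?_⟩
  rw [← h, ← hA, ← hB]
  simp [mul_assoc]

section RankOne

variable {r : ℕ} {F : Type*} [Field F] [Fintype F] {V Vπ : Type*} [AddCommGroup V] [Module ℂ V]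
  [AddCommGroup Vπ] [Module ℂ Vπ] {K : Type*} [Fintype K] [DecidableEq K]
  {ρ : Representation ℂ (GL (Fin r) F) V}
  {π : Representation ℂ (Matrix K K (Matrix (Fin r) (Fin r) F))ˣ Vπ}

theorem IsCuspidal.average_comp_elemUnit_eq_zero (hρ : IsCuspidal ρ) {i j : K} (h : i ≠ j)
    (S : PiTensorProduct ℂ (fun _ : K => V) →ₗ[ℂ] Vπ)
    (hS : ∀ d x, S (tensorRep K ρ d x) = π (blockDiagUnit d) (S x))
    (hfix : ∀ u ∈ orderUnipotent (Matrix (Fin r) (Fin r) F) (pairRel i j),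
      ∀ x, π u (S x) = S x)
    {X : Matrix (Fin r) (Fin r) F} (hX : ¬ IsUnit X) (hX0 : X ≠ 0) (x) :
    subgroupAverage π (orderUnipotent _ (pairRel i j)) (π (elemUnit h.symm X) (S x)) = 0 := by
  classical
  have : Finite (Matrix (Fin r) (Fin r) F) := inferInstanceAs (Finite (Fin r → Fin r → F))
  have : Finite (Matrix K K (Matrix (Fin r) (Fin r) F)) :=
    inferInstanceAs (Finite (K → K → Matrix (Fin r) (Fin r) F))
  obtain ⟨A, B, δ, rfl⟩ := exists_unit_mul_diagonal_mul_unit X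
  obtain ⟨a, ha⟩ : ∃ a, δ a = 0 := by
    by_contra! hne
    refine hX ((A.isUnit.mul ?_).mul B.isUnit)
    rw [Matrix.isUnit_iff_isUnit_det, det_diagonal, isUnit_iff_ne_zero]
    exact Finset.prod_ne_zero_iff.2 fun a _ => hne a
  obtain ⟨b, hb⟩ : ∃ b, δ b ≠ 0 := by
    by_contra! hz
    have : δ = 0 := funext hz
    exact hX0 (by simp [this])
  let β : Fin r → ℕ := fun a => if δ a = 0 then 0 else 1
  let L := subgroupAverage π (orderUnipotent (Matrix (Fin r) (Fin r) F) (pairRel i j)) ∘ₗ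
    π (elemUnit h.symm (A * diagonal δ * B : Matrix (Fin r) (Fin r) F)) ∘ₗ S
  have hL0 : L ∘ₗ tensorRep K ρ (Function.update 1 i B⁻¹) = 0 := by
    refine hρ.eq_zero_of_invariant i _ β (a := a) (b := b) (by simp [β, ha, hb]) fun u hu x => ?_
    rw [mem_orderUnipotent (isStrictRel_valRel β)] at hu
    let Y₀ : Matrix (Fin r) (Fin r) F := (u - 1) * diagonal fun b => (δ b)⁻¹
    have hY : ∀ p q, Y₀ p q = ((u : Matrix (Fin r) (Fin r) F) p q -
        (1 : Matrix (Fin r) (Fin r) F) p q) * (δ q)⁻¹ := fun p q => mul_diagonal _ _ _ _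
    have hY₁ : Y₀ * diagonal δ = u - 1 := by
      refine Matrix.ext fun p q => ?_
      rw [mul_diagonal, hY]
      by_cases hq : δ q = 0
      · have := hu p q (by simp [valRel, β, hq])
        simp [this]
      · rw [inv_mul_cancel_right₀ hq, Matrix.sub_apply]
    have hY₂ : diagonal δ * Y₀ = 0 := by
      refine Matrix.ext fun p q => ?_
      rw [diagonal_mul, hY]
      by_cases hp : δ p = 0
      · simp [hp]
      · have h1 : β p = 1 := if_neg hp
        have h2 : β q ≤ 1 := by simp only [β]; split_ifs <;> omega
        have := hu p q (by simp only [valRel]; omega)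
        simp [this]
    let Y : Matrix (Fin r) (Fin r) F :=
      (B⁻¹ : GL (Fin r) F) * Y₀ * (A⁻¹ : GL (Fin r) F)
    have hXY : (A * diagonal δ * B : Matrix (Fin r) (Fin r) F) * Y = 0 := by
      calc _ = A * diagonal δ * (B * (B⁻¹ : GL (Fin r) F)) * Y₀ * (A⁻¹ : GL (Fin r) F) := by
            simp only [Y, mul_assoc]
        _ = A * (diagonal δ * Y₀) * (A⁻¹ : GL (Fin r) F) := by
            rw [Units.mul_inv, mul_one, mul_assoc _ (diagonal δ)]
        _ = 0 := by rw [hY₂, mul_zero, zero_mul]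
    have hu' : ((B⁻¹ * u * B : GL (Fin r) F) : Matrix (Fin r) (Fin r) F) =
        1 + Y * (A * diagonal δ * B) := by
      calc _ = (B⁻¹ : GL (Fin r) F) * (1 + Y₀ * diagonal δ) * B := by rw [hY₁]; simp
        _ = 1 + (B⁻¹ : GL (Fin r) F) * Y₀ * ((A⁻¹ : GL (Fin r) F) * A) * (diagonal δ * B) := by
            rw [Units.inv_mul, mul_one, mul_add, add_mul, mul_one, Units.inv_mul]
            simp only [mul_assoc]
        _ = _ := by simp only [Y, mul_assoc]
    have key := elemUnit_mul_elemUnit_of_mul_eq_zero h (B⁻¹ * u * B) hXY hu'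
    have hinv : ∀ y, L (tensorRep K ρ (Function.update 1 i (B⁻¹ * u * B)) y) = L y := fun y => by
      have hYm : elemUnit h Y ∈ orderUnipotent (Matrix (Fin r) (Fin r) F) (pairRel i j) :=
        (elemUnit_mem_iff h).2 ⟨Y, rfl⟩
      simp only [L, LinearMap.comp_apply]
      rw [hS, ← hfix _ hYm y]
      conv_rhs => rw [hfix _ hYm y, ← subgroupAverage_apply_of_mem π hYm]
      simp only [← Module.End.mul_apply, mul_assoc, ← map_mul]
      simp only [mul_assoc] at key
      rw [key]
    simp only [LinearMap.comp_apply]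
    rw [← hinv (tensorRep K ρ (Function.update 1 i B⁻¹) x)]
    simp only [← Module.End.mul_apply, ← map_mul]
    congr 3
    simp only [← Function.update_mul, mul_one]
    congr 1
    group
  have h1 := LinearMap.congr_fun hL0 (tensorRep K ρ (Function.update 1 i B) x)
  rw [LinearMap.comp_apply, ← Module.End.mul_apply, ← map_mul, ← Function.update_mul] at h1
  simpa [L] using h1

theorem IsCuspidal.eq_zero_of_average_pairRel_eq_zero (hρ : IsCuspidal ρ) {i j : K} (h : i ≠ j)
    (S : PiTensorProduct ℂ (fun _ : K => V) →ₗ[ℂ] Vπ)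
    (hS : ∀ d x, S (tensorRep K ρ d x) = π (blockDiagUnit d) (S x))
    (hfix : ∀ u ∈ orderUnipotent (Matrix (Fin r) (Fin r) F) (pairRel i j),
      ∀ x, π u (S x) = S x)
    (h0 : ∀ x, subgroupAverage π (orderUnipotent _ (pairRel j i)) (S x) = 0) : S = 0 := by
  classical
  have : Finite (Matrix (Fin r) (Fin r) F) := inferInstanceAs (Finite (Fin r → Fin r → F))
  have := Fintype.ofFinite (Matrix (Fin r) (Fin r) F)
  have : Finite (Matrix K K (Matrix (Fin r) (Fin r) F)) :=
    inferInstanceAs (Finite (K → K → Matrix (Fin r) (Fin r) F))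
  refine LinearMap.ext fun x => ?_
  have hsum := card_smul_average_pairRel π h.symm (S x)
  rw [h0, smul_zero] at hsum
  have hs := congrArg (subgroupAverage π (orderUnipotent _ (pairRel i j))) hsum.symm
  rw [map_sum, map_zero] at hs
  have e0 : elemUnit h.symm (0 : Matrix (Fin r) (Fin r) F) = 1 :=
    Units.ext (by simp [elemUnit_val])
  rw [Finset.sum_eq_single 0, e0, map_one, Module.End.one_apply,
    subgroupAverage_of_fixed π fun u hu => hfix u hu x] at hs
  · exact hs
  · intro X _ hX0
    by_cases hX : IsUnit X
    · obtain ⟨X, rfl⟩ := hX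
      have ha : elemUnit h ((X⁻¹ : (Matrix (Fin r) (Fin r) F)ˣ) : Matrix (Fin r) (Fin r) F) ∈
          orderUnipotent (Matrix (Fin r) (Fin r) F) (pairRel i j) :=
        (elemUnit_mem_iff h).2 ⟨_, rfl⟩
      have hsw := elemUnit_swap_average π h X (S x)
      rw [h0, map_zero, elemUnit_neg] at hsw
      rw [← subgroupAverage_apply_of_mem π (Subgroup.inv_mem _ ha),
        ← hfix _ (Subgroup.inv_mem _ ha) x, hsw]
      simp only [← Module.End.mul_apply, ← map_mul, mul_assoc]
    · exact hρ.average_comp_elemUnit_eq_zero h S hS hfix hX hX0 x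
  · simp

end RankOne

theorem exists_adjacent_inversion {k : ℕ} (σ σ₀ : Equiv.Perm (Fin k))
    (h : ∃ x y, σ x < σ y ∧ σ₀ y ≤ σ₀ x) :
    ∃ x y, (σ y : ℕ) = σ x + 1 ∧ σ₀ y < σ₀ x := by
  by_contra! hc
  obtain ⟨x, y, hxy, hyx⟩ := h
  rcases k with _ | k
  · exact x.elim0
  have hm : StrictMono (σ₀ ∘ σ.symm) := Fin.strictMono_iff_lt_succ.2 fun i => by
    refine lt_of_le_of_ne (hc _ _ (by simp)) fun he => ?_
    have := σ.symm.injective (σ₀.injective he)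
    simp [Fin.ext_iff] at this
  have := hm hxy
  simp only [Function.comp_apply, Equiv.symm_apply_apply] at this
  exact absurd this (not_lt.2 hyx)

theorem valRel_mul_swap {k : ℕ} (σ : Equiv.Perm (Fin k)) {x y : Fin k}
    (h : (σ y : ℕ) = σ x + 1) (a b : Fin k) :
    valRel (σ * Equiv.swap x y) a b ↔ (valRel σ a b ∧ ¬ pairRel x y a b) ∨ pairRel y x a b := by
  have hne : x ≠ y := by rintro rfl; omega
  have hv : ∀ {c d : Fin k}, c ≠ d → (σ c : ℕ) ≠ σ d := fun hcd he =>
    hcd (σ.injective (Fin.ext he))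
  simp only [valRel, pairRel, Equiv.Perm.mul_apply, Fin.lt_def]
  rcases eq_or_ne a x with rfl | hax
  · rcases eq_or_ne b a with rfl | hba
    · simp [hne]
    · rcases eq_or_ne b y with rfl | hby
      · simp [hne]; omega
      · rw [Equiv.swap_apply_left, Equiv.swap_apply_of_ne_of_ne hba hby]
        have := hv hba
        have := hv hby
        simp [hby, hba]; omega
  · rcases eq_or_ne a y with rfl | hay
    · rcases eq_or_ne b a with rfl | hba
      · simp [hne.symm]
      · rcases eq_or_ne b x with rfl | hbx
        · simp; omega
        · rw [Equiv.swap_apply_right, Equiv.swap_apply_of_ne_of_ne hbx hba]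
          have := hv hba
          have := hv hbx
          simp [hbx, hba]; omega
    · rw [Equiv.swap_apply_of_ne_of_ne hax hay]
      rcases eq_or_ne b x with rfl | hbx
      · have := hv hax
        have := hv hay
        simp [hax, hay]; omega
      · rcases eq_or_ne b y with rfl | hby
        · have := hv hax
          have := hv hay
          simp [hax, hay]; omega
        · rw [Equiv.swap_apply_of_ne_of_ne hbx hby]
          simp [hax, hay]

section Chain

variable {r k : ℕ} {F : Type*} [Field F] [Fintype F] {V Vπ : Type*} [AddCommGroup V] [Module ℂ V]
  [AddCommGroup Vπ] [Module ℂ Vπ] {ρ : Representation ℂ (GL (Fin r) F) V}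
  {π : Representation ℂ (Matrix (Fin k) (Fin k) (Matrix (Fin r) (Fin r) F))ˣ Vπ}

/-- Averaging an equivariant map fixed by one Borel-type group over another one does not kill
it. -/
theorem IsCuspidal.average_comp_ne_zero (hρ : IsCuspidal ρ) (σ₀ σ : Equiv.Perm (Fin k))
    (S : PiTensorProduct ℂ (fun _ : Fin k => V) →ₗ[ℂ] Vπ) (hS0 : S ≠ 0)
    (hS : ∀ d x, S (tensorRep (Fin k) ρ d x) = π (blockDiagUnit d) (S x))
    (hfix : ∀ u ∈ orderUnipotent (Matrix (Fin r) (Fin r) F) (valRel σ₀),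
      ∀ x, π u (S x) = S x) :
    subgroupAverage π (orderUnipotent _ (valRel σ)) ∘ₗ S ≠ 0 := by
  classical
  have : Finite (Matrix (Fin r) (Fin r) F) := inferInstanceAs (Finite (Fin r → Fin r → F))
  have : Finite (Matrix (Fin k) (Fin k) (Matrix (Fin r) (Fin r) F)) :=
    inferInstanceAs (Finite (Fin k → Fin k → Matrix (Fin r) (Fin r) F))
  induction hm : (Finset.univ.filter fun p : Fin k × Fin k =>
    valRel σ p.1 p.2 ∧ valRel σ₀ p.2 p.1).card using Nat.strong_induction_on generalizing σ with
  | _ m ih =>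
  by_cases hinv : ∃ x y, σ x < σ y ∧ σ₀ y ≤ σ₀ x
  · obtain ⟨x, y, hxy, hyx⟩ := exists_adjacent_inversion σ σ₀ hinv
    have hlt : σ x < σ y := by rw [Fin.lt_def]; omega
    have hne : x ≠ y := by rintro rfl; exact lt_irrefl _ hlt
    have hsw := valRel_mul_swap σ hxy
    have hS1 := ih _ (by
      rw [← hm]
      refine Finset.card_lt_card ⟨fun p hp => ?_, fun hsub => ?_⟩
      · rw [Finset.mem_filter, hsw] at hp
        rcases hp.2.1 with h | ⟨h1, h2⟩
        · exact Finset.mem_filter.2 ⟨Finset.mem_univ _, h.1, hp.2.2⟩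
        · have := hp.2.2
          rw [h1, h2] at this
          exact absurd this (not_lt.2 hyx.le)
      · have := hsub (Finset.mem_filter.2 ⟨Finset.mem_univ (x, y), hlt, hyx⟩)
        rw [Finset.mem_filter, hsw] at this
        rcases this.2.1 with h | h
        · exact h.2 ⟨rfl, rfl⟩
        · exact hne h.1) (σ * Equiv.swap x y) rfl
    intro h0
    refine hS1 (hρ.eq_zero_of_average_pairRel_eq_zero (π := π) hne.symm _ ?_ ?_ ?_)
    · intro d z
      rw [LinearMap.comp_apply, hS, LinearMap.comp_apply,
        blockDiagUnit_average π (isStrictRel_valRel _)]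
    · intro u hu z
      refine apply_subgroupAverage π ?_ _
      exact orderUnipotent_mono (isStrictRel_valRel _) (isStrictRel_pairRel hne.symm)
        (fun i j hij => (hsw i j).2 (Or.inr hij)) hu
    · intro z
      have hC : IsStrictRel fun a b => valRel σ a b ∧ ¬ pairRel x y a b :=
        { irrefl := fun a ha => lt_irrefl _ ha.1
          trans := fun a b c hab hbc => ⟨lt_trans hab.1 hbc.1, fun hac => by
            obtain ⟨rfl, rfl⟩ := hac
            have h1 : (σ a : ℕ) < σ b := hab.1
            have h2 : (σ b : ℕ) < σ c := hbc.1
            omega⟩ }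
      have e1 := average_orderUnipotent_eq_comp π (isStrictRel_valRel (σ * Equiv.swap x y)) hC
        (isStrictRel_pairRel hne.symm) hsw (by
          rintro a b ⟨hab, -⟩ ⟨rfl, rfl⟩
          exact lt_asymm hab hlt) (S z)
      rw [subgroupAverage_of_fixed π (fun u hu => hfix u
        (orderUnipotent_mono (isStrictRel_valRel _) (isStrictRel_pairRel hne.symm) (by
          rintro a b ⟨rfl, rfl⟩; exact hyx) hu) z)] at e1
      have e2 := average_orderUnipotent_eq_comp π (isStrictRel_valRel σ)
        (isStrictRel_pairRel hne) hC (fun a b => by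
          by_cases hab : pairRel x y a b
          · simp only [hab, true_or, iff_true]
            obtain ⟨rfl, rfl⟩ := hab
            exact hlt
          · simp [hab]) (fun a b hab h => h.2 hab) (S z)
      rw [LinearMap.comp_apply, e1, ← e2]
      exact LinearMap.congr_fun h0 z
  · push Not at hinv
    intro h0
    refine hS0 ?_
    rw [← h0]
    refine LinearMap.ext fun z => ?_
    rw [LinearMap.comp_apply, subgroupAverage_of_fixed π fun u hu => hfix u
      (orderUnipotent_mono (isStrictRel_valRel _) (isStrictRel_valRel _) hinv hu) z]

end Chain

section Bruhat

variable {I F : Type*} [Fintype I] [DecidableEq I] [Field F]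

/-- The unit `1 + c eᵀ` for orthogonal vectors `c` and `e`. -/
def rankOneUnit (c e : I → F) (h : e ⬝ᵥ c = 0) : GL I F where
  val := 1 + vecMulVec c e
  inv := 1 - vecMulVec c e
  val_inv := by
    have : vecMulVec c e * vecMulVec c e = 0 := by
      rw [vecMulVec_mul_vecMulVec, h, zero_smul, vecMulVec_zero]
    rw [add_mul, mul_sub, mul_sub, this]; simp
  inv_val := by
    have : vecMulVec c e * vecMulVec c e = 0 := by
      rw [vecMulVec_mul_vecMulVec, h, zero_smul, vecMulVec_zero]
    rw [sub_mul, mul_add, mul_add, this]; simp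

theorem rankOneUnit_val (c e : I → F) (h : e ⬝ᵥ c = 0) :
    (rankOneUnit c e h : Matrix I I F) = 1 + vecMulVec c e := rfl

theorem blockTriangular_rankOneUnit (β : I → ℕ) (c e : I → F) (h : e ⬝ᵥ c = 0)
    (hce : ∀ i j, c i ≠ 0 → e j ≠ 0 → β i ≤ β j) :
    BlockTriangular (rankOneUnit c e h : Matrix I I F) β := by
  rw [rankOneUnit_val]
  refine BlockTriangular.add blockTriangular_one fun i j hij => ?_
  rw [vecMulVec_apply]
  by_contra hne
  exact absurd (hce i j (left_ne_zero_of_mul hne) (right_ne_zero_of_mul hne)) (not_le.2 hij)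

theorem exists_partial_bruhat (β : I → ℕ) (hβ : Function.Injective β) (g : GL I F) (t : ℕ) :
    ∃ (b b' : GL I F) (f : I → I), BlockTriangular (b : Matrix I I F) β ∧
      BlockTriangular (b' : Matrix I I F) β ∧ ∀ j, β j < t →
        (b * g * b' : GL I F).val (f j) j ≠ 0 ∧
        (∀ i, i ≠ f j → (b * g * b' : GL I F).val i j = 0) ∧
        (∀ l, l ≠ j → (b * g * b' : GL I F).val (f j) l = 0) := by
  classical
  induction t with
  | zero =>
    exact ⟨1, 1, id, blockTriangular_one, blockTriangular_one, fun j hj => absurd hj (by omega)⟩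
  | succ t ih =>
    obtain ⟨b, b', f, hb, hb', hf⟩ := ih
    by_cases hj : ∃ j, β j = t
    swap
    · exact ⟨b, b', f, hb, hb', fun j h => hf j (by
        have : β j ≠ t := fun h => hj ⟨j, h⟩
        omega)⟩
    obtain ⟨j, hj⟩ := hj
    set x : GL I F := b * g * b' with hx
    obtain ⟨i, hi, himax⟩ : ∃ i, x.val i j ≠ 0 ∧ ∀ i', x.val i' j ≠ 0 → β i' ≤ β i := by
      have hne : (Finset.univ.filter fun i => x.val i j ≠ 0).Nonempty := by
        by_contra hemp
        rw [Finset.not_nonempty_iff_eq_empty, Finset.filter_eq_empty_iff] at hemp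
        have h1 : (x⁻¹.val * x.val) j j = 1 := by simp
        rw [Matrix.mul_apply, Finset.sum_eq_zero] at h1
        · exact zero_ne_one h1
        · intro l _
          have : x.val l j = 0 := by simpa using hemp (Finset.mem_univ l)
          rw [this, mul_zero]
      obtain ⟨i, hi, him⟩ := Finset.exists_max_image _ β hne
      exact ⟨i, (Finset.mem_filter.1 hi).2, fun i' h' =>
        him i' (Finset.mem_filter.2 ⟨Finset.mem_univ _, h'⟩)⟩
    have hfi : ∀ l, β l < t → f l ≠ i := fun l hl he => by
      refine hi ?_
      rw [← he]
      exact (hf l hl).2.2 j (by rintro rfl; omega)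
    let c : I → F := fun i' => if i' = i then 0 else -(x.val i' j / x.val i j)
    have hc : Pi.single i 1 ⬝ᵥ c = 0 := by simp [c]
    let y : GL I F := rankOneUnit c _ hc * x
    have hy : ∀ p q, y.val p q = x.val p q + c p * x.val i q := fun p q => by
      change ((1 + vecMulVec c (Pi.single i 1)) * x.val) p q = _
      rw [add_mul, one_mul, Matrix.add_apply, vecMulVec_mul]
      simp [vecMulVec_apply]
    have hyj : ∀ p, p ≠ i → y.val p j = 0 := fun p hp => by
      rw [hy]; simp only [c, if_neg hp]; field_simp; ring
    have hyi : ∀ q, y.val i q = x.val i q := fun q => by rw [hy]; simp [c]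
    let e : I → F := fun q => if q = j then 0 else -(x.val i q / x.val i j)
    have he : e ⬝ᵥ Pi.single j 1 = 0 := by simp [e]
    let z : GL I F := y * rankOneUnit _ e he
    have hz : ∀ p q, z.val p q = y.val p q + y.val p j * e q := fun p q => by
      change (y.val * (1 + vecMulVec (Pi.single j 1) e)) p q = _
      rw [mul_add, mul_one, Matrix.add_apply, mul_vecMulVec]
      simp [vecMulVec_apply]
    have hzp : ∀ p q, p ≠ i → z.val p q = y.val p q := fun p q hp => by
      rw [hz, hyj p hp, zero_mul, add_zero]
    have hzi : ∀ q, q ≠ j → z.val i q = 0 := fun q hq => by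
      rw [hz, hyi, hyi]; simp only [e, if_neg hq]; field_simp; ring
    have hzij : z.val i j = x.val i j := by rw [hz, hyi]; simp [e]
    refine ⟨rankOneUnit c _ hc * b, b' * rankOneUnit _ e he, Function.update f j i, ?_, ?_, ?_⟩
    · refine BlockTriangular.mul (blockTriangular_rankOneUnit β _ _ _ fun p q hp hq => ?_) hb
      have hq' : q = i := by
        by_contra hne; exact hq (by simp [hne])
      subst hq'
      refine himax p fun h0 => hp ?_
      simp [c, h0]
    · refine BlockTriangular.mul hb' (blockTriangular_rankOneUnit β _ _ _ fun p q hp hq => ?_)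
      have hp' : p = j := by
        by_contra hne; exact hp (by simp [hne])
      subst hp'
      by_contra! hlt
      refine hq ?_
      have : x.val i q = 0 := (hf q (by omega)).2.1 i fun h => hfi q (by omega) h.symm
      simp [e, this]
    · have hassoc : rankOneUnit c _ hc * b * g * (b' * rankOneUnit _ e he) = z := by
        simp only [z, y, hx, mul_assoc]
      rw [hassoc]
      intro l hl
      rcases eq_or_ne l j with rfl | hlj
      · rw [Function.update_self]
        exact ⟨by rwa [hzij], fun p hp => by rw [hzp p _ hp, hyj p hp], hzi⟩
      · have hlt : β l < t := by
          have : β l ≠ t := fun h => hlj (hβ (h.trans hj.symm))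
          omega
        rw [Function.update_of_ne hlj]
        obtain ⟨h1, h2, h3⟩ := hf l hlt
        have hil : x.val i l = 0 := h2 i fun h => hfi l hlt h.symm
        have hcf : c (f l) = 0 := by
          simp [c, h3 j hlj.symm]
        refine ⟨?_, fun p hp => ?_, fun q hq => ?_⟩
        · rwa [hzp _ _ (hfi l hlt), hy, hil, mul_zero, add_zero]
        · rcases eq_or_ne p i with rfl | hpi
          · exact hzi l hlj
          · rw [hzp _ _ hpi, hy, hil, mul_zero, add_zero, h2 p hp]
        · rw [hzp _ _ (hfi l hlt), hy, hcf, zero_mul, add_zero, h3 q hq]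

/-- The Bruhat decomposition of the general linear group. -/
theorem exists_blockTriangular_mul_mul_eq_permUnit (β : I → ℕ) (hβ : Function.Injective β)
    (g : GL I F) : ∃ (b b' : GL I F) (σ : Equiv.Perm I), BlockTriangular (b : Matrix I I F) β ∧
      BlockTriangular (b' : Matrix I I F) β ∧ b * g * b' = permUnit F σ := by
  obtain ⟨t, ht⟩ : ∃ t, ∀ j, β j < t := by
    refine ⟨Finset.univ.sup β + 1, fun j => Nat.lt_succ_of_le (Finset.le_sup (Finset.mem_univ j))⟩
  obtain ⟨b, b', f, hb, hb', hf⟩ := exists_partial_bruhat β hβ g t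
  have hfinj : Function.Injective f := fun p q hpq => by
    by_contra hne
    refine (hf p (ht p)).1 ?_
    rw [hpq]
    exact (hf q (ht q)).2.2 p hne
  let σ := Equiv.ofBijective f hfinj.bijective_of_finite
  let D : I → Fˣ := fun j => Units.mk0 _ (hf j (ht j)).1
  let d : GL I F := blockDiagUnit fun j => (D j)⁻¹
  refine ⟨b, b' * d, σ⁻¹, hb, hb'.mul ?_, ?_⟩
  · exact blockTriangular_diagonal _
  · rw [← mul_assoc]
    refine Units.ext (Matrix.ext fun p q => ?_)
    rw [Units.val_mul, blockDiagUnit_val, mul_diagonal, permUnit_val]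
    rw [Equiv.Perm.permMatrix, PEquiv.toMatrix_apply]
    simp only [Equiv.toPEquiv_apply, Option.mem_def, Option.some.injEq, Equiv.Perm.inv_def]
    rcases eq_or_ne p (f q) with rfl | hp
    · rw [if_pos (by rw [Equiv.symm_apply_eq]; rfl)]
      exact mul_inv_cancel₀ (hf q (ht q)).1
    · rw [if_neg (by rw [Equiv.symm_apply_eq]; exact hp), (hf q (ht q)).2.1 p hp, zero_mul]

end Bruhat

section Support

theorem exists_blockDiagUnit_mul {K R : Type*} [Fintype K] [DecidableEq K] [LinearOrder K]
    [Ring R] [Finite R] (g h : (Matrix K K R)ˣ) (hgh : g * h = 1)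
    (hg : ∀ i j, j < i → g.val i j = 0) (hh : ∀ i j, j < i → h.val i j = 0) :
    ∃ (d : K → Rˣ), ∃ n ∈ orderUnipotent R (valRel (fun i : K => i)), g = blockDiagUnit d * n := by
  have hhg : h * g = 1 := mul_eq_one_comm.1 hgh
  have hd : ∀ g h : (Matrix K K R)ˣ, g * h = 1 → (∀ i j, j < i → g.val i j = 0) →
      (∀ i j, j < i → h.val i j = 0) → ∀ i, g.val i i * h.val i i = 1 := by
    intro g h hgh hg hh i
    have : (g * h).val i i = 1 := by rw [hgh, Units.val_one, one_apply_eq]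
    rw [Units.val_mul, Matrix.mul_apply, Finset.sum_eq_single i] at this
    · exact this
    · intro j _ hj
      rcases lt_or_gt_of_ne hj with hlt | hlt
      · rw [hg _ _ hlt, zero_mul]
      · rw [hh _ _ hlt, mul_zero]
    · simp
  let d : K → Rˣ := fun i => ⟨g.val i i, h.val i i, hd g h hgh hg hh i, hd h g hhg hh hg i⟩
  refine ⟨d, (blockDiagUnit d)⁻¹ * g, ?_, by rw [mul_inv_cancel_left]⟩
  rw [mem_orderUnipotent (isStrictRel_valRel _)]
  intro i j hij
  rw [Units.val_mul, ← map_inv, blockDiagUnit_val, diagonal_mul]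
  have hij' : j ≤ i := not_lt.1 hij
  rcases hij'.eq_or_lt with rfl | hlt
  · rw [one_apply_eq]
    exact hd h g hhg hh hg j
  · rw [hg _ _ hlt, mul_zero, one_apply_ne]
    exact hlt.ne'

end Support

section Support

/-- Flattening of invertible matrices of matrices. -/
def compUnits (K I F : Type*) [Fintype K] [DecidableEq K] [Fintype I] [DecidableEq I] [Field F] :
    (Matrix K K (Matrix I I F))ˣ ≃* GL (K × I) F :=
  Units.mapEquiv (compRingEquiv K I F).toMulEquiv

theorem compUnits_val {K I F : Type*} [Fintype K] [DecidableEq K] [Fintype I] [DecidableEq I]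
    [Field F] (g : (Matrix K K (Matrix I I F))ˣ) (p q : K × I) :
    (compUnits K I F g : Matrix (K × I) (K × I) F) p q = g.val p.1 q.1 p.2 q.2 := rfl

theorem compUnits_conj_permUnit {K I F : Type*} [Fintype K] [DecidableEq K] [Fintype I]
    [DecidableEq I] [Field F] (σ : Equiv.Perm (K × I)) (g : (Matrix K K (Matrix I I F))ˣ)
    (p q : K × I) :
    ((compUnits K I F).symm (permUnit F σ) * g * ((compUnits K I F).symm (permUnit F σ))⁻¹).val
      p.1 q.1 p.2 q.2 = (compUnits K I F g : Matrix (K × I) (K × I) F) (σ p) (σ q) := by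
  rw [← compUnits_val, map_mul, map_mul, map_inv, MulEquiv.apply_symm_apply]
  exact congrFun (congrFun (permUnit_conj_val σ (compUnits K I F g)) p) q

theorem tensorRep_mul_inv {G V K : Type*} [Group G] [AddCommGroup V] [Module ℂ V]
    (ρ : Representation ℂ G V) (d : K → G) : tensorRep K ρ d * tensorRep K ρ d⁻¹ = 1 := by
  rw [← map_mul, mul_inv_cancel, map_one]

variable {r k : ℕ} {F : Type*} [Field F] [Fintype F] {V : Type*} [AddCommGroup V] [Module ℂ V]
  {ρ : Representation ℂ (GL (Fin r) F) V}

/-- The group of block upper unitriangular matrices. -/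
abbrev upperGroup (K R : Type*) [Fintype K] [DecidableEq K] [LT K] [Ring R] :
    Subgroup (Matrix K K R)ˣ := orderUnipotent R (valRel fun i : K => i)

/-- Operator valued functions which transform under the block upper triangular group, on both
sides, according to `ρ^{⊗k}`. -/
structure IsBiequivariant (ρ : Representation ℂ (GL (Fin r) F) V)
    (Ψ : (Matrix (Fin k) (Fin k) (Matrix (Fin r) (Fin r) F))ˣ →
      Module.End ℂ (PiTensorProduct ℂ fun _ : Fin k => V)) : Prop where
  unipotent_mul : ∀ n ∈ upperGroup (Fin k) (Matrix (Fin r) (Fin r) F), ∀ g, Ψ (n * g) = Ψ g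
  mul_unipotent : ∀ n ∈ upperGroup (Fin k) (Matrix (Fin r) (Fin r) F), ∀ g, Ψ (g * n) = Ψ g
  blockDiag_mul : ∀ d g, Ψ (blockDiagUnit d * g) = tensorRep (Fin k) ρ d * Ψ g
  mul_blockDiag : ∀ d g, Ψ (g * blockDiagUnit d) = Ψ g * tensorRep (Fin k) ρ d

theorem exists_blockDiagUnit_mul_of_blockTriangular
    (g : (Matrix (Fin k) (Fin k) (Matrix (Fin r) (Fin r) F))ˣ)
    (hg : BlockTriangular (compUnits _ _ F g : Matrix (Fin k × Fin r) (Fin k × Fin r) F)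
      Prod.fst) :
    ∃ d, ∃ n ∈ upperGroup (Fin k) (Matrix (Fin r) (Fin r) F), g = blockDiagUnit d * n := by
  have : Finite (Matrix (Fin r) (Fin r) F) := inferInstanceAs (Finite (Fin r → Fin r → F))
  have hinv : BlockTriangular
      (compUnits _ _ F g⁻¹ : Matrix (Fin k × Fin r) (Fin k × Fin r) F) Prod.fst := by
    have := (compUnits _ _ F g).invertible
    rw [map_inv, coe_units_inv]
    exact blockTriangular_inv_of_blockTriangular hg
  exact exists_blockDiagUnit_mul g g⁻¹ (mul_inv_cancel g)
    (fun i j hij => Matrix.ext fun a b => hg (i := (i, a)) (j := (j, b)) hij)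
    (fun i j hij => Matrix.ext fun a b => hinv (i := (i, a)) (j := (j, b)) hij)

theorem IsBiequivariant.eq_zero_of_mul {Ψ} (h : IsBiequivariant (k := k) ρ Ψ)
    {b b' g} (hb : BlockTriangular (compUnits _ _ F b : Matrix (Fin k × Fin r) _ F) Prod.fst)
    (hb' : BlockTriangular (compUnits _ _ F b' : Matrix (Fin k × Fin r) _ F) Prod.fst)
    (h0 : Ψ (b * g * b') = 0) : Ψ g = 0 := by
  obtain ⟨d, n, hn, rfl⟩ := exists_blockDiagUnit_mul_of_blockTriangular b hb
  obtain ⟨d', n', hn', rfl⟩ := exists_blockDiagUnit_mul_of_blockTriangular b' hb'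
  rw [← mul_assoc, h.mul_unipotent _ hn', h.mul_blockDiag, mul_assoc, h.blockDiag_mul,
    h.unipotent_mul _ hn] at h0
  have h1 : tensorRep (Fin k) ρ d⁻¹ * (tensorRep (Fin k) ρ d * Ψ g * tensorRep (Fin k) ρ d') *
      tensorRep (Fin k) ρ d'⁻¹ = Ψ g := by
    have := tensorRep_mul_inv ρ d⁻¹
    rw [inv_inv] at this
    rw [mul_assoc, mul_assoc, mul_assoc, tensorRep_mul_inv, mul_one, ← mul_assoc, this, one_mul]
  rw [← h1, h0, mul_zero, zero_mul]

theorem IsBiequivariant.eq_zero_of_not_blockPreserving (hρ : IsCuspidal ρ) {Ψ}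
    (h : IsBiequivariant (k := k) ρ Ψ) (σ : Equiv.Perm (Fin k × Fin r)) {i : Fin k}
    {a b : Fin r} (hab : (σ.symm (i, a)).1 ≠ (σ.symm (i, b)).1) :
    Ψ ((compUnits _ _ F).symm (permUnit F σ)) = 0 := by
  have : Finite (Matrix (Fin r) (Fin r) F) := inferInstanceAs (Finite (Fin r → Fin r → F))
  let β : Fin r → ℕ := fun a => (σ.symm (i, a)).1
  set s := (compUnits _ _ F).symm (permUnit F σ)
  refine hρ.eq_zero_of_invariant i (Ψ s) β (a := a) (b := b)
    (fun h => hab (Fin.ext h)) fun u hu x => ?_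
  rw [mem_orderUnipotent (isStrictRel_valRel _)] at hu
  let d : Fin k → GL (Fin r) F := Function.update 1 i u
  let m : (Matrix (Fin k) (Fin k) (Matrix (Fin r) (Fin r) F))ˣ := blockDiagUnit d
  have hmem : s * m * s⁻¹ ∈
      upperGroup (Fin k) (Matrix (Fin r) (Fin r) F) := by
    rw [mem_orderUnipotent (isStrictRel_valRel _)]
    intro p q hpq
    refine Matrix.ext fun c e => ?_
    have h1 := compUnits_conj_permUnit σ m (p, c) (q, e)
    rw [compUnits_val m, blockDiagUnit_val] at h1
    have h2 : (1 : Matrix (Fin k) (Fin k) (Matrix (Fin r) (Fin r) F)) p q c e =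
        (1 : Matrix (Fin k × Fin r) (Fin k × Fin r) F) (σ (p, c)) (σ (q, e)) := by
      rw [one_apply, one_apply]
      by_cases hpq : p = q
      · subst hpq
        simp [one_apply]
      · simp [hpq]
    refine h1.trans ?_
    rw [h2]
    obtain ⟨⟨j, c'⟩, hc'⟩ : ∃ x, x = σ (p, c) := ⟨_, rfl⟩
    obtain ⟨⟨l, e'⟩, he'⟩ : ∃ x, x = σ (q, e) := ⟨_, rfl⟩
    rw [← hc', ← he']
    by_cases hjl : j = l
    · subst hjl
      rw [diagonal_apply_eq]
      by_cases hji : j = i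
      · subst hji
        simp only [d]
        rw [Function.update_self, hu]
        · simp [one_apply]
        · simp only [valRel, β]
          rw [hc', he']
          simpa [valRel] using hpq
      · simp only [d]
        rw [Function.update_of_ne hji]
        simp [one_apply]
    · rw [diagonal_apply_ne _ hjl]
      simp [one_apply, hjl]
  have h1 := h.unipotent_mul _ hmem s
  rw [inv_mul_cancel_right, h.mul_blockDiag] at h1
  exact LinearMap.congr_fun h1 x

theorem IsBiequivariant.eq_zero (hr : 0 < r) (hρ : IsCuspidal ρ) {Ψ}
    (h : IsBiequivariant (k := k) ρ Ψ) (h0 : ∀ w, Ψ (permUnit _ w) = 0) : Ψ = 0 := by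
  classical
  refine funext fun g => ?_
  let β : Fin k × Fin r → ℕ := fun p => finProdFinEquiv p
  have hβ : Function.Injective β := Fin.val_injective.comp finProdFinEquiv.injective
  have htri : ∀ b : GL (Fin k × Fin r) F, BlockTriangular (b : Matrix _ _ F) β →
      BlockTriangular (compUnits _ _ F ((compUnits _ _ F).symm b) :
        Matrix (Fin k × Fin r) _ F) Prod.fst := by
    intro b hb p q hpq
    rw [MulEquiv.apply_symm_apply]
    refine hb ?_
    simp only [β, finProdFinEquiv_apply_val]
    have h1 : (q.1 : ℕ) + 1 ≤ p.1 := hpq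
    have h2 := q.2.2
    nlinarith
  obtain ⟨b, b', σ, hb, hb', hσ⟩ :=
    exists_blockTriangular_mul_mul_eq_permUnit β hβ (compUnits _ _ F g)
  refine h.eq_zero_of_mul (htri b hb) (htri b' hb') ?_
  have hg : (compUnits _ _ F).symm b * g * (compUnits _ _ F).symm b' =
      (compUnits _ _ F).symm (permUnit F σ) := by
    rw [← hσ, map_mul, map_mul, MulEquiv.symm_apply_apply]
  rw [hg]
  by_cases hcon : ∃ i a b, (σ.symm (i, a)).1 ≠ (σ.symm (i, b)).1
  · obtain ⟨i, a, b, hab⟩ := hcon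
    exact h.eq_zero_of_not_blockPreserving hρ σ hab
  · push Not at hcon
    let z : Fin r := ⟨0, hr⟩
    let w : Fin k → Fin k := fun i => (σ.symm (i, z)).1
    have hw : ∀ i a, (σ.symm (i, a)).1 = w i := fun i a => hcon i a z
    have hsurj : Function.Surjective w := fun j =>
      ⟨(σ (j, z)).1, by rw [← hw _ (σ (j, z)).2]; simp⟩
    let e : Equiv.Perm (Fin k) := Equiv.ofBijective w hsurj.bijective_of_finite
    set s := (compUnits _ _ F).symm (permUnit F σ) with hs
    have hblock : BlockTriangular (compUnits _ _ F ((permUnit _ e) * s) :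
        Matrix (Fin k × Fin r) (Fin k × Fin r) F) Prod.fst := by
      intro p q hpq
      rw [compUnits_val, Units.val_mul, permUnit_mul_val, submatrix_apply]
      have : (compUnits _ _ F s : Matrix (Fin k × Fin r) _ F) (e p.1, p.2) q = 0 := by
        rw [hs, MulEquiv.apply_symm_apply, permUnit_val, Equiv.Perm.permMatrix,
          PEquiv.toMatrix_apply, if_neg]
        intro hq
        have hq' : σ (e p.1, p.2) = q := by simpa using hq
        have h1 : σ.symm q = (e p.1, p.2) := by rw [← hq']; simp
        have h2 := hw q.1 q.2
        rw [Prod.mk.eta, h1] at h2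
        exact hpq.ne (e.injective h2).symm
      exact this
    obtain ⟨d, n, hn, hdn⟩ := exists_blockDiagUnit_mul_of_blockTriangular _ hblock
    have hs' : s = permUnit _ e⁻¹ * blockDiagUnit d * n := by
      rw [mul_assoc, ← hdn, ← permUnit_inv, inv_mul_cancel_left]
    rw [hs', h.mul_unipotent _ hn, h.mul_blockDiag, h0, zero_mul]

end Support

theorem apply_subgroupAverage_of_invariant {G V X : Type*} [Group G] [Finite G] [AddCommGroup V]
    [Module ℂ V] [AddCommGroup X] [Module ℂ X] (π : Representation ℂ G V) {U : Subgroup G}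
    (L : V →ₗ[ℂ] X) (hL : ∀ u ∈ U, ∀ v, L (π u v) = L v) (v : V) :
    L (subgroupAverage π U v) = L v := by
  have := Fintype.ofFinite U
  rw [subgroupAverage_apply, map_smul, map_sum,
    Finset.sum_congr rfl fun (u : U) _ => hL u u.2 v, Finset.sum_const, Finset.card_univ,
    ← Nat.cast_smul_eq_nsmul ℂ, smul_smul, Fintype.card_eq_nat_card, inv_mul_cancel₀, one_smul]
  simp

/-- Two irreducible representations with a common nonzero matrix coefficient are equivalent. -/
theorem IsIrred.exists_equiv_of_coefficient_eq {G V V' Y : Type*} [Group G] [AddCommGroup V]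
    [Module ℂ V] [AddCommGroup V'] [Module ℂ V'] [AddCommGroup Y] [Module ℂ Y]
    {π : Representation ℂ G V} {π' : Representation ℂ G V'} (h : IsIrred π) (h' : IsIrred π')
    (t : V →ₗ[ℂ] Y) (t' : V' →ₗ[ℂ] Y) (v : V) (v' : V')
    (heq : ∀ g, t (π g v) = t' (π' g v')) (hne : ∃ g, t (π g v) ≠ 0) :
    ∃ e : V ≃ₗ[ℂ] V', ∀ g x, e (π g x) = π' g (e x) := by
  obtain ⟨g₀, hg₀⟩ := hne
  let Z : Submodule ℂ (V × V') := Submodule.span ℂ (Set.range fun g => (π g v, π' g v'))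
  have hZinv : ∀ g, ∀ z ∈ Z, (π g z.1, π' g z.2) ∈ Z := by
    intro g z hz
    have : Z ≤ Z.comap ((π g).prodMap (π' g)) := by
      refine Submodule.span_le.2 ?_
      rintro _ ⟨x, rfl⟩
      refine Submodule.subset_span ⟨g * x, ?_⟩
      simp [map_mul]
    exact this hz
  have hmem : ∀ g, (π g v, π' g v') ∈ Z := fun g => Submodule.subset_span ⟨g, rfl⟩
  have ht : ∀ z ∈ Z, t z.1 = t' z.2 := by
    intro z hz
    have : Z ≤ LinearMap.eqLocus (t ∘ₗ LinearMap.fst ℂ V V') (t' ∘ₗ LinearMap.snd ℂ V V') := by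
      refine Submodule.span_le.2 ?_
      rintro _ ⟨x, rfl⟩
      exact heq x
    exact this hz
  have h1 : Z.comap (LinearMap.inl ℂ V V') = ⊥ := by
    refine (h.2 _ fun g x hx => ?_).resolve_right fun htop => hg₀ ?_
    · have := hZinv g _ hx
      simpa using this
    · have : π g₀ v ∈ Z.comap (LinearMap.inl ℂ V V') := htop ▸ Submodule.mem_top
      simpa using ht _ this
  have h2 : Z.comap (LinearMap.inr ℂ V V') = ⊥ := by
    refine (h'.2 _ fun g x hx => ?_).resolve_right fun htop => hg₀ ?_
    · have := hZinv g _ hx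
      simpa using this
    · have : π' g₀ v' ∈ Z.comap (LinearMap.inr ℂ V V') := htop ▸ Submodule.mem_top
      rw [heq]
      simpa using (ht _ this).symm
  have h3 : Z.map (LinearMap.fst ℂ V V') = ⊤ := by
    refine (h.2 _ ?_).resolve_left fun hbot => hg₀ ?_
    · rintro g _ ⟨z, hz, rfl⟩
      exact ⟨_, hZinv g z hz, rfl⟩
    · have : π g₀ v ∈ Z.map (LinearMap.fst ℂ V V') := ⟨_, hmem g₀, rfl⟩
      rw [hbot, Submodule.mem_bot] at this
      rw [this, map_zero]
  have h4 : Z.map (LinearMap.snd ℂ V V') = ⊤ := by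
    refine (h'.2 _ ?_).resolve_left fun hbot => hg₀ ?_
    · rintro g _ ⟨z, hz, rfl⟩
      exact ⟨_, hZinv g z hz, rfl⟩
    · have : π' g₀ v' ∈ Z.map (LinearMap.snd ℂ V V') := ⟨_, hmem g₀, rfl⟩
      rw [hbot, Submodule.mem_bot] at this
      rw [heq, this, map_zero]
  let p : Z →ₗ[ℂ] V := LinearMap.fst ℂ V V' ∘ₗ Z.subtype
  let q : Z →ₗ[ℂ] V' := LinearMap.snd ℂ V V' ∘ₗ Z.subtype
  have hp : Function.Bijective p := by
    refine ⟨(injective_iff_map_eq_zero p).2 fun z hz => ?_, fun x => ?_⟩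
    · obtain ⟨⟨x, y⟩, hxy⟩ := z
      obtain rfl : x = 0 := hz
      have : y ∈ Z.comap (LinearMap.inr ℂ V V') := hxy
      rw [h2, Submodule.mem_bot] at this
      subst this
      rfl
    · have : x ∈ Z.map (LinearMap.fst ℂ V V') := h3 ▸ Submodule.mem_top
      obtain ⟨z, hz, rfl⟩ := this
      exact ⟨⟨z, hz⟩, rfl⟩
  have hq : Function.Bijective q := by
    refine ⟨(injective_iff_map_eq_zero q).2 fun z hz => ?_, fun x => ?_⟩
    · obtain ⟨⟨x, y⟩, hxy⟩ := z
      obtain rfl : y = 0 := hz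
      have : x ∈ Z.comap (LinearMap.inl ℂ V V') := hxy
      rw [h1, Submodule.mem_bot] at this
      subst this
      rfl
    · have : x ∈ Z.map (LinearMap.snd ℂ V V') := h4 ▸ Submodule.mem_top
      obtain ⟨z, hz, rfl⟩ := this
      exact ⟨⟨z, hz⟩, rfl⟩
  refine ⟨(LinearEquiv.ofBijective p hp).symm.trans (LinearEquiv.ofBijective q hq), fun g x => ?_⟩
  obtain ⟨z, rfl⟩ := hp.2 x
  have e1 : π g (p z) = p ⟨_, hZinv g z z.2⟩ := rfl
  have e2 : ∀ y : Z, (LinearEquiv.ofBijective p hp).symm (p y) = y := fun y =>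
    (LinearEquiv.ofBijective p hp).symm_apply_apply y
  rw [e1, LinearEquiv.trans_apply, LinearEquiv.trans_apply, e2, e2]
  rfl

theorem exists_mul_mul_eq_self {𝕜 V W : Type*} [Field 𝕜] [AddCommGroup V] [Module 𝕜 V]
    [AddCommGroup W] [Module 𝕜 W] (T : V →ₗ[𝕜] W) : ∃ s : W →ₗ[𝕜] V, ∀ v, T (s (T v)) = T v := by
  obtain ⟨s', hs'⟩ := T.rangeRestrict.exists_rightInverse_of_surjective
    (LinearMap.range_rangeRestrict T)
  obtain ⟨s, hs⟩ := s'.exists_extend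
  refine ⟨s, fun v => ?_⟩
  have h1 : s (T v) = s' ⟨T v, v, rfl⟩ := (LinearMap.congr_fun hs ⟨T v, v, rfl⟩)
  have h2 := congrArg Subtype.val (LinearMap.congr_fun hs' ⟨T v, v, rfl⟩)
  rw [h1]
  exact h2

section TensorPower

variable {G V K : Type*} [Group G] [Finite G] [AddCommGroup V] [Module ℂ V]
  [FiniteDimensional ℂ V] [Fintype K] {ρ : Representation ℂ G V}

/-- An operator which permutes the factors of `ρ^{⊗k}` permutes the factors of every operator
`f^{⊗k}`. -/
theorem IsIrred.comp_map_eq_map_comp (hρ : IsIrred ρ) (w : Equiv.Perm K)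
    (Φ : Module.End ℂ (PiTensorProduct ℂ fun _ : K => V))
    (hΦ : ∀ d, Φ * tensorRep K ρ d = tensorRep K ρ (d ∘ w) * Φ) (f : V →ₗ[ℂ] V) :
    Φ * PiTensorProduct.map (fun _ => f) = PiTensorProduct.map (fun _ => f) * Φ := by
  classical
  have := Fintype.ofFinite G
  obtain ⟨c, rfl⟩ := hρ.exists_eq_sum f
  have key : PiTensorProduct.map (fun _ : K => ∑ g, c g • ρ g) =
      ∑ d : K → G, (∏ i, c (d i)) • tensorRep K ρ d := by
    have h := (PiTensorProduct.mapMultilinear ℂ (fun _ : K => V) fun _ => V).map_sum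
      fun (_ : K) g => c g • ρ g
    refine h.trans (Finset.sum_congr rfl fun d _ => ?_)
    rw [MultilinearMap.map_smul_univ]
    rfl
  rw [key, Finset.mul_sum, Finset.sum_mul]
  refine Fintype.sum_equiv (Equiv.arrowCongr w.symm (Equiv.refl G)) _ _ fun d => ?_
  have e : Equiv.arrowCongr w.symm (Equiv.refl G) d = d ∘ w := rfl
  rw [e, mul_smul_comm, smul_mul_assoc, hΦ]
  congr 1
  exact (Equiv.prod_comp w fun i => c (d i)).symm

end TensorPower

section Main

variable {r k : ℕ} {F : Type*} [Field F] [Fintype F] {V Vπ : Type*} [AddCommGroup V] [Module ℂ V]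
  [AddCommGroup Vπ] [Module ℂ Vπ] {ρ : Representation ℂ (GL (Fin r) F) V}
  {π : Representation ℂ (Matrix (Fin k) (Fin k) (Matrix (Fin r) (Fin r) F))ˣ Vπ}

/-- The group of block lower unitriangular matrices. -/
abbrev lowerGroup (k : ℕ) (R : Type*) [Ring R] : Subgroup (Matrix (Fin k) (Fin k) R)ˣ :=
  orderUnipotent R (valRel (Fin.revPerm : Equiv.Perm (Fin k)))

theorem permUnit_mul_blockDiagUnit {K R : Type*} [Fintype K] [DecidableEq K] [Ring R]
    (w : Equiv.Perm K) (d : K → Rˣ) :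
    permUnit R w * blockDiagUnit d = blockDiagUnit (d ∘ w) * permUnit R w := by
  rw [← mul_inv_eq_iff_eq_mul]
  refine Units.ext (Matrix.ext fun i j => ?_)
  rw [permUnit_conj_val, submatrix_apply, blockDiagUnit_val, blockDiagUnit_val]
  rcases eq_or_ne i j with rfl | hij
  · rw [diagonal_apply_eq, diagonal_apply_eq]
    rfl
  · rw [diagonal_apply_ne _ hij, diagonal_apply_ne _ (w.injective.ne hij)]

/-- A map into `ρ^{⊗k}` which is equivariant for the block upper triangular group has an
equivariant generalized inverse. -/
theorem exists_equivariant_section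
    (T : Vπ →ₗ[ℂ] PiTensorProduct ℂ fun _ : Fin k => V) (hT0 : T ≠ 0)
    (hTN : ∀ n ∈ upperGroup (Fin k) (Matrix (Fin r) (Fin r) F), ∀ v, T (π n v) = T v)
    (hTM : ∀ d v, T (π (blockDiagUnit d) v) = tensorRep (Fin k) ρ d (T v)) :
    ∃ S : (PiTensorProduct ℂ fun _ : Fin k => V) →ₗ[ℂ] Vπ, S ≠ 0 ∧
      (∀ d x, S (tensorRep (Fin k) ρ d x) = π (blockDiagUnit d) (S x)) ∧
      ∀ n ∈ upperGroup (Fin k) (Matrix (Fin r) (Fin r) F), ∀ x, π n (S x) = S x := by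
  classical
  have : Finite (Matrix (Fin r) (Fin r) F) := inferInstanceAs (Finite (Fin r → Fin r → F))
  have : Finite (Matrix (Fin k) (Fin k) (Matrix (Fin r) (Fin r) F)) :=
    inferInstanceAs (Finite (Fin k → Fin k → Matrix (Fin r) (Fin r) F))
  have := Fintype.ofFinite (GL (Fin r) F)
  obtain ⟨s, hs⟩ := exists_mul_mul_eq_self T
  let f : (Fin k → GL (Fin r) F) → (PiTensorProduct ℂ fun _ : Fin k => V) →ₗ[ℂ] Vπ := fun d =>
    π (blockDiagUnit d) ∘ₗ subgroupAverage π (upperGroup (Fin k) (Matrix (Fin r) (Fin r) F)) ∘ₗ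
      s ∘ₗ tensorRep (Fin k) ρ d⁻¹
  have hf : ∀ d x, f d x = subgroupAverage π (upperGroup (Fin k) (Matrix (Fin r) (Fin r) F))
      (π (blockDiagUnit d) (s (tensorRep (Fin k) ρ d⁻¹ x))) := fun d x =>
    blockDiagUnit_average π (isStrictRel_valRel _) _ _
  refine ⟨∑ d, f d, fun h0 => hT0 ?_, fun d x => ?_, fun n hn x => ?_⟩
  · refine LinearMap.ext fun v => ?_
    have h1 : ∀ d, T (f d (T v)) = T v := fun d => by
      rw [hf, apply_subgroupAverage_of_invariant π T hTN, ← hTM d⁻¹ v, hTM, hs, hTM,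
        ← Module.End.mul_apply, tensorRep_mul_inv, Module.End.one_apply]
    have h2 := congrArg T (LinearMap.congr_fun h0 (T v))
    rw [LinearMap.sum_apply, map_sum, Finset.sum_congr rfl fun d _ => h1 d, Finset.sum_const,
      Finset.card_univ, LinearMap.zero_apply, map_zero, ← Nat.cast_smul_eq_nsmul ℂ] at h2
    exact (smul_eq_zero.1 h2).resolve_left (by simp)
  · rw [LinearMap.sum_apply, LinearMap.sum_apply, map_sum]
    refine (Fintype.sum_equiv (Equiv.mulLeft d) _ _ fun c => ?_).symm
    simp only [f, LinearMap.comp_apply, Equiv.coe_mulLeft, map_mul, _root_.mul_inv_rev,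
      Module.End.mul_apply]
    rw [← Module.End.mul_apply (tensorRep (Fin k) ρ d⁻¹), ← map_mul, inv_mul_cancel, map_one,
      Module.End.one_apply]
  · rw [LinearMap.sum_apply, map_sum]
    refine Finset.sum_congr rfl fun d _ => ?_
    rw [hf, apply_subgroupAverage π hn]

/-- Comparison of the two unipotent averages at a block permutation. -/
theorem apply_average_lower_permUnit {X : Type*} [AddCommGroup X] [Module ℂ X]
    (T : Vπ →ₗ[ℂ] X)
    (hTN : ∀ n ∈ upperGroup (Fin k) (Matrix (Fin r) (Fin r) F), ∀ v, T (π n v) = T v)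
    (w : Equiv.Perm (Fin k)) (v : Vπ)
    (hv : ∀ u ∈ lowerGroup k (Matrix (Fin r) (Fin r) F), π u v = v) :
    T (subgroupAverage π (lowerGroup k (Matrix (Fin r) (Fin r) F)) (π (permUnit _ w) v)) =
      T (π (permUnit _ w)
        (subgroupAverage π (upperGroup (Fin k) (Matrix (Fin r) (Fin r) F)) v)) := by
  have : Finite (Matrix (Fin r) (Fin r) F) := inferInstanceAs (Finite (Fin r → Fin r → F))
  have : Finite (Matrix (Fin k) (Fin k) (Matrix (Fin r) (Fin r) F)) :=
    inferInstanceAs (Finite (Fin k → Fin k → Matrix (Fin r) (Fin r) F))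
  let D : Fin k → Fin k → Prop := valRel w.symm
  let D' : Fin k → Fin k → Prop := valRel (w.symm.trans Fin.revPerm)
  have hD : IsStrictRel D := isStrictRel_valRel _
  have hD' : IsStrictRel D' := isStrictRel_valRel _
  have hlt : IsStrictRel (valRel fun i : Fin k => i) := isStrictRel_valRel _
  have hgt : IsStrictRel (valRel (Fin.revPerm : Equiv.Perm (Fin k))) := isStrictRel_valRel _
  have hinf : ∀ {E E' : Fin k → Fin k → Prop}, IsStrictRel E → IsStrictRel E' →
      IsStrictRel fun i j => E i j ∧ E' i j := fun hE hE' =>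
    ⟨fun i hi => hE.irrefl i hi.1, fun i j l hij hjl =>
      ⟨hE.trans i j l hij.1 hjl.1, hE'.trans i j l hij.2 hjl.2⟩⟩
  have hcase : ∀ i j, i ≠ j → w.symm i < w.symm j ∨ w.symm j < w.symm i := fun i j hij =>
    lt_or_gt_of_ne (w.symm.injective.ne hij)
  have hTQ : ∀ x, T (π (permUnit _ w)
      (subgroupAverage π (orderUnipotent (Matrix (Fin r) (Fin r) F) D) x)) =
      T (π (permUnit _ w) x) := fun x => by
    rw [apply_subgroupAverage_conj π (U₂ := upperGroup (Fin k) (Matrix (Fin r) (Fin r) F))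
      (permUnit_conj_mem hlt hD w fun i j => by simp [D, valRel]),
      apply_subgroupAverage_of_invariant π T hTN]
  have h1 : subgroupAverage π (orderUnipotent (Matrix (Fin r) (Fin r) F) D') v =
      subgroupAverage π (orderUnipotent (Matrix (Fin r) (Fin r) F)
        fun i j => D' i j ∧ valRel (fun i : Fin k => i) i j) v := by
    rw [average_orderUnipotent_eq_comp π hD' (hinf hD' hlt) (hinf hD' hgt)]
    · rw [subgroupAverage_of_fixed π (v := v) fun u hu =>
        hv u (orderUnipotent_mono hgt (hinf hD' hgt) (fun i j h => h.2) hu)]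
    · intro i j
      simp only [← and_or_left, iff_self_and]
      intro hij
      have hne : i ≠ j := by rintro rfl; exact hD'.irrefl _ hij
      simpa [valRel] using hne
    · rintro i j ⟨-, h2⟩ ⟨-, h3⟩
      simp only [valRel, Fin.revPerm_apply, Fin.rev_lt_rev] at h2 h3
      exact lt_asymm h2 h3
  have h2 : subgroupAverage π (upperGroup (Fin k) (Matrix (Fin r) (Fin r) F)) v =
      subgroupAverage π (orderUnipotent (Matrix (Fin r) (Fin r) F)
        fun i j => D i j ∧ valRel (fun i : Fin k => i) i j)
      (subgroupAverage π (orderUnipotent (Matrix (Fin r) (Fin r) F)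
        fun i j => D' i j ∧ valRel (fun i : Fin k => i) i j) v) := by
    refine average_orderUnipotent_eq_comp π hlt (hinf hD hlt) (hinf hD' hlt) ?_ ?_ v
    · intro i j
      simp only [← or_and_right, iff_and_self]
      intro hij
      simpa [D, D', valRel] using hcase i j hij.ne
    · rintro i j ⟨h2, -⟩ ⟨h3, -⟩
      simp only [D, D', valRel, Equiv.trans_apply, Fin.revPerm_apply, Fin.rev_lt_rev] at h2 h3
      exact lt_asymm h2 h3
  rw [← apply_subgroupAverage_conj π (U₁ := orderUnipotent (Matrix (Fin r) (Fin r) F) D')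
    (permUnit_conj_mem hgt hD' w fun i j => by simp [D', valRel]), h1, h2,
    ← hTQ (subgroupAverage π _ (subgroupAverage π _ v)),
    subgroupAverage_absorb π (orderUnipotent_mono hD (hinf hD hlt) fun i j h => h.1), hTQ]

theorem exists_equiv_comp_of_intertwiner [FiniteDimensional ℂ V] (hr : 0 < r)
    (hρ : IsIrred ρ) (hcusp : IsCuspidal ρ) (hπ : IsIrred π)
    (T : Vπ →ₗ[ℂ] PiTensorProduct ℂ fun _ : Fin k => V) (hT0 : T ≠ 0)
    (hTN : ∀ n ∈ upperGroup (Fin k) (Matrix (Fin r) (Fin r) F), ∀ v, T (π n v) = T v)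
    (hTM : ∀ d v, T (π (blockDiagUnit d) v) = tensorRep (Fin k) ρ d (T v))
    (θ : (Matrix (Fin k) (Fin k) (Matrix (Fin r) (Fin r) F))ˣ ≃*
      (Matrix (Fin k) (Fin k) (Matrix (Fin r) (Fin r) F))ˣ)
    (θ₀ : GL (Fin r) F → GL (Fin r) F)
    (hθN : ∀ n ∈ upperGroup (Fin k) (Matrix (Fin r) (Fin r) F),
      θ n ∈ lowerGroup k (Matrix (Fin r) (Fin r) F))
    (hθM : ∀ d : Fin k → GL (Fin r) F, θ (blockDiagUnit d) = blockDiagUnit (θ₀ ∘ d))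
    (hθw : ∀ w, θ (permUnit _ w) = permUnit _ w)
    (A : V ≃ₗ[ℂ] V) (hA : ∀ g v, A (ρ (θ₀ g) v) = ρ g (A v)) :
    ∃ e : Vπ ≃ₗ[ℂ] Vπ, ∀ g x, e (π g x) = π (θ g) (e x) := by
  have : Finite (Matrix (Fin r) (Fin r) F) := inferInstanceAs (Finite (Fin r → Fin r → F))
  have : Finite (Matrix (Fin k) (Fin k) (Matrix (Fin r) (Fin r) F)) :=
    inferInstanceAs (Finite (Fin k → Fin k → Matrix (Fin r) (Fin r) F))
  obtain ⟨S₀, hS₀, hS₀M, hS₀N⟩ := exists_equivariant_section T hT0 hTN hTM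
  let S₁ := subgroupAverage π (lowerGroup k (Matrix (Fin r) (Fin r) F)) ∘ₗ S₀
  have hS₁ : S₁ ≠ 0 := hcusp.average_comp_ne_zero 1 Fin.revPerm S₀ hS₀ hS₀M hS₀N
  have hS₁M : ∀ d x, S₁ (tensorRep (Fin k) ρ d x) = π (blockDiagUnit d) (S₁ x) := fun d x => by
    simp only [S₁, LinearMap.comp_apply]
    rw [hS₀M, blockDiagUnit_average π (isStrictRel_valRel _)]
  have hS₁N : ∀ u ∈ lowerGroup k (Matrix (Fin r) (Fin r) F), ∀ x, π u (S₁ x) = S₁ x :=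
    fun u hu x => apply_subgroupAverage π hu _
  let S := subgroupAverage π (upperGroup (Fin k) (Matrix (Fin r) (Fin r) F)) ∘ₗ S₁
  have hS : S ≠ 0 := hcusp.average_comp_ne_zero Fin.revPerm 1 S₁ hS₁ hS₁M hS₁N
  have hSM : ∀ d x, S (tensorRep (Fin k) ρ d x) = π (blockDiagUnit d) (S x) := fun d x => by
    simp only [S, LinearMap.comp_apply]
    rw [hS₁M, blockDiagUnit_average π (isStrictRel_valRel _)]
  have hSN : ∀ u ∈ upperGroup (Fin k) (Matrix (Fin r) (Fin r) F), ∀ x, π u (S x) = S x :=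
    fun u hu x => apply_subgroupAverage π hu _
  let B : (PiTensorProduct ℂ fun _ : Fin k => V) ≃ₗ[ℂ] PiTensorProduct ℂ fun _ : Fin k => V :=
    PiTensorProduct.congr fun _ => A
  have hBmap : (B : Module.End ℂ (PiTensorProduct ℂ fun _ : Fin k => V)) =
      PiTensorProduct.map fun _ => (A : V →ₗ[ℂ] V) := rfl
  have hB : ∀ (d : Fin k → GL (Fin r) F) x,
      B (tensorRep (Fin k) ρ (θ₀ ∘ d) x) = tensorRep (Fin k) ρ d (B x) := fun d x => by
    have : (PiTensorProduct.map fun _ => (A : V →ₗ[ℂ] V)) ∘ₗ tensorRep (Fin k) ρ (θ₀ ∘ d) =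
        tensorRep (Fin k) ρ d ∘ₗ PiTensorProduct.map fun _ => (A : V →ₗ[ℂ] V) := by
      rw [tensorRep_apply, tensorRep_apply, ← PiTensorProduct.map_comp,
        ← PiTensorProduct.map_comp]
      congr 1
      funext i
      exact LinearMap.ext fun v => hA (d i) v
    exact LinearMap.congr_fun this x
  have hBs : ∀ (d : Fin k → GL (Fin r) F) x,
      B.symm (tensorRep (Fin k) ρ d x) = tensorRep (Fin k) ρ (θ₀ ∘ d) (B.symm x) := fun d x => by
    rw [LinearEquiv.symm_apply_eq, hB, LinearEquiv.apply_symm_apply]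
  let T₁ := T ∘ₗ subgroupAverage π (lowerGroup k (Matrix (Fin r) (Fin r) F))
  have hT₁N : ∀ u ∈ lowerGroup k (Matrix (Fin r) (Fin r) F), ∀ v, T₁ (π u v) = T₁ v :=
    fun u hu v => congrArg T (subgroupAverage_apply_of_mem π hu v)
  have hT₁M : ∀ d v, T₁ (π (blockDiagUnit d) v) = tensorRep (Fin k) ρ d (T₁ v) := fun d v => by
    simp only [T₁, LinearMap.comp_apply]
    rw [← blockDiagUnit_average π (isStrictRel_valRel _), hTM]
  let Φ : (Matrix (Fin k) (Fin k) (Matrix (Fin r) (Fin r) F))ˣ →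
      Module.End ℂ (PiTensorProduct ℂ fun _ : Fin k => V) := fun g => T ∘ₗ π g ∘ₗ S
  let Φ' : (Matrix (Fin k) (Fin k) (Matrix (Fin r) (Fin r) F))ˣ →
      Module.End ℂ (PiTensorProduct ℂ fun _ : Fin k => V) :=
    fun g => (B : Module.End ℂ (PiTensorProduct ℂ fun _ : Fin k => V)) ∘ₗ T₁ ∘ₗ π (θ g) ∘ₗ
      S₁ ∘ₗ (B.symm : Module.End ℂ (PiTensorProduct ℂ fun _ : Fin k => V))
  have hw : ∀ w, Φ (permUnit _ w) = Φ' (permUnit _ w) := fun w => by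
    have hc : ∀ d, Φ (permUnit _ w) * tensorRep (Fin k) ρ d =
        tensorRep (Fin k) ρ (d ∘ w) * Φ (permUnit _ w) := fun d => by
      refine LinearMap.ext fun x => ?_
      simp only [Φ, Module.End.mul_apply, LinearMap.comp_apply]
      rw [hSM, ← hTM, ← Module.End.mul_apply (π _), ← Module.End.mul_apply (π _), ← map_mul,
        ← map_mul, permUnit_mul_blockDiagUnit]
    have hcomm := hρ.comp_map_eq_map_comp w _ hc (A : V →ₗ[ℂ] V)
    rw [← hBmap] at hcomm
    refine LinearMap.ext fun x => ?_
    have h1 := LinearMap.congr_fun hcomm (B.symm x)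
    simp only [Module.End.mul_apply, LinearEquiv.coe_coe, LinearEquiv.apply_symm_apply] at h1
    rw [h1]
    simp only [Φ, Φ', LinearMap.comp_apply, LinearEquiv.coe_coe, S, T₁, hθw]
    rw [apply_average_lower_permUnit T hTN w _ fun u hu => hS₁N u hu _]
  have hbi : IsBiequivariant ρ (Φ - Φ') :=
    { unipotent_mul := fun n hn g => by
        refine LinearMap.ext fun x => ?_
        simp only [Φ, Φ', Pi.sub_apply, LinearMap.sub_apply, LinearMap.comp_apply, map_mul,
          Module.End.mul_apply]
        rw [hTN n hn, hT₁N _ (hθN n hn)]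
      mul_unipotent := fun n hn g => by
        refine LinearMap.ext fun x => ?_
        simp only [Φ, Φ', Pi.sub_apply, LinearMap.sub_apply, LinearMap.comp_apply, map_mul,
          Module.End.mul_apply]
        rw [hSN n hn, hS₁N _ (hθN n hn)]
      blockDiag_mul := fun d g => by
        refine LinearMap.ext fun x => ?_
        simp only [Φ, Φ', Pi.sub_apply, LinearMap.sub_apply, LinearMap.comp_apply, map_mul,
          Module.End.mul_apply, map_sub, LinearEquiv.coe_coe, hθM]
        rw [hTM, hT₁M, hB]
      mul_blockDiag := fun d g => by
        refine LinearMap.ext fun x => ?_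
        simp only [Φ, Φ', Pi.sub_apply, LinearMap.sub_apply, LinearMap.comp_apply, map_mul,
          Module.End.mul_apply, LinearEquiv.coe_coe, hθM]
        rw [hSM, hBs, hS₁M] }
  have hΦ : Φ = Φ' := sub_eq_zero.1 (hbi.eq_zero hr hcusp fun w => sub_eq_zero.2 (hw w))
  obtain ⟨x, hx⟩ : ∃ x, S x ≠ 0 := by
    by_contra! h
    exact hS (LinearMap.ext h)
  have hne : ∃ g, T (π g (S x)) ≠ 0 := by
    by_contra! h
    have hspan := (hπ.2 (Submodule.span ℂ (Set.range fun g => π g (S x))) (by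
      intro g
      change Submodule.span ℂ _ ≤ (Submodule.span ℂ _).comap (π g)
      refine Submodule.span_le.2 ?_
      rintro _ ⟨y, rfl⟩
      refine Submodule.subset_span ⟨g * y, ?_⟩
      simp [map_mul])).resolve_left fun hbot => hx ?_
    · refine hT0 (LinearMap.ker_eq_top.1 (top_le_iff.1 (hspan ▸ Submodule.span_le.2 ?_)))
      rintro _ ⟨y, rfl⟩
      exact h y
    · have : S x ∈ Submodule.span ℂ (Set.range fun g => π g (S x)) :=
        Submodule.subset_span ⟨1, by simp⟩
      rwa [hbot, Submodule.mem_bot] at this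
  have hπ' : IsIrred (π.comp θ.toMonoidHom) := ⟨hπ.1, fun W hW => hπ.2 W fun g v hv => by
    have := hW (θ.symm g) v hv
    simpa using this⟩
  exact hπ.exists_equiv_of_coefficient_eq hπ' T
    ((B : Module.End ℂ (PiTensorProduct ℂ fun _ : Fin k => V)) ∘ₗ T₁) (S x) (S₁ (B.symm x))
    (fun g => LinearMap.congr_fun (congrFun hΦ g) x) hne

end Main

section DualTwist

variable {n F : Type*} [Fintype n] [DecidableEq n] [Field F]

/-- The automorphism `g ↦ τ(g)⁻ᵀ` of the general linear group. -/
def dualTwist (n : Type*) [Fintype n] [DecidableEq n] (τ : F ≃+* F) (hτ : ∀ x, τ (τ x) = x) :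
    GL n F ≃* GL n F where
  toFun g :=
    { val := ((g⁻¹).val.map τ)ᵀ
      inv := (g.val.map τ)ᵀ
      val_inv := by rw [← transpose_mul, ← Matrix.map_mul, Units.mul_inv]; simp
      inv_val := by rw [← transpose_mul, ← Matrix.map_mul, Units.inv_mul]; simp }
  invFun g :=
    { val := ((g⁻¹).val.map τ)ᵀ
      inv := (g.val.map τ)ᵀ
      val_inv := by rw [← transpose_mul, ← Matrix.map_mul, Units.mul_inv]; simp
      inv_val := by rw [← transpose_mul, ← Matrix.map_mul, Units.inv_mul]; simp }
  left_inv g := Units.ext (Matrix.ext fun i j => hτ _)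
  right_inv g := Units.ext (Matrix.ext fun i j => hτ _)
  map_mul' g h := Units.ext (by
    change (((g * h)⁻¹ : GL n F).val.map τ)ᵀ = ((g⁻¹).val.map τ)ᵀ * ((h⁻¹).val.map τ)ᵀ
    rw [← transpose_mul, ← Matrix.map_mul, ← Units.val_mul, _root_.mul_inv_rev])

theorem dualTwist_apply (τ : F ≃+* F) (hτ : ∀ x, τ (τ x) = x) (g : GL n F) (i j : n) :
    (dualTwist n τ hτ g : Matrix n n F) i j = τ ((g⁻¹ : GL n F).val j i) := rfl

theorem trace_dualTwist {V : Type*} [AddCommGroup V] [Module ℂ V] (τ : F ≃+* F)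
    (hτ : ∀ x, τ (τ x) = x) (ρ : Representation ℂ (GL n F) V) (g : GL n F) :
    LinearMap.trace ℂ V (ρ (dualTwist n τ hτ g)) =
      LinearMap.trace ℂ V (ρ (GeneralLinearGroup.map (τ : F →+* F) g⁻¹)) := by
  obtain ⟨p, hp⟩ := exists_conj_eq_transpose (GeneralLinearGroup.map (τ : F →+* F) g⁻¹)
  have h : dualTwist n τ hτ g = p * GeneralLinearGroup.map (τ : F →+* F) g⁻¹ * p⁻¹ :=
    Units.ext hp.symm
  rw [h, map_mul, LinearMap.trace_mul_comm, ← map_mul, ← mul_assoc, inv_mul_cancel, one_mul]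

end DualTwist

section Transfer

variable {k r : ℕ} {F : Type*} [Field F]

/-- The general linear group of size `k * r` as a group of `k × k` block matrices. -/
def blockUnits (k r : ℕ) (F : Type*) [Field F] :
    (Matrix (Fin k) (Fin k) (Matrix (Fin r) (Fin r) F))ˣ ≃* GL (Fin (k * r)) F :=
  (compUnits (Fin k) (Fin r) F).trans
    (Units.mapEquiv (reindexAlgEquiv F F finProdFinEquiv).toMulEquiv)

theorem finProdFinEquiv_eq_emb (i : Fin k) (a : Fin r) : finProdFinEquiv (i, a) = emb i a :=
  Fin.ext (by simp [emb, finProdFinEquiv_apply_val, add_comm, mul_comm])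

theorem blockUnits_apply (g : (Matrix (Fin k) (Fin k) (Matrix (Fin r) (Fin r) F))ˣ)
    (i j : Fin k) (a b : Fin r) :
    (blockUnits k r F g : Matrix (Fin (k * r)) (Fin (k * r)) F) (emb i a) (emb j b) =
      g.val i j a b := by
  rw [← finProdFinEquiv_eq_emb, ← finProdFinEquiv_eq_emb]
  change (compUnits (Fin k) (Fin r) F g).val (finProdFinEquiv.symm (finProdFinEquiv (i, a)))
    (finProdFinEquiv.symm (finProdFinEquiv (j, b))) = _
  rw [Equiv.symm_apply_apply, Equiv.symm_apply_apply]
  rfl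

/-- The automorphism `g ↦ τ(g)⁻ᵀ` on block matrices. -/
def blockTwist (k r : ℕ) (τ : F ≃+* F) (hτ : ∀ x, τ (τ x) = x) :
    (Matrix (Fin k) (Fin k) (Matrix (Fin r) (Fin r) F))ˣ ≃*
      (Matrix (Fin k) (Fin k) (Matrix (Fin r) (Fin r) F))ˣ :=
  ((blockUnits k r F).trans (dualTwist _ τ hτ)).trans (blockUnits k r F).symm

variable (τ : F ≃+* F) (hτ : ∀ x, τ (τ x) = x)

theorem blockUnits_blockTwist (g) :
    blockUnits k r F (blockTwist k r τ hτ g) = dualTwist _ τ hτ (blockUnits k r F g) :=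
  MulEquiv.apply_symm_apply _ _

theorem blockTwist_apply (g : (Matrix (Fin k) (Fin k) (Matrix (Fin r) (Fin r) F))ˣ)
    (i j : Fin k) (a b : Fin r) :
    (blockTwist k r τ hτ g).val i j a b = τ ((g⁻¹).val j i b a) := by
  rw [← blockUnits_apply, blockUnits_blockTwist, dualTwist_apply, ← map_inv, blockUnits_apply]

theorem blockTwist_blockDiagUnit (d : Fin k → GL (Fin r) F) :
    blockTwist k r τ hτ (blockDiagUnit d) = blockDiagUnit (dualTwist (Fin r) τ hτ ∘ d) := by
  refine Units.ext (Matrix.ext fun i j => Matrix.ext fun a b => ?_)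
  rw [blockTwist_apply, ← map_inv, blockDiagUnit_val, blockDiagUnit_val]
  rcases eq_or_ne i j with rfl | hij
  · rw [diagonal_apply_eq, diagonal_apply_eq]
    rfl
  · rw [diagonal_apply_ne _ hij, diagonal_apply_ne _ hij.symm]
    simp

theorem blockTwist_permUnit (w : Equiv.Perm (Fin k)) :
    blockTwist k r τ hτ (permUnit _ w) = permUnit _ w := by
  refine Units.ext (Matrix.ext fun i j => Matrix.ext fun a b => ?_)
  rw [blockTwist_apply, permUnit_inv, permUnit_val, permUnit_val, Equiv.Perm.permMatrix,
    Equiv.Perm.permMatrix, PEquiv.toMatrix_apply, PEquiv.toMatrix_apply]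
  have hinv : i ∈ Equiv.toPEquiv w⁻¹ j ↔ w i = j := by
    simp only [Equiv.toPEquiv_apply, Option.mem_def, Option.some.injEq]
    exact (Equiv.symm_apply_eq w).trans eq_comm
  have hw : j ∈ Equiv.toPEquiv w i ↔ w i = j := by simp
  by_cases h : w i = j
  · rw [if_pos (hinv.2 h), if_pos (hw.2 h)]
    rcases eq_or_ne a b with rfl | hab
    · simp
    · simp [hab, hab.symm]
  · rw [if_neg fun hj => h (hinv.1 hj), if_neg fun hj => h (hw.1 hj)]
    simp

theorem blockTwist_mem_lowerGroup [Finite F]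
    {n : (Matrix (Fin k) (Fin k) (Matrix (Fin r) (Fin r) F))ˣ}
    (hn : n ∈ upperGroup (Fin k) (Matrix (Fin r) (Fin r) F)) :
    blockTwist k r τ hτ n ∈ lowerGroup k (Matrix (Fin r) (Fin r) F) := by
  have : Finite (Matrix (Fin r) (Fin r) F) := inferInstanceAs (Finite (Fin r → Fin r → F))
  have hn' := (mem_orderUnipotent (isStrictRel_valRel _)).1 (Subgroup.inv_mem _ hn)
  rw [mem_orderUnipotent (isStrictRel_valRel _)]
  intro i j hij
  refine Matrix.ext fun a b => ?_
  rw [blockTwist_apply, hn' j i (by simpa [valRel] using hij)]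
  rcases eq_or_ne i j with rfl | hne
  · simp only [one_apply_eq]
    simp only [one_apply, eq_comm, apply_ite τ, map_one, map_zero]
  · rw [one_apply_ne hne, one_apply_ne hne.symm]
    simp

end Transfer

/-- Let `F` be a finite field of odd characteristic and `τ` an involutive
field automorphism of `F`, applied entrywise to matrices.  Let `ρ` be an irreducible
cuspidal complex representation of `GL_r(F)` with `χ_ρ(τ(g)) = χ_ρ(g⁻¹)` for all `g`.
Then every irreducible constituent `π` of the parabolic induction of `ρ^{⊗k}` to
`GL_{rk}(F)` satisfies `χ_π(τ(g)) = χ_π(g⁻¹)` for all `g`. -/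
theorem stmt8 (F : Type) [Field F] [Fintype F] (hodd : Odd (ringChar F))
    (τ : F ≃+* F) (hτ : ∀ x, τ (τ x) = x)
    (r k : ℕ) (hr : 1 ≤ r) (hk : 1 ≤ k)
    (V : Type) [AddCommGroup V] [Module ℂ V] [FiniteDimensional ℂ V]
    (ρ : Representation ℂ (GL (Fin r) F) V)
    (hρirr : IsIrred ρ) (hρcusp : IsCuspidal ρ)
    (hρchar : ∀ g : GL (Fin r) F,
      LinearMap.trace ℂ V (ρ (Matrix.GeneralLinearGroup.map (τ : F →+* F) g)) =
        LinearMap.trace ℂ V (ρ g⁻¹))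
    (Vπ : Type) [AddCommGroup Vπ] [Module ℂ Vπ] [FiniteDimensional ℂ Vπ]
    (π : Representation ℂ (GL (Fin (k * r)) F) Vπ) (hπirr : IsIrred π)
    (hconst : ∃ T : Vπ →ₗ[ℂ] PiTensorProduct ℂ (fun _ : Fin k => V),
      T ≠ 0 ∧ IntertwinesParab ρ π T) :
    ∀ g : GL (Fin (k * r)) F,
      LinearMap.trace ℂ Vπ (π (Matrix.GeneralLinearGroup.map (τ : F →+* F) g)) =
        LinearMap.trace ℂ Vπ (π g⁻¹) := by
  have : Finite (Matrix (Fin r) (Fin r) F) := inferInstanceAs (Finite (Fin r → Fin r → F))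
  have := Fintype.ofFinite (GL (Fin r) F)
  have hρ' : IsIrred (ρ.comp (dualTwist (Fin r) τ hτ).toMonoidHom) :=
    ⟨hρirr.1, fun W hW => hρirr.2 W fun g v hv => by
      have := hW ((dualTwist (Fin r) τ hτ).symm g) v hv
      simpa using this⟩
  obtain ⟨A, hA⟩ := hρ'.exists_intertwiner hρirr fun g => by
    refine (trace_dualTwist τ hτ ρ g).trans ?_
    rw [hρchar, inv_inv]
  obtain ⟨T, hT0, hT⟩ := hconst
  have hπ' : IsIrred (π.comp (blockUnits k r F).toMonoidHom) :=
    ⟨hπirr.1, fun W hW => hπirr.2 W fun g v hv => by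
      have := hW ((blockUnits k r F).symm g) v hv
      simpa using this⟩
  obtain ⟨e, he⟩ := exists_equiv_comp_of_intertwiner hr hρirr hρcusp hπ' T hT0
    (fun n hn v => by
      rw [mem_orderUnipotent (isStrictRel_valRel _)] at hn
      refine (hT (blockUnits k r F n) (fun i j a b hij => ?_) 1 (fun i a b => ?_) v).trans ?_
      · rw [blockUnits_apply, hn i j (not_lt.2 hij.le), one_apply_ne hij.ne']
        rfl
      · rw [blockUnits_apply, hn i i (lt_irrefl _), one_apply_eq]
        rfl
      · exact LinearMap.congr_fun (map_one (tensorRep (Fin k) ρ)) (T v))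
    (fun d v => hT (blockUnits k r F (blockDiagUnit d))
      (fun i j a b hij => by
        rw [blockUnits_apply, blockDiagUnit_val, diagonal_apply_ne _ hij.ne']
        rfl) d
      (fun i a b => by rw [blockUnits_apply, blockDiagUnit_val, diagonal_apply_eq]) v)
    (blockTwist k r τ hτ) (dualTwist (Fin r) τ hτ)
    (fun n hn => blockTwist_mem_lowerGroup τ hτ hn) (blockTwist_blockDiagUnit τ hτ)
    (blockTwist_permUnit τ hτ) A hA
  have htr : ∀ g, LinearMap.trace ℂ Vπ (π (dualTwist _ τ hτ g)) =
      LinearMap.trace ℂ Vπ (π g) := fun g => by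
    obtain ⟨x, rfl⟩ := (blockUnits k r F).surjective g
    have hc : π (dualTwist _ τ hτ (blockUnits k r F x)) = e.conj (π (blockUnits k r F x)) := by
      rw [← blockUnits_blockTwist]
      refine LinearMap.ext fun v => ?_
      rw [LinearEquiv.conj_apply_apply]
      refine Eq.trans ?_ (he x (e.symm v)).symm
      rw [LinearEquiv.apply_symm_apply]
      rfl
    rw [hc, LinearMap.trace_conj']
  intro g
  rw [← htr g⁻¹, trace_dualTwist, inv_inv]
end

section
/- Let q be an odd prime power, F a finite field of characteristic dividing q (e.g. F = 𝔽_q or 𝔽_{q²}), and τ : F → F a field automorphism with τ∘τ = id, applied entrywise to matrices. Let r, k ≥ 1, let B ∈ GL_{rk}(F) be such that σ(X) := B·τ(X)·B⁻¹ is an involutive automorphism of GL_{rk}(F), and let H = {g ∈ GL_{rk}(F) : σ(g) = g}. Let ρ be an irreducible cuspidal complex representation of GL_r(F). If some irreducible constituent of the parabolic induction of ρ^{⊗k} to GL_{rk}(F) has a nonzero H-fixed vector, then χ_ρ(τ(g)) = χ_ρ(g⁻¹) for all g ∈ GL_r(F). -/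
open Matrix

theorem exists_pow_isIdempotentElem {M : Type*} [Monoid M] [Finite M] (c : M) :
    ∃ m : ℕ, 0 < m ∧ IsIdempotentElem (c ^ m) := by
  obtain ⟨i, j, hij, h⟩ := Finite.exists_ne_map_eq_of_infinite (fun n : ℕ => c ^ n)
  wlog hlt : i < j generalizing i j
  · exact this j i hij.symm h.symm (by omega)
  obtain ⟨d, rfl⟩ := Nat.exists_eq_add_of_lt hlt
  have key : ∀ t s : ℕ, c ^ (i + s + t * (d + 1)) = c ^ (i + s) := by
    intro t
    induction t with
    | zero => simp
    | succ t ih =>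
      intro s
      have : i + s + (t + 1) * (d + 1) = (i + d + 1) + (s + t * (d + 1)) := by ring
      rw [this, pow_add]
      rw [← h, ← pow_add, ← add_assoc, ih]
  refine ⟨(i + 1) * (d + 1), by positivity, ?_⟩
  obtain ⟨s, hs⟩ : ∃ s, (i + 1) * (d + 1) = i + s :=
    ⟨(i + 1) * (d + 1) - i, by nlinarith [Nat.sub_add_cancel (show i ≤ (i + 1) * (d + 1) by nlinarith)]⟩
  have := key (i + 1) s
  rw [← hs, pow_add] at this
  exact this

section Intertwiner

variable {G V : Type*} [Group G] [AddCommGroup V] [Module ℂ V]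

theorem IsIrred.range_eq_top {ρ : Representation ℂ G V} (hρ : IsIrred ρ) {W : Type*}
    [AddCommGroup W] [Module ℂ W] (b : W →ₗ[ℂ] V) (hb : b ≠ 0)
    (hinv : ∀ g w, ρ g (b w) ∈ LinearMap.range b) : LinearMap.range b = ⊤ := by
  refine (hρ.2 (LinearMap.range b) ?_).resolve_left ?_
  · rintro g _ ⟨w, rfl⟩
    exact hinv g w
  · rwa [LinearMap.range_eq_bot]

variable [FiniteDimensional ℂ V]

/-- A nonzero map `b : V* → V` intertwining the dual of `ρ` with the twist of `ρ` by `θ`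
forces the corresponding characters to agree. -/
theorem trace_eq_of_intertwiner {ρ : Representation ℂ G V} (hρ : IsIrred ρ) (θ : G → G)
    (hθ : Function.Surjective θ) (b : Module.Dual ℂ V →ₗ[ℂ] V) (hb : b ≠ 0)
    (hinv : ∀ g f, ρ (θ g) (b (f ∘ₗ ρ g)) = b f) (g : G) :
    LinearMap.trace ℂ V (ρ (θ g)) = LinearMap.trace ℂ V (ρ g⁻¹) := by
  have hinv' : ∀ g f, ρ (θ g) (b f) = b ((ρ g⁻¹).dualMap f) := by
    intro g f
    rw [← hinv g ((ρ g⁻¹).dualMap f)]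
    congr 2
    ext v
    simp
  have hsurj : Function.Surjective b := by
    rw [← LinearMap.range_eq_top]
    refine hρ.range_eq_top b hb fun g w => ?_
    obtain ⟨g, rfl⟩ := hθ g
    exact ⟨_, (hinv' g w).symm⟩
  have hinj : Function.Injective b :=
    (LinearMap.injective_iff_surjective_of_finrank_eq_finrank
      (Subspace.dual_finrank_eq)).2 hsurj
  let e := LinearEquiv.ofBijective b ⟨hinj, hsurj⟩
  have : ρ (θ g) = e.conj ((ρ g⁻¹).dualMap) := by
    ext v
    obtain ⟨f, rfl⟩ := e.surjective v
    rw [LinearEquiv.conj_apply_apply, LinearEquiv.symm_apply_apply]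
    exact hinv' g f
  rw [this, LinearMap.trace_conj']
  exact LinearMap.trace_transpose' _

/-- If a matrix coefficient `f` of `ρ` with `f 1 ≠ 0` is invariant under `g ↦ σ(g)⁻¹`, then the
character of `ρ ∘ σ` is the character of the dual of `ρ`. -/
theorem trace_eq_of_coefficient_symm [Fintype G] {ρ : Representation ℂ G V} (hρ : IsIrred ρ)
    (σ : G ≃* G) (v : V) (l : Module.Dual ℂ V) (hlv : l v ≠ 0)
    (hsymm : ∀ g, l (ρ (σ g)⁻¹ v) = l (ρ g v)) (hσ : ∀ g, σ (σ g) = g) (g : G) :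
    LinearMap.trace ℂ V (ρ (σ g)) = LinearMap.trace ℂ V (ρ g⁻¹) := by
  let b : Module.Dual ℂ V →ₗ[ℂ] V :=
    ∑ g : G, (LinearMap.toSpanSingleton ℂ V (ρ (σ g) v)) ∘ₗ Module.Dual.eval ℂ V (ρ g v)
  have hb : ∀ f, b f = ∑ g : G, f (ρ g v) • ρ (σ g) v := by
    intro f
    simp [b, LinearMap.sum_apply]
  let A : V →ₗ[ℂ] V := ∑ g : G, ρ g ∘ₗ (LinearMap.toSpanSingleton ℂ V v ∘ₗ l) ∘ₗ ρ g⁻¹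
  have hA : ∀ w, A w = ∑ g : G, l (ρ g⁻¹ w) • ρ g v := by
    intro w
    simp [A, LinearMap.sum_apply]
  have hcomm : ∀ g w, ρ g (A w) = A (ρ g w) := by
    intro g w
    rw [hA, hA, map_sum]
    refine Fintype.sum_equiv (Equiv.mulLeft g) _ _ fun x => ?_
    have hx : ρ (g * x)⁻¹ (ρ g w) = ρ x⁻¹ w := by
      rw [← Module.End.mul_apply, ← map_mul]
      congr 2
      group
    rw [Equiv.coe_mulLeft, hx, map_smul, map_mul, Module.End.mul_apply]
  have htr : LinearMap.trace ℂ V A = Fintype.card G * l v := by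
    have : ∀ g : G, LinearMap.trace ℂ V
        (ρ g ∘ₗ (LinearMap.toSpanSingleton ℂ V v ∘ₗ l) ∘ₗ ρ g⁻¹) = l v := by
      intro g
      rw [LinearMap.trace_comp_comm', LinearMap.comp_assoc]
      have h1 : ρ g⁻¹ ∘ₗ ρ g = LinearMap.id := by
        rw [← Module.End.mul_eq_comp, ← map_mul, inv_mul_cancel, map_one]
        rfl
      rw [h1, LinearMap.comp_id, LinearMap.trace_comp_comm']
      have h2 : l ∘ₗ LinearMap.toSpanSingleton ℂ V v = l v • LinearMap.id := by
        ext; simp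
      rw [h2, map_smul, LinearMap.trace_id]
      simp
    simp only [A, map_sum, this]
    simp
  have hA0 : A ≠ 0 := by
    intro h
    rw [h, map_zero] at htr
    have : (Fintype.card G : ℂ) ≠ 0 := by exact_mod_cast Fintype.card_ne_zero
    exact mul_ne_zero this hlv htr.symm
  have hAv : A v ≠ 0 := by
    have hsurj : Function.Surjective A := by
      rw [← LinearMap.range_eq_top]
      exact hρ.range_eq_top A hA0 fun g w => ⟨_, (hcomm g w).symm⟩
    have hinj : Function.Injective A := LinearMap.injective_iff_surjective.2 hsurj
    rw [Ne, map_eq_zero_iff _ hinj]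
    rintro rfl
    exact hlv (map_zero l)
  refine trace_eq_of_intertwiner hρ σ σ.surjective b ?_ ?_ g
  · obtain ⟨f, hf⟩ : ∃ f : Module.Dual ℂ V, f (A v) ≠ 0 := by
      by_contra! h
      exact hAv ((Module.forall_dual_apply_eq_zero_iff ℂ _).1 h)
    intro h0
    apply hf
    have h1 : l (b f) = f (A v) := by
      rw [hb, hA, map_sum, map_sum]
      refine Finset.sum_congr rfl fun x _ => ?_
      have := hsymm (σ x)
      rw [hσ] at this
      simp [this, mul_comm]
    rw [← h1, h0]
    simp
  · intro g f
    rw [hb, hb, map_sum]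
    refine Fintype.sum_equiv (Equiv.mulLeft g) _ _ fun x => ?_
    simp

end Intertwiner

section UnitGroup

variable {R : Type*} [Ring R]

/-- The additive group of elements killing the kernel of the idempotent `y` and mapping into it. -/
def horospherical (y : R) : AddSubgroup R where
  carrier := {M | y * M = 0 ∧ M * y = M}
  zero_mem' := by simp
  add_mem' := by
    rintro a b ⟨ha, ha'⟩ ⟨hb, hb'⟩
    exact ⟨by rw [mul_add, ha, hb, add_zero], by rw [add_mul, ha', hb']⟩
  neg_mem' := by
    rintro a ⟨ha, ha'⟩
    exact ⟨by rw [mul_neg, ha, neg_zero], by rw [neg_mul, ha']⟩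

theorem mul_eq_zero_of_mem_horospherical {y a b : R} (ha : a ∈ horospherical y)
    (hb : b ∈ horospherical y) : a * b = 0 := by
  rw [← ha.2, mul_assoc, hb.1, mul_zero]

/-- The unit `1 + M`, for `M` factoring as a map from the image of `y` to the kernel of `y`. -/
def horosphericalUnit {y M : R} (h : M ∈ horospherical y) : Rˣ where
  val := 1 + M
  inv := 1 - M
  val_inv := by
    simp [mul_sub, add_mul, mul_eq_zero_of_mem_horospherical h h]
  inv_val := by
    simp [mul_add, sub_mul, mul_eq_zero_of_mem_horospherical h h]

variable {V : Type*} [AddCommGroup V] [Module ℂ V]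

/-- Cuspidality of a representation of the unit group of a ring, with parabolic subgroups replaced
by idempotents. -/
def IsRingCuspidal (ρ : Representation ℂ Rˣ V) : Prop :=
  ∀ y : R, IsIdempotentElem y → y ≠ 0 → y ≠ 1 →
    ∀ v : V, (∀ u : Rˣ, (u : R) - 1 ∈ horospherical y → ρ u v = v) → v = 0

/-- Functionals invariant under the horospherical subgroup vanish. -/
theorem IsRingCuspidal.apply_eq_zero [Finite R] {ρ : Representation ℂ Rˣ V}
    (hρ : IsRingCuspidal ρ) {y : R} (hy : IsIdempotentElem y) (hy0 : y ≠ 0) (hy1 : y ≠ 1)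
    (l : Module.Dual ℂ V) (w : V)
    (h : ∀ u : Rˣ, (u : R) - 1 ∈ horospherical y → l (ρ u w) = l w) : l w = 0 := by
  classical
  let Y := horospherical y
  have : Fintype Y := Fintype.ofFinite Y
  let u : Y → Rˣ := fun M => horosphericalUnit M.2
  have hval : ∀ M : Y, ((u M : Rˣ) : R) = 1 + M := fun M => rfl
  have hu : ∀ M : Y, ((u M : Rˣ) : R) - 1 ∈ horospherical y := by
    intro M
    rw [hval, add_sub_cancel_left]
    exact M.2
  have hzero : ∑ M : Y, ρ (u M) w = 0 := by
    refine hρ y hy hy0 hy1 _ fun u' hu' => ?_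
    let M' : Y := ⟨(u' : R) - 1, hu'⟩
    rw [map_sum]
    refine Fintype.sum_equiv (Equiv.addLeft M') _ _ fun M => ?_
    rw [← Module.End.mul_apply, ← map_mul]
    congr 2
    ext
    have : ((u' : R) - 1) * M = 0 := mul_eq_zero_of_mem_horospherical hu' M.2
    rw [Units.val_mul, hval, hval]
    simp only [Equiv.coe_addLeft, AddSubgroup.coe_add, M']
    rw [sub_mul, one_mul, sub_eq_zero] at this
    rw [mul_add, this, mul_one]
    abel
  have := congrArg l hzero
  rw [map_sum, map_zero, Finset.sum_congr rfl fun M _ => h (u M) (hu M)] at this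
  simpa using this

/-- The parts of the horospherical group fixed by `σ` and by its conjugate under `g` together
fill the horospherical group. -/
theorem exists_add_of_commute [Finite R] (σ : R ≃+* R) (hσ : ∀ a, σ (σ a) = a) (g x : Rˣ)
    (hx : (x : R) * σ g = g) (y : R) (hy : IsIdempotentElem y) (m : ℕ)
    (hym : y = (1 + (x : R)) ^ m) (M : R) (hM : M ∈ horospherical y) :
    ∃ M₁ M₂ : R, M = M₁ + M₂ ∧ M₁ ∈ horospherical y ∧ M₂ ∈ horospherical y ∧
      σ M₁ = M₁ ∧ σ (↑g⁻¹ * M₂ * g) = ↑g⁻¹ * M₂ * g := by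
  have h8 : σ (g : R) = ↑x⁻¹ * g := by
    conv_rhs => rw [← hx, Units.inv_mul_cancel_left]
  have hσx : σ x = ↑x⁻¹ := by
    have h := congrArg σ hx
    rw [map_mul, hσ, h8] at h
    exact g.isUnit.mul_right_cancel h
  have hcomm : Commute (x : R) y := by
    rw [hym]
    exact ((Commute.one_right _).add_right (Commute.refl _)).pow_right m
  have hcomm' : Commute (↑x⁻¹ : R) y := hcomm.units_inv_left
  have hσy : σ y = ↑x⁻¹ ^ m * y := by
    rw [hym, map_pow, map_add, map_one, hσx]
    have h : (1 : R) + ↑x⁻¹ = ↑x⁻¹ * (1 + x) := by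
      rw [mul_add, mul_one, Units.inv_mul, add_comm]
    have hc : Commute (↑x⁻¹ : R) (1 + x) :=
      (Commute.one_right _).add_right (Commute.refl (x : R)).units_inv_left
    rw [h, hc.mul_pow]
  have hyσ : y = (x : R) ^ m * σ y := by
    rw [hσy, ← mul_assoc, ← (Commute.refl (x : R)).units_inv_right.mul_pow, Units.mul_inv,
      one_pow, one_mul]
  let Y := horospherical y
  have hYσ : ∀ a ∈ Y, σ a ∈ Y := by
    rintro a ⟨ha, ha'⟩
    refine ⟨?_, ?_⟩
    · rw [hyσ, mul_assoc, ← map_mul, ha, map_zero, mul_zero]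
    · conv_lhs => rw [← ha', map_mul, hσy, mul_assoc, mul_assoc, hy.eq, ← hσy, ← map_mul, ha']
  have hYx : ∀ a ∈ Y, (x : R) * a * ↑x⁻¹ ∈ Y := by
    rintro a ⟨ha, ha'⟩
    refine ⟨?_, ?_⟩
    · rw [← mul_assoc, ← mul_assoc, ← hcomm.eq, mul_assoc (x : R), ha, mul_zero, zero_mul]
    · rw [mul_assoc, hcomm'.eq, ← mul_assoc, mul_assoc (x : R), ha']
  let φ : Y →+ Y :=
    { toFun := fun a => ⟨(x : R) * a * ↑x⁻¹, hYx a a.2⟩ - a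
      map_zero' := by ext; simp
      map_add' := by
        intro a b
        ext
        simp only [AddSubgroup.coe_add, AddSubgroup.coe_sub, mul_add, add_mul]
        abel }
  have hφ : ∀ a : Y, ((φ a : Y) : R) = (x : R) * a * ↑x⁻¹ - a := fun a => rfl
  have hinj : Function.Injective φ := by
    rw [injective_iff_map_eq_zero]
    intro a ha
    have h0 : (x : R) * a * ↑x⁻¹ = a := by
      rw [← sub_eq_zero, ← hφ, ha]
      rfl
    have h1 : Commute (x : R) a := by
      have := congrArg (fun z => z * (x : R)) h0
      rwa [Units.inv_mul_cancel_right] at this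
    have h2 : Commute (a : R) y := by
      rw [hym]
      exact ((Commute.one_right _).add_right h1.symm).pow_right m
    ext
    rw [← a.2.2, h2.eq, a.2.1]
    rfl
  have hsurj : Function.Surjective φ := Finite.injective_iff_surjective.1 hinj
  obtain ⟨M₁, hM₁⟩ := hsurj (⟨_, hYx _ (hYσ _ hM)⟩ - ⟨M, hM⟩)
  have hM₁' : (x : R) * M₁ * ↑x⁻¹ - M₁ = x * σ M * ↑x⁻¹ - M := by
    rw [← hφ, hM₁]
    rfl
  have hσxi : σ (↑x⁻¹ : R) = x := by rw [← hσx, hσ]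
  have hfix : σ M₁ = M₁ := by
    have h3 : φ ⟨σ M₁, hYσ _ M₁.2⟩ = φ M₁ := by
      ext
      rw [hφ, hφ, hM₁']
      have h4 := congrArg σ hM₁'
      simp only [map_sub, map_mul, hσ, hσxi, hσx] at h4
      have h5 := congrArg (fun z => (x : R) * z * ↑x⁻¹) h4
      simp only [mul_sub, sub_mul, mul_assoc, Units.mul_inv, Units.mul_inv_cancel_left,
        mul_one] at h5
      simp only [mul_assoc]
      rw [← neg_sub M, ← h5, neg_sub]
    exact congrArg Subtype.val (hinj h3)
  refine ⟨M₁, M - M₁, by abel, M₁.2, (Y.sub_mem hM M₁.2), hfix, ?_⟩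
  have h6 : (x : R) * σ (M - M₁) * ↑x⁻¹ = M - M₁ := by
    rw [map_sub, hfix, mul_sub, sub_mul]
    have h9 : (x : R) * σ M * ↑x⁻¹ = (x * M₁ * ↑x⁻¹ - M₁) + M := by rw [hM₁', sub_add_cancel]
    rw [h9]
    abel
  have h7 : σ (↑g⁻¹ : R) = ↑g⁻¹ * x := by
    have : σ (↑g⁻¹ : R) * σ g = ↑g⁻¹ * x * σ g := by
      rw [← map_mul, Units.inv_mul, map_one, mul_assoc, hx, Units.inv_mul]
    exact (g.isUnit.map σ).mul_right_cancel this
  rw [map_mul, map_mul, h7, h8]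
  conv_rhs => rw [← h6]
  simp only [mul_assoc]

/-- The involution induced by `σ` on the unit group. -/
abbrev unitsAut (σ : R ≃+* R) : Rˣ ≃* Rˣ := Units.mapEquiv (σ : R ≃* R)

/-- A vector fixed by the `σ`-fixed units can be replaced by one on which all units `n` with
`σ n = -n` act through a common sign. -/
theorem exists_eigenvector (σ : R ≃+* R)
    (ρ : Representation ℂ Rˣ V) (v₀ : V) (hv₀ : v₀ ≠ 0)
    (hfix : ∀ h : Rˣ, unitsAut σ h = h → ρ h v₀ = v₀) :
    ∃ η : ℂ, η * η = 1 ∧ ∃ v : V, v ≠ 0 ∧ (∀ h : Rˣ, unitsAut σ h = h → ρ h v = v) ∧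
      ∀ n : Rˣ, unitsAut σ n = -n → ρ n v = η • v := by
  by_cases hn : ∃ n : Rˣ, unitsAut σ n = -n
  · obtain ⟨n₀, hn₀⟩ := hn
    have hsplit : ∀ n : Rˣ, unitsAut σ n = -n → unitsAut σ (n₀⁻¹ * n) = n₀⁻¹ * n := by
      intro n hn
      rw [map_mul, map_inv, hn₀, hn, inv_neg, neg_mul_neg]
    have hsq : ρ n₀ (ρ n₀ v₀) = v₀ := by
      rw [← Module.End.mul_apply, ← map_mul]
      apply hfix
      rw [map_mul, hn₀, neg_mul_neg]
    have hfix' : ∀ h : Rˣ, unitsAut σ h = h → ρ h (ρ n₀ v₀) = ρ n₀ v₀ := by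
      intro h hh
      have : h * n₀ = n₀ * (n₀⁻¹ * (h * n₀)) := by rw [mul_inv_cancel_left]
      rw [← Module.End.mul_apply, ← map_mul, this, map_mul, Module.End.mul_apply,
        hfix _ (hsplit _ (by rw [map_mul, hh, hn₀, mul_neg]))]
    have hdecomp : ∀ n : Rˣ, unitsAut σ n = -n → ρ n v₀ = ρ n₀ v₀ := by
      intro n hn
      have : n = n₀ * (n₀⁻¹ * n) := by rw [mul_inv_cancel_left]
      rw [this, map_mul, Module.End.mul_apply, hfix _ (hsplit _ hn)]
    have hdecomp' : ∀ n : Rˣ, unitsAut σ n = -n → ρ n (ρ n₀ v₀) = v₀ := by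
      intro n hn
      rw [← Module.End.mul_apply, ← map_mul]
      apply hfix
      rw [map_mul, hn₀, hn, neg_mul_neg]
    by_cases hw : v₀ + ρ n₀ v₀ = 0
    · refine ⟨-1, by norm_num, v₀, hv₀, hfix, fun n hn => ?_⟩
      rw [hdecomp n hn, neg_one_smul]
      exact eq_neg_of_add_eq_zero_right hw
    · refine ⟨1, by norm_num, v₀ + ρ n₀ v₀, hw, fun h hh => ?_, fun n hn => ?_⟩
      · rw [map_add, hfix h hh, hfix' h hh]
      · rw [map_add, hdecomp n hn, hdecomp' n hn, one_smul, add_comm]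
  · exact ⟨1, by norm_num, v₀, hv₀, hfix, fun n h => (hn ⟨n, h⟩).elim⟩

/-- Averaging produces a functional with the same equivariance as the given vector. -/
theorem exists_functional [Finite R] (σ : R ≃+* R)
    (ρ : Representation ℂ Rˣ V) (η : ℂ) (hη : η * η = 1) (v : V) (hv : v ≠ 0)
    (hfix : ∀ h : Rˣ, unitsAut σ h = h → ρ h v = v)
    (hneg : ∀ n : Rˣ, unitsAut σ n = -n → ρ n v = η • v) :
    ∃ l : Module.Dual ℂ V, l v ≠ 0 ∧ (∀ h : Rˣ, unitsAut σ h = h → ∀ w, l (ρ h w) = l w) ∧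
      ∀ n : Rˣ, unitsAut σ n = -n → ∀ w, l (ρ n w) = η * l w := by
  classical
  have : Fintype Rˣ := Fintype.ofFinite _
  obtain ⟨l₀, hl₀⟩ : ∃ f : Module.Dual ℂ V, f v ≠ 0 := by
    by_contra! h
    exact hv ((Module.forall_dual_apply_eq_zero_iff ℂ _).1 h)
  let c : Rˣ → ℂ := fun g =>
    (if unitsAut σ g = g then 1 else 0) + η * (if unitsAut σ g = -g then 1 else 0)
  let l : Module.Dual ℂ V := ∑ g : Rˣ, c g • (l₀ ∘ₗ ρ g)
  have hl : ∀ w, l w = ∑ g : Rˣ, c g * l₀ (ρ g w) := by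
    intro w
    simp [l, LinearMap.sum_apply]
  refine ⟨l, ?_, ?_, ?_⟩
  · have hterm : ∀ g : Rˣ, c g * l₀ (ρ g v) =
        (((if unitsAut σ g = g then 1 else 0) + (if unitsAut σ g = -g then 1 else 0) : ℕ) : ℂ)
          * l₀ v := by
      intro g
      simp only [c]
      by_cases h₁ : unitsAut σ g = g <;> by_cases h₂ : unitsAut σ g = -g
      · have h3 := hfix g h₁
        have h4 := hneg g h₂
        have h5 : η * l₀ v = l₀ v := by rw [← smul_eq_mul, ← map_smul, ← h4, h3]
        simp only [h₁, if_true, h3]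
        simp only [if_pos (h₁.symm.trans h₂)]
        push_cast
        linear_combination h5
      · simp only [if_pos h₁, if_neg h₂, hfix g h₁]
        simp
      · simp only [if_neg h₁, if_pos h₂, hneg g h₂, map_smul, smul_eq_mul]
        push_cast
        linear_combination l₀ v * hη
      · simp [h₁, h₂]
    rw [hl, Finset.sum_congr rfl fun g _ => hterm g, ← Finset.sum_mul, ← Nat.cast_sum]
    refine mul_ne_zero ?_ hl₀
    rw [Nat.cast_ne_zero]
    have h1 := Finset.single_le_sum
      (f := fun g : Rˣ => (if unitsAut σ g = g then 1 else 0) + (if unitsAut σ g = -g then 1 else 0))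
      (fun g _ => Nat.zero_le _) (Finset.mem_univ (1 : Rˣ))
    simp only [map_one, if_true] at h1
    omega
  · intro h hh w
    rw [hl, hl]
    refine Fintype.sum_equiv (Equiv.mulRight h) _ _ fun g => ?_
    have hc : c (g * h) = c g := by
      simp only [c, map_mul, hh, ← neg_mul, mul_left_inj]
    rw [Equiv.coe_mulRight, hc, map_mul, Module.End.mul_apply]
  · intro n hn w
    rw [hl, hl, Finset.mul_sum]
    refine Fintype.sum_equiv (Equiv.mulRight n) _ _ fun g => ?_
    have hc : η * c (g * n) = c g := by
      have e1 : (unitsAut σ g * -n = g * n) ↔ unitsAut σ g = -g := by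
        rw [mul_neg, neg_eq_iff_eq_neg, ← neg_mul, mul_left_inj]
      have e2 : (unitsAut σ g * -n = -(g * n)) ↔ unitsAut σ g = g := by
        rw [mul_neg, neg_inj, mul_left_inj]
      simp only [c, map_mul, hn, e1, e2]
      linear_combination (if unitsAut σ g = g then (1 : ℂ) else 0) * hη
    rw [Equiv.coe_mulRight, map_mul, Module.End.mul_apply, ← hc, ← mul_assoc]

theorem IsRingCuspidal.trace_eq [Finite R] [FiniteDimensional ℂ V] (h2 : IsUnit (2 : R))
    (σ : R ≃+* R) (hσ : ∀ a, σ (σ a) = a) {ρ : Representation ℂ Rˣ V} (hirr : IsIrred ρ)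
    (hρ : IsRingCuspidal ρ) (v₀ : V) (hv₀ : v₀ ≠ 0)
    (hfix₀ : ∀ h : Rˣ, unitsAut σ h = h → ρ h v₀ = v₀) (g : Rˣ) :
    LinearMap.trace ℂ V (ρ (unitsAut σ g)) = LinearMap.trace ℂ V (ρ g⁻¹) := by
  have : Fintype Rˣ := Fintype.ofFinite _
  obtain ⟨η, hη, v, hv, hfix, hneg⟩ := exists_eigenvector σ ρ v₀ hv₀ hfix₀
  obtain ⟨l, hlv, hlfix, hlneg⟩ := exists_functional σ ρ η hη v hv hfix hneg
  have hs : ∀ g, unitsAut σ (unitsAut σ g) = g := fun g => Units.ext (hσ _)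
  have hval : ∀ g, ((unitsAut σ g : Rˣ) : R) = σ g := fun g => rfl
  have key : ∀ g, l (ρ g v) ≠ 0 → l (ρ (unitsAut σ g)⁻¹ v) = l (ρ g v) := by
    intro g hg
    set x : Rˣ := g * (unitsAut σ g)⁻¹ with hxdef
    have hx' : x * unitsAut σ g = g := by simp [hxdef]
    have hx : (x : R) * σ g = g := congrArg Units.val hx'
    have hsx : unitsAut σ x = x⁻¹ := by
      simp only [hxdef, map_mul, map_inv, hs, _root_.mul_inv_rev, inv_inv]
    have hz : ∃ z : Rˣ, z * x = x * z ∧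
        (unitsAut σ z = x⁻¹ * z ∨ unitsAut σ z = -(x⁻¹ * z)) := by
      obtain ⟨m, hm, hy⟩ := exists_pow_isIdempotentElem (1 + (x : R))
      by_cases hy1 : (1 + (x : R)) ^ m = 1
      · obtain ⟨z, hz⟩ : IsUnit (1 + (x : R)) := IsUnit.of_pow_eq_one hy1 hm.ne'
        refine ⟨z, ?_, Or.inl ?_⟩
        · ext
          simp [hz, mul_add, add_mul]
        · ext
          rw [hval, Units.val_mul, hz, map_add, map_one, ← hval, hsx, mul_add, mul_one,
            Units.inv_mul, add_comm]
      by_cases hy0 : (1 + (x : R)) ^ m = 0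
      · obtain ⟨z, hz⟩ : IsUnit (1 - (x : R)) := by
          have hnil : IsNilpotent (1 + (x : R)) := ⟨m, hy0⟩
          have : (1 : R) - x = -(1 + x) + 2 := by rw [← one_add_one_eq_two]; abel
          rw [this]
          refine IsNilpotent.isUnit_add_right_of_commute hnil.neg h2 ?_
          exact (Commute.ofNat_right _ 2)
        refine ⟨z, ?_, Or.inr ?_⟩
        · ext
          simp [hz, mul_sub, sub_mul]
        · ext
          rw [hval, Units.val_neg, Units.val_mul, hz, map_sub, map_one, ← hval, hsx, mul_sub,
            mul_one, Units.inv_mul, neg_sub]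
      · exfalso
        refine hg (hρ.apply_eq_zero hy hy0 hy1 l _ fun u hu => ?_)
        obtain ⟨M₁, M₂, hM, hM₁, hM₂, hf₁, hf₂⟩ :=
          exists_add_of_commute σ hσ g x hx _ hy m rfl _ hu
        let u₁ := horosphericalUnit hM₁
        let u₂ := horosphericalUnit hM₂
        have hv₁ : (u₁ : R) = 1 + M₁ := rfl
        have hv₂ : (u₂ : R) = 1 + M₂ := rfl
        have hu12 : u = u₁ * u₂ := by
          ext
          rw [Units.val_mul, hv₁, hv₂, mul_add, add_mul, add_mul,
            mul_eq_zero_of_mem_horospherical hM₁ hM₂, ← sub_add_cancel (u : R) 1, hM]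
          simp only [one_mul, mul_one, add_zero]
          abel
        have h₁ : unitsAut σ u₁ = u₁ := by
          ext
          rw [hval, hv₁, map_add, map_one, hf₁]
        have h₂ : unitsAut σ (g⁻¹ * u₂ * g) = g⁻¹ * u₂ * g := by
          ext
          have : ((g⁻¹ * u₂ * g : Rˣ) : R) = 1 + ↑g⁻¹ * M₂ * g := by
            simp [hv₂, mul_add, add_mul]
          rw [hval, this, map_add, map_one, hf₂]
        have hu2 : ρ u₂ (ρ g v) = ρ g v := by
          conv_rhs => rw [← hfix _ h₂]
          simp only [← Module.End.mul_apply, ← map_mul]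
          congr 2
          group
        rw [hu12, map_mul, Module.End.mul_apply, hu2, hlfix _ h₁]
    obtain ⟨z, hzx, hz⟩ := hz
    have hsg : unitsAut σ g = x⁻¹ * g := by rw [eq_inv_mul_iff_mul_eq, hx']
    set n := g⁻¹ * z with hn
    set n' := z * unitsAut σ g with hn'
    have hgn : (unitsAut σ g)⁻¹ = n * g * n'⁻¹ := by
      rw [eq_mul_inv_iff_mul_eq, inv_mul_eq_iff_eq_mul, hn', hn, hsg]
      have : x⁻¹ * z = z * x⁻¹ := by
        rw [inv_mul_eq_iff_eq_mul, ← mul_assoc, ← hzx, mul_assoc, mul_inv_cancel, mul_one]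
      calc z * (x⁻¹ * g) = (x⁻¹ * z) * g := by rw [this, mul_assoc]
        _ = _ := by group
    have hinvcomm : x⁻¹ * z = z * x⁻¹ := by
      rw [inv_mul_eq_iff_eq_mul, ← mul_assoc, ← hzx, mul_assoc, mul_inv_cancel, mul_one]
    rw [hgn]
    rcases hz with hz | hz
    · have h₁ : unitsAut σ n = n := by
        rw [hn, map_mul, map_inv, hsg, hz]
        group
      have h₂ : unitsAut σ n'⁻¹ = n'⁻¹ := by
        rw [map_inv, hn', map_mul, hs, hz, hsg, hinvcomm, mul_assoc]
      rw [map_mul, map_mul, Module.End.mul_apply, Module.End.mul_apply, hfix _ h₂, hlfix _ h₁]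
    · have h₁ : unitsAut σ n = -n := by
        rw [hn, map_mul, map_inv, hsg, hz, mul_neg]
        group
      have h₂ : unitsAut σ n'⁻¹ = -n'⁻¹ := by
        rw [map_inv, hn', map_mul, hs, hz, hsg, hinvcomm, neg_mul, inv_neg, mul_assoc]
      rw [map_mul, map_mul, Module.End.mul_apply, Module.End.mul_apply, hneg _ h₂, hlneg _ h₁,
        map_smul, map_smul, smul_eq_mul, ← mul_assoc, hη, one_mul]
  refine trace_eq_of_coefficient_symm hirr (unitsAut σ) v l hlv (fun g => ?_) hs g
  by_cases hg : l (ρ g v) = 0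
  · by_contra hne
    rw [hg] at hne
    have := key _ hne
    rw [map_inv (unitsAut σ), hs, inv_inv, hg] at this
    exact hne this.symm
  · exact key g hg

end UnitGroup

section GeneralLinear

variable {F : Type*} [Field F]

theorem exists_basis_of_isIdempotentElem {n : ℕ} {y : Matrix (Fin n) (Fin n) F}
    (hy : IsIdempotentElem y) (hy0 : y ≠ 0) (hy1 : y ≠ 1) :
    ∃ (d : ℕ) (g : GL (Fin n) F), 0 < d ∧ d < n ∧
      y * (g : Matrix (Fin n) (Fin n) F) =
        g.val * Matrix.diagonal fun i : Fin n => if (i : ℕ) < d then 0 else 1 := by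
  let f := Matrix.toLin' y
  have hf : IsIdempotentElem f := by
    rw [IsIdempotentElem, Module.End.mul_eq_comp, ← Matrix.toLin'_mul, hy.eq]
  have hc : IsCompl (LinearMap.ker f) (LinearMap.range f) :=
    (LinearMap.IsIdempotentElem.isCompl hf).symm
  have hdim := f.finrank_range_add_finrank_ker
  rw [Module.finrank_fin_fun] at hdim
  let d := Module.finrank F (LinearMap.ker f)
  let s := Module.finrank F (LinearMap.range f)
  have hds : d + s = n := by omega
  let β₀ : Module.Basis (Fin d ⊕ Fin s) F (Fin n → F) :=
    ((Module.finBasis F (LinearMap.ker f)).prod (Module.finBasis F (LinearMap.range f))).map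
      (Submodule.prodEquivOfIsCompl _ _ hc)
  let β := β₀.reindex (finSumFinEquiv.trans (finCongr hds))
  have hβ : ∀ i, f (β i) = (if (i : ℕ) < d then (0 : F) else 1) • β i := by
    intro i
    obtain ⟨i, rfl⟩ := (finSumFinEquiv.trans (finCongr hds)).surjective i
    simp only [β, Module.Basis.reindex_apply, Equiv.symm_apply_apply]
    rcases i with i | i
    · simp [β₀]
    · have : ∀ x ∈ LinearMap.range f, f x = x := by
        rintro _ ⟨x, rfl⟩
        exact LinearMap.congr_fun hf x
      simp [β₀, this]
  let P := (Pi.basisFun F (Fin n)).toMatrix β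
  have : Invertible P := (Pi.basisFun F (Fin n)).invertibleToMatrix β
  refine ⟨d, unitOfInvertible P, ?_, ?_, ?_⟩
  · rw [Nat.pos_iff_ne_zero]
    intro hd
    apply hy1
    have : f = LinearMap.id := β.ext fun i => by simp [hβ, hd]
    rw [← LinearMap.toMatrix'_toLin' y]
    change LinearMap.toMatrix' f = 1
    rw [this, LinearMap.toMatrix'_id]
  · by_contra hd
    apply hy0
    have : f = 0 := β.ext fun i => by
      have : (i : ℕ) < d := by omega
      simp [hβ, this]
    rw [← LinearMap.toMatrix'_toLin' y]
    change LinearMap.toMatrix' f = 0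
    rw [this, map_zero]
  · ext i j
    rw [Matrix.mul_diagonal]
    have := congrFun (hβ j) i
    simp only [f, Matrix.toLin'_apply, Pi.smul_apply, smul_eq_mul] at this
    simp only [val_unitOfInvertible, P, Module.Basis.toMatrix_apply, Pi.basisFun_repr]
    rw [mul_comm, ← this]
    simp [Matrix.mul_apply, Matrix.mulVec, dotProduct, Module.Basis.toMatrix_apply]

theorem IsCuspidal.isRingCuspidal [Fintype F] {n : ℕ} {V : Type*} [AddCommGroup V] [Module ℂ V]
    {ρ : Representation ℂ (GL (Fin n) F) V} (hρ : IsCuspidal ρ) :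
    IsRingCuspidal (R := Matrix (Fin n) (Fin n) F) ρ := by
  intro y hy hy0 hy1 v hv
  obtain ⟨d, g, hd0, hdn, hg⟩ := exists_basis_of_isIdempotentElem hy hy0 hy1
  let b : Fin n → Fin 2 := fun i => if (i : ℕ) < d then 0 else 1
  have hv' : ρ g⁻¹ v = 0 := by
    refine hρ 2 le_rfl b ?_ ?_ _ fun u hu => ?_
    · intro i j hij
      rw [Fin.le_def] at hij
      by_cases h : (j : ℕ) < d
      · have : (i : ℕ) < d := by omega
        simp [b, h, this]
      · simp only [b, h, if_false]
        exact Fin.le_last _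
    · intro i
      fin_cases i
      · exact ⟨⟨0, by omega⟩, by simp [b, hd0]⟩
      · exact ⟨⟨d, hdn⟩, by simp [b]⟩
    · have hN : ∀ i j, b j ≤ b i → ((u : Matrix (Fin n) (Fin n) F) - 1) i j = 0 := by
        intro i j hij
        rw [Matrix.sub_apply, hu i j hij, Matrix.one_apply, sub_self]
      have hconj : ((g * u * g⁻¹ : GL (Fin n) F) : Matrix (Fin n) (Fin n) F) - 1 =
          g.val * ((u : Matrix (Fin n) (Fin n) F) - 1) * ((g⁻¹ : GL (Fin n) F) : Matrix _ _ F) := by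
        rw [mul_sub, sub_mul, mul_one, Units.mul_inv, Units.val_mul, Units.val_mul]
      have hg' : ((g⁻¹ : GL (Fin n) F) : Matrix (Fin n) (Fin n) F) * y =
          (Matrix.diagonal fun i : Fin n => if (i : ℕ) < d then 0 else 1) *
            ((g⁻¹ : GL (Fin n) F) : Matrix (Fin n) (Fin n) F) := by
        have := congrArg (fun z => ((g⁻¹ : GL (Fin n) F) : Matrix (Fin n) (Fin n) F) * z *
          ((g⁻¹ : GL (Fin n) F) : Matrix (Fin n) (Fin n) F)) hg
        simpa only [mul_assoc, Units.mul_inv, mul_one, Units.inv_mul_cancel_left] using this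
      have hfix := hv (g * u * g⁻¹) (by
        rw [hconj]
        refine ⟨?_, ?_⟩
        · rw [← mul_assoc, ← mul_assoc, hg, mul_assoc (g : Matrix (Fin n) (Fin n) F)]
          have : (Matrix.diagonal fun i : Fin n => if (i : ℕ) < d then (0 : F) else 1) *
              ((u : Matrix (Fin n) (Fin n) F) - 1) = 0 := by
            ext i j
            rw [Matrix.diagonal_mul, Matrix.zero_apply]
            split_ifs with h
            · rw [zero_mul]
            · rw [hN i j (by simp only [b, h, if_false]; exact Fin.le_last _), mul_zero]
          rw [this, mul_zero, zero_mul]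
        · rw [mul_assoc, hg', ← mul_assoc, mul_assoc (g : Matrix (Fin n) (Fin n) F)]
          congr 2
          ext i j
          rw [Matrix.mul_diagonal]
          split_ifs with h
          · rw [hN i j (by simp [b, h]), zero_mul]
          · rw [mul_one])
      rw [map_mul, map_mul, Module.End.mul_apply, Module.End.mul_apply] at hfix
      simpa only [ρ.inv_self_apply] using congrArg (ρ g⁻¹) hfix
  rw [← ρ.self_inv_apply g v, hv', map_zero]

/-- A linear map on `A` vanishing on `A ⊓ K` extends to the whole space, vanishing on `K` and
without enlarging the image of `A`. -/
theorem exists_extend_eqOn {E : Type*} [AddCommGroup E] [Module F E] (A K : Submodule F E)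
    (n : E →ₗ[F] E) (hn : ∀ v ∈ A, v ∈ K → n v = 0) :
    ∃ N : E →ₗ[F] E, (∀ v ∈ A, N v = n v) ∧ (∀ v ∈ K, N v = 0) ∧ ∀ v, ∃ a ∈ A, N v = n a := by
  obtain ⟨A', hA'⟩ := Submodule.exists_isCompl (K.comap A.subtype)
  let A₁ := A'.map A.subtype
  have hdisj : Disjoint A₁ K := by
    rw [Submodule.disjoint_def]
    rintro _ ⟨x, hx, rfl⟩ hxK
    have : x ∈ K.comap A.subtype ⊓ A' := ⟨hxK, hx⟩
    rw [hA'.inf_eq_bot, Submodule.mem_bot] at this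
    rw [this, map_zero]
  obtain ⟨C, hKC, hC⟩ := hdisj.symm.exists_isCompl
  let P := A₁.projection C hC.symm
  have hP₁ : ∀ v ∈ A₁, P v = v := fun v hv => Submodule.projection_apply_left hC.symm ⟨v, hv⟩
  have hP₂ : ∀ v ∈ K, P v = 0 := fun v hv =>
    (Submodule.projection_apply_eq_zero_iff hC.symm).2 (hKC hv)
  refine ⟨n ∘ₗ P, ?_, ?_, ?_⟩
  · intro v hv
    have h : (⟨v, hv⟩ : A) ∈ K.comap A.subtype ⊔ A' := by
      rw [hA'.sup_eq_top]
      trivial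
    obtain ⟨x, hx, y, hy, hxy⟩ := Submodule.mem_sup.1 h
    have hv' : (x : E) + y = v := congrArg Subtype.val hxy
    have hPy : P y = y := hP₁ _ (Submodule.mem_map_of_mem hy)
    rw [LinearMap.comp_apply, ← hv', map_add, hP₂ x hx, zero_add, hPy, map_add, hn x x.2 hx,
      zero_add]
  · intro v hv
    rw [LinearMap.comp_apply, hP₂ v hv, map_zero]
  · intro v
    refine ⟨P v, ?_, rfl⟩
    have : P v ∈ A₁ := Submodule.projection_apply_mem hC.symm v
    exact Submodule.map_subtype_le A A' this

variable (F) in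
/-- The standard flag: vectors supported on the first `i` blocks. -/
def flag (k r i : ℕ) : Submodule F (Fin k → Fin r → F) where
  carrier := {v | ∀ j : Fin k, i ≤ j → v j = 0}
  zero_mem' := fun _ _ => rfl
  add_mem' := by
    intro a b ha hb j hj
    rw [Pi.add_apply, ha j hj, hb j hj, add_zero]
  smul_mem' := by
    intro c a ha j hj
    rw [Pi.smul_apply, ha j hj, smul_zero]

section Flag

variable {k r : ℕ}

theorem flag_mono {i j : ℕ} (h : i ≤ j) : flag F k r i ≤ flag F k r j :=
  fun _ hv l hl => hv l (h.trans hl)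

theorem mem_flag_self (v : Fin k → Fin r → F) : v ∈ flag F k r k :=
  fun j hj => absurd j.2 (by omega)

theorem eq_zero_of_mem_flag_zero {v : Fin k → Fin r → F} (h : v ∈ flag F k r 0) : v = 0 :=
  funext fun j => h j (Nat.zero_le _)

theorem single_mem_flag (j : Fin k) (w : Fin r → F) : Pi.single j w ∈ flag F k r (j + 1) := by
  intro l hl
  rw [Pi.single_eq_of_ne]
  rintro rfl
  omega

theorem sub_single_mem_flag {j : Fin k} {v : Fin k → Fin r → F}
    (hv : v ∈ flag F k r (j + 1)) : v - Pi.single j (v j) ∈ flag F k r j := by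
  intro l hl
  rcases eq_or_ne l j with rfl | h
  · simp
  · have : (l : ℕ) ≠ j := fun h' => h (Fin.ext h')
    rw [Pi.sub_apply, Pi.single_eq_of_ne h, hv l (by omega), sub_zero]

theorem eq_single_of_mem_flag_one [NeZero k] {v : Fin k → Fin r → F} (hv : v ∈ flag F k r 1) :
    v = Pi.single 0 (v 0) := by
  have := sub_single_mem_flag (j := (0 : Fin k)) (by simpa using hv)
  rw [← sub_eq_zero]
  exact eq_zero_of_mem_flag_zero (by simpa using this)

theorem single_zero_mem_flag [NeZero k] {i : ℕ} (hi : 1 ≤ i) (w : Fin r → F) :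
    Pi.single 0 w ∈ flag F k r i :=
  flag_mono (by simpa using hi) (single_mem_flag (0 : Fin k) w)

variable {τ : F →+* F} [RingHomInvPair τ τ]

/-- `h` commutes with the semilinear map `S`, preserves the standard flag, and has diagonal
blocks `d`. -/
structure IsAdapted (S : (Fin k → Fin r → F) ≃ₛₗ[τ] (Fin k → Fin r → F))
    (d : Fin k → GL (Fin r) F) (h : (Fin k → Fin r → F) →ₗ[F] (Fin k → Fin r → F)) : Prop where
  commute : ∀ v, h (S v) = S (h v)
  flag_le : ∀ i, ∀ v ∈ flag F k r i, h v ∈ flag F k r i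
  diag : ∀ i w, h (Pi.single i w) i = (d i).val *ᵥ w

theorem IsAdapted.injective {S : (Fin k → Fin r → F) ≃ₛₗ[τ] (Fin k → Fin r → F)}
    {d : Fin k → GL (Fin r) F} {h : (Fin k → Fin r → F) →ₗ[F] (Fin k → Fin r → F)}
    (hh : IsAdapted S d h) : Function.Injective h := by
  rw [injective_iff_map_eq_zero]
  intro v hv
  have key : ∀ i : ℕ, i ≤ k → v ∈ flag F k r (k - i) := by
    intro i
    induction i with
    | zero => exact fun _ => mem_flag_self v
    | succ i ih =>
      intro hi
      let j : Fin k := ⟨k - (i + 1), by omega⟩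
      have hj : v ∈ flag F k r (j + 1) := by
        have := ih (by omega)
        rwa [show k - i = (j : ℕ) + 1 by simp only [j]; omega] at this
      have h1 := hh.flag_le j _ (sub_single_mem_flag hj) j le_rfl
      rw [map_sub, hv, zero_sub, Pi.neg_apply, hh.diag, neg_eq_zero] at h1
      have h2 : v j = 0 := by
        have := congrArg (fun z => ((d j)⁻¹).val *ᵥ z) h1
        simpa using this
      have h3 := sub_single_mem_flag hj
      rwa [h2, Pi.single_zero, sub_zero] at h3
  exact eq_zero_of_mem_flag_zero (by simpa using key k le_rfl)

theorem map_mem_flag_of_le_ker {N : (Fin k → Fin r → F) →ₗ[F] (Fin k → Fin r → F)} {a b : ℕ}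
    (hab : a ≤ b + 1) (hker : ∀ v ∈ flag F k r b, N v = 0) (hN : ∀ v, N v ∈ flag F k r a) (i : ℕ)
    (v : Fin k → Fin r → F) (hv : v ∈ flag F k r i) : N v ∈ flag F k r i := by
  by_cases h : i ≤ b
  · rw [hker v (flag_mono h hv)]
    exact zero_mem _
  · exact flag_mono (by omega) (hN v)

/-- The conjugate of `N` by the semilinear automorphism `S`. -/
def semiConj (S : (Fin k → Fin r → F) ≃ₛₗ[τ] (Fin k → Fin r → F))
    (N : (Fin k → Fin r → F) →ₗ[F] (Fin k → Fin r → F)) :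
    (Fin k → Fin r → F) →ₗ[F] (Fin k → Fin r → F) :=
  (S.toLinearMap.comp N).comp S.symm.toLinearMap

theorem semiConj_apply (S : (Fin k → Fin r → F) ≃ₛₗ[τ] (Fin k → Fin r → F))
    (N : (Fin k → Fin r → F) →ₗ[F] (Fin k → Fin r → F)) (v : Fin k → Fin r → F) :
    semiConj S N v = S (N (S.symm v)) := rfl

theorem add_semiConj_commute {S : (Fin k → Fin r → F) ≃ₛₗ[τ] (Fin k → Fin r → F)} {c : F}
    (hS : ∀ v, S (S v) = c • v) (N : (Fin k → Fin r → F) →ₗ[F] (Fin k → Fin r → F))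
    (v : Fin k → Fin r → F) : (N + semiConj S N) (S v) = S ((N + semiConj S N) v) := by
  obtain ⟨u, rfl⟩ := S.surjective v
  have h : S.symm (c • u) = S u := by rw [← hS, LinearEquiv.symm_apply_apply]
  simp only [LinearMap.add_apply, semiConj_apply, map_add, LinearEquiv.symm_apply_apply, hS, h]
  rw [map_smul, add_comm]

theorem id_add_commute {S : (Fin k → Fin r → F) ≃ₛₗ[τ] (Fin k → Fin r → F)}
    {M : (Fin k → Fin r → F) →ₗ[F] (Fin k → Fin r → F)} (hM : ∀ v, M (S v) = S (M v))
    (v : Fin k → Fin r → F) :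
    (LinearMap.id + M : (Fin k → Fin r → F) →ₗ[F] (Fin k → Fin r → F)) (S v) =
      S ((LinearMap.id + M : (Fin k → Fin r → F) →ₗ[F] (Fin k → Fin r → F)) v) := by
  rw [LinearMap.add_apply, hM, LinearMap.add_apply, map_add]
  rfl

/-- The linear map acting on the first block through `a`, and killing the other blocks. -/
def blockEnd [NeZero k] (a : Matrix (Fin r) (Fin r) F) :
    (Fin k → Fin r → F) →ₗ[F] (Fin k → Fin r → F) :=
  (LinearMap.single F (fun _ : Fin k => Fin r → F) 0).comp
    ((Matrix.mulVecLin a).comp (LinearMap.proj 0))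

theorem blockEnd_apply [NeZero k] (a : Matrix (Fin r) (Fin r) F) (v : Fin k → Fin r → F) :
    blockEnd a v = Pi.single 0 (a *ᵥ v 0) := rfl

theorem one_add_single_of_mem_flag_one [NeZero k] {N : (Fin k → Fin r → F) →ₗ[F] (Fin k → Fin r → F)}
    (hN : ∀ v, N v ∈ flag F k r 1) {a : Matrix (Fin r) (Fin r) F}
    (ha : ∀ w, N (Pi.single 0 w) 0 = (a - 1) *ᵥ w) (i : Fin k) (w : Fin r → F) :
    (Pi.single i w + N (Pi.single i w) : Fin k → Fin r → F) i =
      (Pi.mulSingle 0 a : Fin k → Matrix (Fin r) (Fin r) F) i *ᵥ w := by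
  rcases eq_or_ne i 0 with rfl | hi
  · rw [Pi.add_apply, ha, Pi.single_eq_same, Pi.mulSingle_eq_same, Matrix.sub_mulVec,
      Matrix.one_mulVec, add_sub_cancel]
  · have : (i : ℕ) ≠ 0 := fun h => hi (Fin.ext (by simpa using h))
    rw [Pi.add_apply, hN _ i (by omega), Pi.single_eq_same, add_zero,
      Pi.mulSingle_eq_of_ne hi, Matrix.one_mulVec]

theorem val_mulSingle [NeZero k] (a : GL (Fin r) F) (i : Fin k) :
    ((Pi.mulSingle 0 a : Fin k → GL (Fin r) F) i).val =
      (Pi.mulSingle 0 a.val : Fin k → Matrix (Fin r) (Fin r) F) i := by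
  rcases eq_or_ne i 0 with rfl | hi
  · simp
  · simp [Pi.mulSingle_eq_of_ne hi]

theorem blockEnd_mem_flag_one [NeZero k] (a : Matrix (Fin r) (Fin r) F) (v : Fin k → Fin r → F) :
    blockEnd a v ∈ flag F k r 1 := single_zero_mem_flag le_rfl _

theorem exists_isAdapted_of_mem_horospherical [NeZero k]
    {S : (Fin k → Fin r → F) ≃ₛₗ[τ] (Fin k → Fin r → F)} {c : F} (hS : ∀ v, S (S v) = c • v)
    {i : ℕ} {y : Matrix (Fin r) (Fin r) F}
    (hy : ∀ w, y *ᵥ w = 0 ↔ S (Pi.single 0 w) ∈ flag F k r i) (u : GL (Fin r) F)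
    (hu : u.val - 1 ∈ horospherical y) : ∃ h, IsAdapted S (Pi.mulSingle 0 u) h := by
  obtain ⟨N, hN, hNK, hNA⟩ := exists_extend_eqOn (flag F k r 1)
    ((flag F k r i).comap S.toLinearMap) (blockEnd (u.val - 1)) (by
      intro v hv hvK
      rw [Submodule.mem_comap, eq_single_of_mem_flag_one hv] at hvK
      rw [blockEnd_apply, ← hu.2, ← Matrix.mulVec_mulVec, (hy _).2 hvK, Matrix.mulVec_zero,
        Pi.single_zero])
  have hN1 : ∀ v, N v ∈ flag F k r 1 := by
    intro v
    obtain ⟨a, -, ha⟩ := hNA v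
    rw [ha]
    exact blockEnd_mem_flag_one _ _
  have hσr : ∀ v, semiConj S N v ∈ flag F k r i := by
    intro v
    obtain ⟨a, -, ha⟩ := hNA (S.symm v)
    rw [semiConj_apply, ha, blockEnd_apply, ← hy, Matrix.mulVec_mulVec, hu.1, Matrix.zero_mulVec]
  have hσk : ∀ v ∈ flag F k r i, semiConj S N v = 0 := by
    intro v hv
    rw [semiConj_apply, hNK, map_zero]
    change S (S.symm v) ∈ flag F k r i
    rwa [LinearEquiv.apply_symm_apply]
  refine ⟨LinearMap.id + (N + semiConj S N), ?_, ?_, ?_⟩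
  · exact id_add_commute (add_semiConj_commute hS N)
  · intro j v hv
    refine add_mem hv (add_mem ?_ ?_)
    · exact map_mem_flag_of_le_ker (b := 0) le_rfl
        (fun v hv => by rw [eq_zero_of_mem_flag_zero hv, map_zero]) hN1 j v hv
    · exact map_mem_flag_of_le_ker (Nat.le_succ i) hσk hσr j v hv
  · intro j w
    have hσ0 : semiConj S N (Pi.single j w) j = 0 := by
      by_cases hji : i ≤ j
      · exact hσr _ j hji
      · rw [hσk _ (flag_mono (by omega) (single_mem_flag j w)), Pi.zero_apply]
    rw [val_mulSingle, ← one_add_single_of_mem_flag_one hN1]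
    · simp [hσ0]
    · intro w
      rw [hN _ (single_zero_mem_flag le_rfl _), blockEnd_apply, Pi.single_eq_same,
        Pi.single_eq_same]

theorem exists_block [NeZero k] (S : (Fin k → Fin r → F) ≃ₛₗ[τ] (Fin k → Fin r → F)) (i : Fin k)
    (hle : ∀ w, S (Pi.single 0 w) ∈ flag F k r (i + 1))
    (hinj : ∀ w, S (Pi.single 0 w) ∈ flag F k r i → w = 0) :
    ∃ A : GL (Fin r) F, ∀ w, S (Pi.single 0 w) i = A.val *ᵥ (τ ∘ w) := by
  let L : (Fin r → F) →ₛₗ[τ] (Fin r → F) :=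
    (LinearMap.proj (φ := fun _ : Fin k => Fin r → F) i).comp
      (S.toLinearMap.comp (LinearMap.single F (fun _ : Fin k => Fin r → F) 0))
  have hL : ∀ w, L w = S (Pi.single 0 w) i := fun w => rfl
  let A : Matrix (Fin r) (Fin r) F := Matrix.of fun a b => L (Pi.single b 1) a
  have hA : ∀ w, L w = A *ᵥ (τ ∘ w) := by
    intro w
    conv_lhs => rw [pi_eq_sum_univ' w, map_sum]
    ext a
    simp only [map_smulₛₗ, Finset.sum_apply, Pi.smul_apply, smul_eq_mul, Matrix.mulVec, dotProduct,
      A, Matrix.of_apply, Function.comp_apply]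
    exact Finset.sum_congr rfl fun b _ => mul_comm _ _
  have hunit : IsUnit A := by
    rw [← Matrix.mulVec_injective_iff_isUnit, ← Matrix.coe_mulVecLin, injective_iff_map_eq_zero]
    intro x hx
    have hττ : τ ∘ (τ ∘ x) = x := by
      ext a
      exact RingHomInvPair.comp_apply_eq₂
    have h0 : L (τ ∘ x) = 0 := by
      rw [hA, hττ]
      exact hx
    have h1 : τ ∘ x = 0 := by
      apply hinj
      have := sub_single_mem_flag (hle (τ ∘ x))
      rwa [← hL, h0, Pi.single_zero, sub_zero] at this
    rw [← hττ, h1]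
    ext a
    exact map_zero τ
  exact ⟨hunit.unit, hA⟩

theorem exists_isAdapted_update [NeZero k]
    {S : (Fin k → Fin r → F) ≃ₛₗ[τ] (Fin k → Fin r → F)} {c : F} (hS : ∀ v, S (S v) = c • v)
    {i : Fin k} (hi : i ≠ 0) (hle : ∀ w, S (Pi.single 0 w) ∈ flag F k r (i + 1))
    (hinj : ∀ w, S (Pi.single 0 w) ∈ flag F k r i → w = 0)
    {A : GL (Fin r) F} (hA : ∀ w, S (Pi.single 0 w) i = A.val *ᵥ (τ ∘ w)) (a : GL (Fin r) F) :
    ∃ h, IsAdapted S (Function.update (Pi.mulSingle 0 a) i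
      (A * Matrix.GeneralLinearGroup.map τ a * A⁻¹)) h := by
  have hi1 : 1 ≤ (i : ℕ) := by
    rw [Nat.one_le_iff_ne_zero]
    exact fun h => hi (Fin.ext (by simpa using h))
  obtain ⟨N, hN, hNK, hNA⟩ := exists_extend_eqOn (flag F k r 1)
    ((flag F k r i).comap S.toLinearMap) (blockEnd (a.val - 1)) (by
      intro v hv hvK
      rw [Submodule.mem_comap, eq_single_of_mem_flag_one hv] at hvK
      rw [blockEnd_apply, hinj _ hvK, Matrix.mulVec_zero, Pi.single_zero])
  have hN1 : ∀ v, N v ∈ flag F k r 1 := by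
    intro v
    obtain ⟨a, -, ha⟩ := hNA v
    rw [ha]
    exact blockEnd_mem_flag_one _ _
  have hσr : ∀ v, semiConj S N v ∈ flag F k r (i + 1) := by
    intro v
    obtain ⟨a, -, ha⟩ := hNA (S.symm v)
    rw [semiConj_apply, ha, blockEnd_apply]
    exact hle _
  have hσk : ∀ v ∈ flag F k r i, semiConj S N v = 0 := by
    intro v hv
    rw [semiConj_apply, hNK, map_zero]
    change S (S.symm v) ∈ flag F k r i
    rwa [LinearEquiv.apply_symm_apply]
  refine ⟨LinearMap.id + (N + semiConj S N), ?_, ?_, ?_⟩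
  · exact id_add_commute (add_semiConj_commute hS N)
  · intro j v hv
    refine add_mem hv (add_mem ?_ ?_)
    · exact map_mem_flag_of_le_ker (b := 0) le_rfl
        (fun v hv => by rw [eq_zero_of_mem_flag_zero hv, map_zero]) hN1 j v hv
    · exact map_mem_flag_of_le_ker le_rfl hσk hσr j v hv
  · intro j w
    rcases eq_or_ne j i with rfl | hji
    · obtain ⟨x, rfl⟩ : ∃ x, w = A.val *ᵥ (τ ∘ x) := by
        refine ⟨τ ∘ ((A⁻¹).val *ᵥ w), ?_⟩
        have hττ : τ ∘ (τ ∘ ((A⁻¹).val *ᵥ w)) = (A⁻¹).val *ᵥ w := by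
          ext a
          exact RingHomInvPair.comp_apply_eq₂
        rw [hττ, Matrix.mulVec_mulVec, Units.mul_inv, Matrix.one_mulVec]
      have h1 := hσk _ (sub_single_mem_flag (hle x))
      rw [map_sub, sub_eq_zero, semiConj_apply, LinearEquiv.symm_apply_apply,
        hN _ (single_zero_mem_flag le_rfl _), blockEnd_apply, Pi.single_eq_same, hA] at h1
      have h2 := congrFun h1 j
      rw [hA] at h2
      have h3 : τ ∘ ((a.val - 1) *ᵥ x) = a.val.map τ *ᵥ (τ ∘ x) - τ ∘ x := by
        rw [Matrix.sub_mulVec, Matrix.one_mulVec]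
        ext b
        simp [Matrix.mulVec, dotProduct, map_sum]
      rw [Function.update_self, LinearMap.add_apply, LinearMap.add_apply, Pi.add_apply,
        Pi.add_apply, ← h2, hN1 _ j hi1, h3, zero_add, LinearMap.id_apply, Pi.single_eq_same,
        Matrix.mulVec_sub, add_sub_cancel, Units.val_mul, Units.val_mul, Matrix.mulVec_mulVec,
        Matrix.mulVec_mulVec, mul_assoc _ _ A.val, Units.inv_mul, mul_one]
      rfl
    · have hσ0 : semiConj S N (Pi.single j w) j = 0 := by
        by_cases hij : (i : ℕ) + 1 ≤ j
        · exact hσr _ j hij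
        · have : (j : ℕ) ≠ i := fun h => hji (Fin.ext h)
          rw [hσk _ (flag_mono (by omega) (single_mem_flag j w)), Pi.zero_apply]
      rw [Function.update_of_ne hji, val_mulSingle, ← one_add_single_of_mem_flag_one hN1]
      · simp [hσ0]
      · intro w
        rw [hN _ (single_zero_mem_flag le_rfl _), blockEnd_apply, Pi.single_eq_same,
          Pi.single_eq_same]

theorem exists_isAdapted_of_fixed [NeZero k] (h2 : (2 : F) ≠ 0)
    {S : (Fin k → Fin r → F) ≃ₛₗ[τ] (Fin k → Fin r → F)} {c : F} (hS : ∀ v, S (S v) = c • v)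
    {A : GL (Fin r) F} (hA : ∀ w, S (Pi.single 0 w) = Pi.single 0 (A.val *ᵥ (τ ∘ w)))
    {a : GL (Fin r) F} (ha : A * Matrix.GeneralLinearGroup.map τ a * A⁻¹ = a) :
    ∃ h, IsAdapted S (Pi.mulSingle 0 a) h := by
  let n : (Fin k → Fin r → F) →ₗ[F] (Fin k → Fin r → F) := blockEnd (a.val - 1)
  let N := (2⁻¹ : F) • (n + semiConj S n)
  have hτ2 : τ 2⁻¹ = 2⁻¹ := by rw [map_inv₀, map_ofNat]
  have hσr : ∀ v, N v ∈ flag F k r 1 := by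
    intro v
    refine Submodule.smul_mem _ _ (add_mem (blockEnd_mem_flag_one _ _) ?_)
    rw [semiConj_apply, blockEnd_apply, hA]
    exact single_zero_mem_flag le_rfl _
  have hAa : A.val * a.val.map τ = a.val * A.val := by
    rw [mul_inv_eq_iff_eq_mul] at ha
    exact congrArg Units.val ha
  have hσn : ∀ w, semiConj S n (Pi.single 0 w) = n (Pi.single 0 w) := by
    intro w
    obtain ⟨x, rfl⟩ : ∃ x, w = A.val *ᵥ (τ ∘ x) := by
      refine ⟨τ ∘ ((A⁻¹).val *ᵥ w), ?_⟩
      have hττ : τ ∘ (τ ∘ ((A⁻¹).val *ᵥ w)) = (A⁻¹).val *ᵥ w := by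
        ext a
        exact RingHomInvPair.comp_apply_eq₂
      rw [hττ, Matrix.mulVec_mulVec, Units.mul_inv, Matrix.one_mulVec]
    have h3 : τ ∘ ((a.val - 1) *ᵥ x) = a.val.map τ *ᵥ (τ ∘ x) - τ ∘ x := by
      rw [Matrix.sub_mulVec, Matrix.one_mulVec]
      ext b
      simp [Matrix.mulVec, dotProduct, map_sum]
    rw [← hA, semiConj_apply, LinearEquiv.symm_apply_apply, hA, blockEnd_apply, blockEnd_apply, hA,
      Pi.single_eq_same, Pi.single_eq_same, h3, Matrix.mulVec_sub, Matrix.mulVec_mulVec, hAa,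
      Matrix.sub_mulVec, Matrix.one_mulVec, Matrix.mulVec_mulVec]
  refine ⟨LinearMap.id + N, ?_, ?_, ?_⟩
  · refine id_add_commute fun v => ?_
    rw [LinearMap.smul_apply, add_semiConj_commute hS, LinearMap.smul_apply, map_smulₛₗ, hτ2]
  · intro j v hv
    refine add_mem hv ?_
    exact map_mem_flag_of_le_ker (b := 0) le_rfl
      (fun v hv => by rw [eq_zero_of_mem_flag_zero hv, map_zero]) hσr j v hv
  · intro j w
    rw [val_mulSingle, ← one_add_single_of_mem_flag_one hσr]
    · rfl
    · intro w
      rw [LinearMap.smul_apply, LinearMap.add_apply, hσn, ← two_smul F, smul_smul,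
        inv_mul_cancel₀ h2, one_smul, blockEnd_apply, Pi.single_eq_same, Pi.single_eq_same]

theorem exists_isIdempotentElem_mulVec_eq_zero (D : Submodule F (Fin r → F)) (hD : D ≠ ⊥)
    (hD' : D ≠ ⊤) : ∃ y : Matrix (Fin r) (Fin r) F, IsIdempotentElem y ∧ y ≠ 0 ∧ y ≠ 1 ∧
      ∀ w, y *ᵥ w = 0 ↔ w ∈ D := by
  obtain ⟨C, hC⟩ := Submodule.exists_isCompl D
  let P := C.projection D hC.symm
  have hy : ∀ w, LinearMap.toMatrix' P *ᵥ w = 0 ↔ w ∈ D := by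
    intro w
    rw [← Matrix.toLin'_apply, Matrix.toLin'_toMatrix', Submodule.projection_apply_eq_zero_iff]
  refine ⟨LinearMap.toMatrix' P, ?_, ?_, ?_, hy⟩
  · rw [IsIdempotentElem, ← LinearMap.toMatrix'_mul,
      (Submodule.isIdempotentElem_projection hC.symm).eq]
  · intro h
    refine hD' (Submodule.eq_top_iff'.2 fun w => (hy w).1 ?_)
    rw [h, Matrix.zero_mulVec]
  · intro h
    refine hD (D.eq_bot_iff.2 fun w hw => ?_)
    simpa [h] using (hy w).2 hw

/-- The relative position of the standard flag and its image under `S`. -/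
theorem isAdapted_trichotomy [NeZero k] (h2 : (2 : F) ≠ 0) (hr : 1 ≤ r)
    {S : (Fin k → Fin r → F) ≃ₛₗ[τ] (Fin k → Fin r → F)} {c : F} (hS : ∀ v, S (S v) = c • v) :
    (∃ y : Matrix (Fin r) (Fin r) F, IsIdempotentElem y ∧ y ≠ 0 ∧ y ≠ 1 ∧
      ∀ u : GL (Fin r) F, u.val - 1 ∈ horospherical y →
        ∃ h, IsAdapted S (Pi.mulSingle 0 u) h) ∨
    (∃ i : Fin k, i ≠ 0 ∧ ∃ A : GL (Fin r) F, ∀ a, ∃ h, IsAdapted S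
      (Function.update (Pi.mulSingle 0 a) i (A * Matrix.GeneralLinearGroup.map τ a * A⁻¹)) h) ∨
    (∃ A : GL (Fin r) F, (∀ w, A.val *ᵥ (τ ∘ (A.val *ᵥ (τ ∘ w))) = c • w) ∧
      ∀ a, A * Matrix.GeneralLinearGroup.map τ a * A⁻¹ = a →
        ∃ h, IsAdapted S (Pi.mulSingle 0 a) h) := by
  classical
  have hex : ∃ i : ℕ, ∃ w : Fin r → F, w ≠ 0 ∧ S (Pi.single 0 w) ∈ flag F k r i := by
    refine ⟨k, fun _ => 1, fun h => one_ne_zero (congrFun h ⟨0, hr⟩), mem_flag_self _⟩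
  obtain ⟨w₀, hw₀, hw₀S⟩ := Nat.find_spec hex
  have hmin := fun j => Nat.find_min (m := j) hex
  generalize Nat.find hex = i at hw₀S hmin
  have hmin' : ∀ j < i, ∀ w, S (Pi.single 0 w) ∈ flag F k r j → w = 0 := by
    intro j hj w hw
    by_contra hw0
    exact hmin j hj ⟨w, hw0, hw⟩
  by_cases hle : ∀ w, S (Pi.single 0 w) ∈ flag F k r i
  · have hi0 : i ≠ 0 := by
      rintro rfl
      have := eq_zero_of_mem_flag_zero hw₀S
      rw [EmbeddingLike.map_eq_zero_iff] at this
      exact hw₀ (by simpa using congrFun this 0)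
    have hik : i ≤ k := by
      by_contra! h
      exact hw₀ (hmin' k h w₀ (mem_flag_self _))
    let i₀ : Fin k := ⟨i - 1, by omega⟩
    have hi₀ : (i₀ : ℕ) + 1 = i := by simp only [i₀]; omega
    have hle' : ∀ w, S (Pi.single 0 w) ∈ flag F k r (i₀ + 1) := by rwa [hi₀]
    have hinj := hmin' i₀ (by omega)
    obtain ⟨A, hA⟩ := exists_block S i₀ hle' hinj
    by_cases h0 : i₀ = 0
    · have hA' : ∀ w, S (Pi.single 0 w) = Pi.single 0 (A.val *ᵥ (τ ∘ w)) := by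
        intro w
        rw [h0] at hA
        rw [← hA]
        refine eq_single_of_mem_flag_one ?_
        simpa [h0] using hle' w
      refine Or.inr (Or.inr ⟨A, fun w => ?_, fun a ha => exists_isAdapted_of_fixed h2 hS hA' ha⟩)
      have := congrFun (hS (Pi.single 0 w)) 0
      rw [hA', hA', Pi.single_eq_same] at this
      simpa using this
    · exact Or.inr (Or.inl ⟨i₀, h0, A, exists_isAdapted_update hS h0 hle' hinj hA⟩)
  · left
    obtain ⟨y, hy, hy0, hy1, hyD⟩ := exists_isIdempotentElem_mulVec_eq_zero
      ((flag F k r i).comap (S.toLinearMap.comp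
        (LinearMap.single F (fun _ : Fin k => Fin r → F) 0)))
      (fun h => hw₀ ((Submodule.eq_bot_iff _).1 h w₀ hw₀S))
      (fun h => hle fun w => Submodule.eq_top_iff'.1 h w)
    exact ⟨y, hy, hy0, hy1, fun u hu =>
      exists_isAdapted_of_mem_horospherical hS (fun w => hyD w) u hu⟩

theorem emb_eq (i : Fin k) (a : Fin r) : emb i a = finProdFinEquiv (i, a) := by
  ext
  simp [emb, mul_comm, add_comm]

variable (F k r) in
/-- Splitting a vector of length `k * r` into `k` blocks of length `r`. -/
def blockEquiv : (Fin (k * r) → F) ≃ₗ[F] (Fin k → Fin r → F) :=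
  (LinearEquiv.funCongrLeft F F finProdFinEquiv).trans (LinearEquiv.curry F F (Fin k) (Fin r))

theorem blockEquiv_apply (v : Fin (k * r) → F) (i : Fin k) (a : Fin r) :
    blockEquiv F k r v i a = v (emb i a) := by
  rw [emb_eq]
  rfl

theorem blockEquiv_single (j : Fin k) (b : Fin r) :
    blockEquiv F k r (Pi.single (emb j b) 1) = Pi.single j (Pi.single b 1) := by
  ext i a
  have h : emb i a = emb j b ↔ i = j ∧ a = b := by
    rw [emb_eq, emb_eq, EmbeddingLike.apply_eq_iff_eq, Prod.mk.injEq]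
  rw [blockEquiv_apply, Pi.single_apply, if_congr h rfl rfl, Pi.single_apply]
  by_cases h : i = j <;> simp [h, Pi.single_apply]

/-- The semilinear automorphism `v ↦ B τ(v)`, read in blocks. -/
def blockSemi (τ : F →+* F) [RingHomInvPair τ τ] (B : GL (Fin (k * r)) F) :
    (Fin k → Fin r → F) ≃ₛₗ[τ] (Fin k → Fin r → F) where
  toFun v := blockEquiv F k r (B.val *ᵥ (τ ∘ (blockEquiv F k r).symm v))
  map_add' v w := by
    rw [← map_add, ← Matrix.mulVec_add]
    congr 2
    ext x
    simp
  map_smul' c v := by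
    rw [← map_smul, ← Matrix.mulVec_smul]
    congr 2
    ext x
    simp
  invFun v := blockEquiv F k r (τ ∘ ((B⁻¹).val *ᵥ (blockEquiv F k r).symm v))
  left_inv v := by
    beta_reduce
    rw [LinearEquiv.symm_apply_apply, Matrix.mulVec_mulVec, Units.inv_mul, Matrix.one_mulVec,
      ← LinearEquiv.eq_symm_apply]
    ext x
    exact RingHomInvPair.comp_apply_eq₂
  right_inv v := by
    beta_reduce
    rw [LinearEquiv.symm_apply_apply]
    have : τ ∘ (τ ∘ ((B⁻¹).val *ᵥ (blockEquiv F k r).symm v)) =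
        (B⁻¹).val *ᵥ (blockEquiv F k r).symm v := by
      ext x
      exact RingHomInvPair.comp_apply_eq₂
    rw [this, Matrix.mulVec_mulVec, Units.mul_inv, Matrix.one_mulVec,
      LinearEquiv.apply_symm_apply]

theorem blockSemi_blockEquiv (B : GL (Fin (k * r)) F) (v : Fin (k * r) → F) :
    blockSemi τ B (blockEquiv F k r v) = blockEquiv F k r (B.val *ᵥ (τ ∘ v)) := by
  change blockEquiv F k r (B.val *ᵥ (τ ∘ (blockEquiv F k r).symm (blockEquiv F k r v))) = _
  rw [LinearEquiv.symm_apply_apply]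

theorem comp_mulVec {n : Type*} [Fintype n] (τ : F →+* F) (M : Matrix n n F) (v : n → F) :
    τ ∘ (M *ᵥ v) = M.map τ *ᵥ (τ ∘ v) := by
  ext b
  simp [Matrix.mulVec, dotProduct, map_sum]

theorem blockSemi_blockSemi {B : GL (Fin (k * r)) F} {c : F}
    (hB : B.val * B.val.map τ = Matrix.scalar _ c) (v : Fin k → Fin r → F) :
    blockSemi τ B (blockSemi τ B v) = c • v := by
  obtain ⟨v, rfl⟩ := (blockEquiv F k r).surjective v
  have : τ ∘ (τ ∘ v) = v := by
    ext x
    exact RingHomInvPair.comp_apply_eq₂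
  rw [blockSemi_blockEquiv, blockSemi_blockEquiv, comp_mulVec, this, Matrix.mulVec_mulVec, hB,
    ← map_smul]
  congr 1
  ext x
  simp

theorem IsAdapted.exists_matrix {B : GL (Fin (k * r)) F} {d : Fin k → GL (Fin r) F}
    {h : (Fin k → Fin r → F) →ₗ[F] (Fin k → Fin r → F)} (hh : IsAdapted (blockSemi τ B) d h) :
    ∃ p : GL (Fin (k * r)) F, IsParab p.val ∧
      (∀ i a b, (d i).val a b = p.val (emb i a) (emb i b)) ∧
      B * Matrix.GeneralLinearGroup.map τ p * B⁻¹ = p := by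
  let e := blockEquiv F k r
  let M := LinearMap.toMatrix' (e.symm.toLinearMap ∘ₗ h ∘ₗ e.toLinearMap)
  have hM : ∀ v, M *ᵥ v = e.symm (h (e v)) := fun v => by
    rw [← Matrix.toLin'_apply, Matrix.toLin'_toMatrix']
    rfl
  have hentry : ∀ i j a b, M (emb i a) (emb j b) = h (Pi.single j (Pi.single b 1)) i a := by
    intro i j a b
    have h1 := congrFun (hM (Pi.single (emb j b) 1)) (emb i a)
    rw [← blockEquiv_apply (e.symm _)] at h1
    simpa [e, blockEquiv_single] using h1
  have hunit : IsUnit M := by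
    rw [← Matrix.mulVec_injective_iff_isUnit]
    intro v w hvw
    simp only [hM] at hvw
    exact e.injective (hh.injective (e.symm.injective hvw))
  have hcomm : B.val * M.map τ = M * B.val := by
    apply Matrix.ext_of_mulVec_single
    intro i
    obtain ⟨u, hu⟩ : ∃ u : Fin (k * r) → F, τ ∘ u = Pi.single i 1 :=
      ⟨τ ∘ Pi.single i 1, funext fun x => RingHomInvPair.comp_apply_eq₂⟩
    rw [← hu, ← Matrix.mulVec_mulVec, ← Matrix.mulVec_mulVec, ← comp_mulVec, hM, hM]
    apply e.injective
    rw [LinearEquiv.apply_symm_apply, ← blockSemi_blockEquiv, ← blockSemi_blockEquiv]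
    exact (congrArg _ (e.apply_symm_apply _)).trans (hh.commute _).symm
  refine ⟨hunit.unit, ?_, ?_, ?_⟩
  · intro i j a b hij
    change M _ _ = 0
    rw [hentry, hh.flag_le _ _ (single_mem_flag j _) i hij]
    rfl
  · intro i a b
    change _ = M _ _
    rw [hentry, hh.diag]
    simp
  · rw [mul_inv_eq_iff_eq_mul]
    ext1
    exact hcomm

end Flag

end GeneralLinear

section Contraction

variable {V : Type*} [AddCommGroup V] [Module ℂ V] {k : ℕ}

/-- Contracting a tensor against functionals, one on each factor. -/
noncomputable def contraction (w : PiTensorProduct ℂ fun _ : Fin k => V) :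
    MultilinearMap ℂ (fun _ : Fin k => Module.Dual ℂ V) ℂ :=
  ((LinearMap.applyₗ w).comp PiTensorProduct.dualDistrib).compMultilinearMap
    (PiTensorProduct.tprod ℂ)

theorem contraction_apply (w : PiTensorProduct ℂ fun _ : Fin k => V)
    (l : Fin k → Module.Dual ℂ V) :
    contraction w l = PiTensorProduct.dualDistrib (PiTensorProduct.tprod ℂ l) w := rfl

theorem contraction_map (f : Fin k → V →ₗ[ℂ] V) (w : PiTensorProduct ℂ fun _ : Fin k => V)
    (l : Fin k → Module.Dual ℂ V) :
    contraction (PiTensorProduct.map f w) l = contraction w fun i => l i ∘ₗ f i := by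
  rw [contraction_apply, contraction_apply, ← LinearMap.comp_apply]
  congr 1
  ext v
  simp

variable [FiniteDimensional ℂ V]

theorem exists_contraction_ne_zero {w : PiTensorProduct ℂ fun _ : Fin k => V} (hw : w ≠ 0) :
    ∃ l, contraction w l ≠ 0 := by
  let β := Module.finBasis ℂ V
  let γ := Basis.piTensorProduct fun _ : Fin k => β
  obtain ⟨p, hp⟩ : ∃ p, γ.coord p w ≠ 0 := by
    by_contra! h
    exact hw ((γ.forall_coord_eq_zero_iff).1 h)
  refine ⟨fun i => β.coord (p i), ?_⟩
  convert hp using 1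
  rw [contraction_apply]
  congr 1
  ext v
  simp [γ]

/-- A nonzero tensor has a nonzero slice in the first factor. -/
theorem exists_fixed_of_map_eq [NeZero k] {G : Type*} [Group G] (ρ : Representation ℂ G V)
    {w : PiTensorProduct ℂ fun _ : Fin k => V} (hw : w ≠ 0) :
    ∃ x : V, x ≠ 0 ∧ ∀ u : G,
      PiTensorProduct.map (fun i => ρ ((Pi.mulSingle 0 u : Fin k → G) i)) w = w → ρ u x = x := by
  obtain ⟨l, hl⟩ := exists_contraction_ne_zero hw
  let x := (Module.evalEquiv ℂ V).symm ((contraction w).toLinearMap l 0)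
  have hx : ∀ f : Module.Dual ℂ V, f x = contraction w (Function.update l 0 f) := by
    intro f
    rw [← Module.Dual.eval_apply ℂ V, ← Module.evalEquiv_toLinearMap]
    simp [x]
  refine ⟨x, ?_, fun u hu => ?_⟩
  · intro h0
    apply hl
    have := hx (l 0)
    rwa [h0, map_zero, Function.update_eq_self, eq_comm] at this
  · rw [← sub_eq_zero, ← Module.forall_dual_apply_eq_zero_iff ℂ]
    intro f
    rw [map_sub, sub_eq_zero, ← LinearMap.comp_apply, hx, hx]
    conv_rhs => rw [← hu, contraction_map]
    congr 1
    ext1 i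
    rcases eq_or_ne i 0 with rfl | hi
    · simp
    · simp only [Function.update_of_ne hi, Pi.mulSingle_eq_of_ne hi, map_one]
      rfl

/-- A nonzero tensor has a nonzero slice in any two factors. -/
theorem exists_bilinear_of_map_eq [NeZero k] {G : Type*} [Group G] (ρ : Representation ℂ G V)
    {w : PiTensorProduct ℂ fun _ : Fin k => V} (hw : w ≠ 0) {i : Fin k} (hi : i ≠ 0) :
    ∃ b : Module.Dual ℂ V →ₗ[ℂ] V, b ≠ 0 ∧ ∀ g g' : G,
      PiTensorProduct.map
        (fun j => ρ (Function.update (Pi.mulSingle 0 g : Fin k → G) i g' j)) w = w →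
      ∀ f, ρ g' (b (f ∘ₗ ρ g)) = b f := by
  obtain ⟨l, hl⟩ := exists_contraction_ne_zero hw
  have hdual : ∀ (z : Module.Dual ℂ (Module.Dual ℂ V)) (f : Module.Dual ℂ V),
      f ((Module.evalEquiv ℂ V).symm z) = z f := by
    intro z f
    rw [← Module.Dual.eval_apply ℂ V, ← Module.evalEquiv_toLinearMap]
    simp
  let b : Module.Dual ℂ V →ₗ[ℂ] V :=
    { toFun := fun f => (Module.evalEquiv ℂ V).symm
        ((contraction w).toLinearMap (Function.update l 0 f) i)
      map_add' := by
        intro f f'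
        rw [← map_add]
        congr 1
        ext f''
        simp only [MultilinearMap.toLinearMap_apply, LinearMap.add_apply,
          Function.update_comm hi.symm, MultilinearMap.map_update_add]
      map_smul' := by
        intro c f
        rw [RingHom.id_apply, ← map_smul]
        congr 1
        ext f''
        simp only [MultilinearMap.toLinearMap_apply, LinearMap.smul_apply,
          Function.update_comm hi.symm, MultilinearMap.map_update_smul] }
  have hb : ∀ f f' : Module.Dual ℂ V,
      f' (b f) = contraction w (Function.update (Function.update l 0 f) i f') :=
    fun f f' => hdual _ f'
  refine ⟨b, ?_, fun g g' hg f => ?_⟩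
  · intro h0
    apply hl
    have := hb (l 0) (l i)
    rwa [h0, LinearMap.zero_apply, map_zero, Function.update_eq_self, Function.update_eq_self,
      eq_comm] at this
  · rw [← sub_eq_zero, ← Module.forall_dual_apply_eq_zero_iff ℂ]
    intro f'
    rw [map_sub, sub_eq_zero, ← LinearMap.comp_apply, hb, hb]
    conv_rhs => rw [← hg, contraction_map]
    congr 1
    ext1 j
    rcases eq_or_ne j i with rfl | hji
    · simp
    rcases eq_or_ne j 0 with rfl | hj
    · simp [Function.update_of_ne hji]
    · simp only [Function.update_of_ne hji, Function.update_of_ne hj, Pi.mulSingle_eq_of_ne hj,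
        map_one]
      rfl

end Contraction

section Twist

variable {F : Type*} [Field F] {n : ℕ}

theorem val_map_map {τ : F →+* F} (hτ : ∀ x, τ (τ x) = x) (M : Matrix (Fin n) (Fin n) F) :
    (M.map τ).map τ = M := by
  ext i j
  exact hτ _

theorem map_map_eq {τ : F →+* F} (hτ : ∀ x, τ (τ x) = x) (g : GL (Fin n) F) :
    Matrix.GeneralLinearGroup.map τ (Matrix.GeneralLinearGroup.map τ g) = g :=
  Units.ext (val_map_map hτ g.val)

/-- The ring automorphism `M ↦ A τ(M) A⁻¹`, for `A τ(A)` central. -/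
def twistedConj {τ : F →+* F} (A : GL (Fin n) F)
    (hA : ∀ M : Matrix (Fin n) (Fin n) F,
      A.val * (A.val * M.map τ * (A⁻¹).val).map τ * (A⁻¹).val = M) :
    Matrix (Fin n) (Fin n) F ≃+* Matrix (Fin n) (Fin n) F where
  toFun M := A.val * M.map τ * (A⁻¹).val
  invFun M := A.val * M.map τ * (A⁻¹).val
  left_inv := hA
  right_inv := hA
  map_mul' M N := by
    rw [Matrix.map_mul]
    simp only [mul_assoc, Units.inv_mul_cancel_left]
  map_add' M N := by
    rw [Matrix.map_add τ (map_add τ), mul_add, add_mul]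

theorem twistedConj_twistedConj {τ : F →+* F} (hτ : ∀ x, τ (τ x) = x) {A : GL (Fin n) F} {c : F}
    (hA : A.val * A.val.map τ = Matrix.scalar _ c) (M : Matrix (Fin n) (Fin n) F) :
    A.val * (A.val * M.map τ * (A⁻¹).val).map τ * (A⁻¹).val = M := by
  have h1 : (A⁻¹).val.map τ * (A⁻¹).val * (A.val * A.val.map τ) = 1 := by
    rw [mul_assoc, Units.inv_mul_cancel_left, ← Matrix.map_mul, Units.inv_mul,
      Matrix.map_one τ (map_zero τ) (map_one τ)]
  have h2 : Matrix.scalar (Fin n) c * M = M * Matrix.scalar (Fin n) c :=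
    Matrix.scalar_commute c (Commute.all c) M
  rw [Matrix.map_mul, Matrix.map_mul, val_map_map hτ]
  have h3 : A.val * (A.val.map τ * M * (A⁻¹).val.map τ) * (A⁻¹).val =
      M * ((A.val * A.val.map τ) * ((A⁻¹).val.map τ * (A⁻¹).val)) := by
    rw [← mul_assoc M, hA, ← h2, ← hA]
    simp only [mul_assoc]
  rw [h3, mul_eq_one_comm.1 h1, mul_one]

theorem exists_scalar_of_involutive {τ : F →+* F} (hτ : ∀ x, τ (τ x) = x) (B : GL (Fin n) F)
    (hinvol : ∀ g, B * Matrix.GeneralLinearGroup.map τ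
      (B * Matrix.GeneralLinearGroup.map τ g * B⁻¹) * B⁻¹ = g) :
    ∃ c, B.val * B.val.map τ = Matrix.scalar _ c := by
  have h : B * Matrix.GeneralLinearGroup.map τ B ∈ Subgroup.center (GL (Fin n) F) := by
    rw [Subgroup.mem_center_iff]
    intro g
    conv_lhs => rw [← hinvol g]
    rw [map_mul, map_mul, map_map_eq hτ, map_inv]
    group
  rw [Matrix.GeneralLinearGroup.mem_center_iff_val_mem_range_scalar] at h
  obtain ⟨c, hc⟩ := h
  exact ⟨c, hc.symm⟩

end Twist

theorem IsIrred.exists_apply_ne_zero {G V W : Type*} [Group G] [AddCommGroup V] [Module ℂ V]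
    [AddCommGroup W] [Module ℂ W] {π : Representation ℂ G V} (hπ : IsIrred π) {T : V →ₗ[ℂ] W}
    (hT : T ≠ 0) {v : V} (hv : v ≠ 0) : ∃ g, T (π g v) ≠ 0 := by
  by_contra! h
  let U := Submodule.span ℂ (Set.range fun g => π g v)
  have hle : U ≤ LinearMap.ker T := by
    rw [Submodule.span_le]
    rintro _ ⟨g, rfl⟩
    exact h g
  rcases hπ.2 U (fun g x hx => by
    induction hx using Submodule.span_induction with
    | mem x hx =>
      obtain ⟨g', rfl⟩ := hx
      exact Submodule.subset_span ⟨g * g', by simp⟩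
    | zero => rw [map_zero]; exact zero_mem _
    | add x y _ _ hx hy => rw [map_add]; exact add_mem hx hy
    | smul c x _ hx => rw [map_smul]; exact Submodule.smul_mem _ _ hx) with h0 | h0
  · apply hv
    have : v ∈ U := Submodule.subset_span ⟨1, by simp⟩
    rwa [h0] at this
  · apply hT
    rwa [h0, top_le_iff, LinearMap.ker_eq_top] at hle

/-- Conjugation does not change the character. -/
theorem trace_conj_eq {G V : Type*} [Group G] [AddCommGroup V] [Module ℂ V]
    (ρ : Representation ℂ G V) (a g : G) :
    LinearMap.trace ℂ V (ρ (a * g * a⁻¹)) = LinearMap.trace ℂ V (ρ g) := by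
  rw [map_mul, LinearMap.trace_mul_comm, ← map_mul, ← mul_assoc,
    inv_mul_cancel, one_mul]

/-- Let `q` be an odd prime power, `F` a finite field of characteristic
dividing `q`, and `τ` an involutive field automorphism of `F` applied entrywise.
Let `B ∈ GL_{rk}(F)` be such that `σ(X) = B·τ(X)·B⁻¹` is an involutive automorphism of
`GL_{rk}(F)` with fixed points `H`, and let `ρ` be an irreducible cuspidal complex
representation of `GL_r(F)`.  If some irreducible constituent of the parabolic
induction of `ρ^{⊗k}` to `GL_{rk}(F)` has a nonzero `H`-fixed vector, then
`χ_ρ(τ(g)) = χ_ρ(g⁻¹)` for all `g ∈ GL_r(F)`. -/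
theorem stmt9 (q : ℕ) (hq : Odd q) (hq' : IsPrimePow q)
    (F : Type) [Field F] [Fintype F] (hcharF : ringChar F ∣ q)
    (τ : F ≃+* F) (hτ : ∀ x, τ (τ x) = x)
    (r k : ℕ) (hr : 1 ≤ r) (hk : 1 ≤ k)
    (B : GL (Fin (k * r)) F)
    (hinvol : ∀ g : GL (Fin (k * r)) F,
      B * Matrix.GeneralLinearGroup.map (τ : F →+* F)
          (B * Matrix.GeneralLinearGroup.map (τ : F →+* F) g * B⁻¹) * B⁻¹ = g)
    (V : Type) [AddCommGroup V] [Module ℂ V] [FiniteDimensional ℂ V]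
    (ρ : Representation ℂ (GL (Fin r) F) V)
    (hρirr : IsIrred ρ) (hρcusp : IsCuspidal ρ)
    (Vπ : Type) [AddCommGroup Vπ] [Module ℂ Vπ] [FiniteDimensional ℂ Vπ]
    (π : Representation ℂ (GL (Fin (k * r)) F) Vπ) (hπirr : IsIrred π)
    (hconst : ∃ T : Vπ →ₗ[ℂ] PiTensorProduct ℂ (fun _ : Fin k => V),
      T ≠ 0 ∧ IntertwinesParab ρ π T)
    (v : Vπ) (hv : v ≠ 0)
    (hfix : ∀ g : GL (Fin (k * r)) F,
      B * Matrix.GeneralLinearGroup.map (τ : F →+* F) g * B⁻¹ = g → π g v = v) :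
    ∀ g : GL (Fin r) F,
      LinearMap.trace ℂ V (ρ (Matrix.GeneralLinearGroup.map (τ : F →+* F) g)) =
        LinearMap.trace ℂ V (ρ g⁻¹) := by
  have : NeZero k := ⟨by omega⟩
  let τ' : F →+* F := τ
  have hτ' : ∀ x, τ' (τ' x) = x := hτ
  have : RingHomInvPair τ' τ' := ⟨RingHom.ext hτ, RingHom.ext hτ⟩
  have h2 : (2 : F) ≠ 0 := by
    refine Ring.two_ne_zero fun h => ?_
    rw [h] at hcharF
    exact Nat.not_even_iff_odd.2 hq (even_iff_two_dvd.2 hcharF)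
  have hcusp := hρcusp.isRingCuspidal
  obtain ⟨c, hc⟩ := exists_scalar_of_involutive hτ' B hinvol
  obtain ⟨T, hT, hTint⟩ := hconst
  obtain ⟨g₀, hw⟩ := hπirr.exists_apply_ne_zero hT hv
  let B' := g₀ * B * (Matrix.GeneralLinearGroup.map τ' g₀)⁻¹
  have hB' : B'.val * B'.val.map τ' = Matrix.scalar _ c := by
    have h1 : B' * Matrix.GeneralLinearGroup.map τ' B' =
        g₀ * (B * Matrix.GeneralLinearGroup.map τ' B) * g₀⁻¹ := by
      simp only [B', map_mul, map_inv, map_map_eq hτ']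
      group
    have h2 : B'.val * B'.val.map τ' = g₀.val * (B.val * B.val.map τ') * (g₀⁻¹).val :=
      congrArg Units.val h1
    rw [h2, hc, ← (Matrix.scalar_commute c (Commute.all c) g₀.val).eq, mul_assoc, Units.mul_inv,
      mul_one]
  have hinv : ∀ d : Fin k → GL (Fin r) F, (∃ h, IsAdapted (blockSemi τ' B') d h) →
      PiTensorProduct.map (fun i => ρ (d i)) (T (π g₀ v)) = T (π g₀ v) := by
    rintro d ⟨h, hh⟩
    obtain ⟨p, hp, hpd, hpB⟩ := hh.exists_matrix
    rw [← hTint p hp d hpd]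
    congr 1
    have h1 := hfix (g₀⁻¹ * p * g₀) (by
      change B * Matrix.GeneralLinearGroup.map τ' _ * B⁻¹ = _
      conv_rhs => rw [← hpB]
      simp only [B', map_mul, map_inv]
      group)
    rw [map_mul, map_mul, Module.End.mul_apply, Module.End.mul_apply] at h1
    simpa only [π.self_inv_apply] using congrArg (π g₀) h1
  intro g
  change LinearMap.trace ℂ V (ρ (Matrix.GeneralLinearGroup.map τ' g)) = _
  rcases isAdapted_trichotomy h2 hr (blockSemi_blockSemi hB') with
    ⟨y, hy, hy0, hy1, hu⟩ | ⟨i, hi, A, hA⟩ | ⟨A, hAc, hA⟩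
  · obtain ⟨x, hx, hfixed⟩ := exists_fixed_of_map_eq ρ hw
    exact absurd (hcusp y hy hy0 hy1 x fun u huy => hfixed u (hinv _ (hu u huy))) hx
  · obtain ⟨b, hb, hbinv⟩ := exists_bilinear_of_map_eq ρ hw hi
    rw [← trace_conj_eq ρ A]
    refine trace_eq_of_intertwiner hρirr
      (fun a => A * Matrix.GeneralLinearGroup.map τ' a * A⁻¹) (fun a => ?_) b hb
      (fun a => hbinv _ _ (hinv _ (hA a))) g
    refine ⟨Matrix.GeneralLinearGroup.map τ' (A⁻¹ * a * A), ?_⟩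
    beta_reduce
    rw [map_map_eq hτ']
    group
  · obtain ⟨x, hx, hfixed⟩ := exists_fixed_of_map_eq ρ hw
    have hAc' : A.val * A.val.map τ' = Matrix.scalar _ c := by
      apply Matrix.ext_of_mulVec_single
      intro i
      have h1 := hAc (Pi.single i 1)
      rw [comp_mulVec, show τ' ∘ τ' ∘ Pi.single i (1 : F) = Pi.single i 1 from
        funext fun x => hτ' _, Matrix.mulVec_mulVec] at h1
      rw [h1]
      ext x
      simp [Pi.single_apply]
    let σ := twistedConj A (twistedConj_twistedConj hτ' hAc')
    have hσ : ∀ a, unitsAut σ a = A * Matrix.GeneralLinearGroup.map τ' a * A⁻¹ :=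
      fun a => Units.ext rfl
    rw [← trace_conj_eq ρ A, ← hσ]
    refine hcusp.trace_eq ?_ σ (twistedConj_twistedConj hτ' hAc') hρirr x hx
      (fun a ha => hfixed a (hinv _ (hA a (by rw [← hσ, ha])))) g
    have h := (IsUnit.mk0 (2 : F) h2).map (algebraMap F (Matrix (Fin r) (Fin r) F))
    rwa [map_ofNat] at h
end
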